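/- Let k ≥ 2 and n ∈ ℕ with 2n ≥ k² + 3. There exists δ_0 ∈ (0,1), depending only on n and k, such that for every δ ∈ (δ_0, 1) and every collection of bounded intervals (a_{ij}, b_{ij}) ⊆ ℝ (1 ≤ i < j ≤ k), for Haar-almost every g ∈ SL_{2n}(ℝ) the following holds: there exist a constant c_g > 0 depending only on g, n and k (not on the intervals nor on δ) and constants C, T_0 > 0 such that for all T > T_0, |N_{g,I}(T) − c_g · ∏_{1≤i<j≤k}(b_{ij} − a_{ij}) · T^{2nk − k(k−1)}| ≤ C · T^{δ(2nk − k(k−1))}, where N_{g,I}(T) = #{(v_1, …, v_k) ∈ (ℤ^{2n})^k : ⟨v_i, v_j⟩^g ∈ (a_{ij}, b_{ij}) for all 1 ≤ i < j ≤ k, and ‖v_ℓ‖ < T for all 1 ≤ ℓ ≤ k}. -/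

import Mathlib

open Matrix MeasureTheory

noncomputable section

abbrev Pairs (k : ℕ) := {p : Fin k × Fin k // p.1 < p.2}

/-- The standard symplectic matrix `J_n` with block form `(0 Iₙ; -Iₙ 0)`. -/
def Jmat (n : ℕ) : Matrix (Fin (2*n)) (Fin (2*n)) ℝ :=
  fun i j => if (i : ℕ) + n = (j : ℕ) then 1 else if (j : ℕ) + n = (i : ℕ) then -1 else 0

/-- The standard symplectic form `⟨v,w⟩ = vᵀ Jₙ w` on `ℝ^{2n}`. -/
def symp (n : ℕ) (v w : Fin (2*n) → ℝ) : ℝ := v ⬝ᵥ (Jmat n).mulVec w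

abbrev SL2n (n : ℕ) := Matrix.SpecialLinearGroup (Fin (2*n)) ℝ

/-- The symplectic form `⟨v,w⟩^g = ⟨g v, g w⟩` attached to `g ∈ SL_{2n}(ℝ)`. -/
def sympG (n : ℕ) (g : SL2n n) (v w : Fin (2*n) → ℝ) : ℝ :=
  symp n ((g : Matrix (Fin (2*n)) (Fin (2*n)) ℝ).mulVec v)
         ((g : Matrix (Fin (2*n)) (Fin (2*n)) ℝ).mulVec w)

/-- Euclidean norm on `ℝ^d` (presented as `Fin d → ℝ`). -/
def enorm2 {d : ℕ} (v : Fin d → ℝ) : ℝ := Real.sqrt (∑ i, (v i)^2)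

instance (m : ℕ) : MeasurableSpace (Matrix (Fin m) (Fin m) ℝ) := MeasurableSpace.pi

noncomputable instance (m : ℕ) : TopologicalSpace (Matrix.SpecialLinearGroup (Fin m) ℝ) :=
  instTopologicalSpaceSubtype

instance (m : ℕ) : MeasurableSpace (Matrix.SpecialLinearGroup (Fin m) ℝ) :=
  Subtype.instMeasurableSpace

/-- The exponent `2nk - k(k-1)` as a real number. -/
def expo (n k : ℕ) : ℝ := ((2*n*k : ℕ) : ℝ) - ((k*(k-1) : ℕ) : ℝ)

/-- The counting function `N_{g,I}(T)`: the number of integer tuples `(v_1,…,v_k)`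
with `⟨v_i,v_j⟩^g ∈ (a_{ij},b_{ij})` for `i < j` and `‖v_ℓ‖ < T`. -/
def Ncount (n k : ℕ) (g : SL2n n) (a b : Pairs k → ℝ) (T : ℝ) : ℕ :=
  Nat.card {v : Fin k → (Fin (2*n) → ℤ) |
    (∀ p : Pairs k, sympG n g (fun j => ((v p.1.1 j : ℤ) : ℝ))
        (fun j => ((v p.1.2 j : ℤ) : ℝ)) ∈ Set.Ioo (a p) (b p)) ∧
    ∀ l, enorm2 (fun j => ((v l j : ℤ) : ℝ)) < T}

section
abbrev WW (p : ℕ) := Fin p → ℂ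
def om {p : ℕ} (u v : WW p) : ℝ := ∑ i, ((u i).re * (v i).im - (u i).im * (v i).re)
def nn {p : ℕ} (u : WW p) : ℝ := ‖(WithLp.toLp 2 u : EuclideanSpace ℂ (Fin p))‖

lemma om_eq_inner {p : ℕ} (u v : WW p) :
    om u v = (inner ℂ (WithLp.toLp 2 u : EuclideanSpace ℂ (Fin p)) (WithLp.toLp 2 v)).im := by
  simp only [om, PiLp.inner_apply, Complex.im_sum]
  refine Finset.sum_congr rfl fun i _ => ?_
  simp
  ring

lemma nn_sq_cons {p : ℕ} (c : ℂ) (u : WW p) :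
    nn (Fin.cons c u : WW (p+1)) ^ 2 = ‖c‖ ^ 2 + nn u ^ 2 := by
  simp [nn, EuclideanSpace.norm_sq_eq, Fin.sum_univ_succ]

lemma nn_nonneg {p : ℕ} (u : WW p) : 0 ≤ nn u := norm_nonneg _
lemma nn_pos {p : ℕ} {u : WW p} (h : u ≠ 0) : 0 < nn u := by
  rw [nn, norm_pos_iff]; intro h'; apply h
  ext i; have := congrArg (fun w : EuclideanSpace ℂ (Fin p) => w i) h'; simpa using this
lemma norm_le_nn {p : ℕ} (u : WW p) : ‖u‖ ≤ nn u := by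
  rw [pi_norm_le_iff_of_nonneg (nn_nonneg u)]
  intro i
  exact PiLp.norm_apply_le (WithLp.toLp 2 u : EuclideanSpace ℂ (Fin p)) i
lemma nn_continuous {p : ℕ} : Continuous (nn : WW p → ℝ) := by
  unfold nn
  exact (PiLp.continuous_toLp 2 _).norm
lemma om_continuous {p : ℕ} : Continuous (fun z : WW p × WW p => om z.1 z.2) := by
  unfold om; fun_prop

lemma exA {p : ℕ} (y : WW (p+1)) (hy : y ≠ 0) : ∃ A : WW (p+1) ≃ₗ[ℂ] WW (p+1),
    (∀ u, nn (A u) = nn u) ∧ (∀ u v, om (A u) (A v) = om u v) ∧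
    A (Fin.cons 1 0) = (((nn y)⁻¹ : ℝ) : ℂ) • y ∧ MeasurePreserving A := by
  set Y : EuclideanSpace ℂ (Fin (p+1)) := WithLp.toLp 2 y with hY
  have hs := nn_pos hy
  have ho : Orthonormal ℂ (Set.domRestrict {(0 : Fin (p+1))} (fun _ => (((nn y)⁻¹ : ℝ) : ℂ) • Y)) := by
    constructor
    · intro i
      simp only [Set.domRestrict_apply, norm_smul]
      rw [show ‖Y‖ = nn y from rfl]
      simp
      rw [abs_of_pos hs, inv_mul_cancel₀ hs.ne']
    · intro i j hij
      exact absurd (Subsingleton.elim i j) hij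
  obtain ⟨b, hb⟩ := ho.exists_orthonormalBasis_extension_of_card_eq (by simp)
  let e := WithLp.linearEquiv 2 ℂ (WW (p+1))
  let A : WW (p+1) ≃ₗ[ℂ] WW (p+1) := (e.symm.trans b.repr.symm.toLinearEquiv).trans e
  have hA : ∀ u, (WithLp.toLp 2 (A u) : EuclideanSpace ℂ (Fin (p+1))) = b.repr.symm (WithLp.toLp 2 u) := by
    intro u; rfl
  have hnn : ∀ u, nn (A u) = nn u := by
    intro u; rw [nn, hA, LinearIsometryEquiv.norm_map]; rfl
  refine ⟨A, hnn, ?_, ?_, ?_⟩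
  · intro u v; rw [om_eq_inner, om_eq_inner, hA, hA, LinearIsometryEquiv.inner_map_map]
  · have h1 : (WithLp.toLp 2 (Fin.cons 1 0 : WW (p+1)) : EuclideanSpace ℂ (Fin (p+1)))
        = EuclideanSpace.single 0 1 := by
      ext i; refine Fin.cases ?_ (fun i => ?_) i <;> simp
    have := hA (Fin.cons 1 0)
    rw [h1, OrthonormalBasis.repr_symm_single, hb 0 rfl] at this
    have h2 := congrArg (WithLp.ofLp) this
    exact h2
  · let A' : WW (p+1) ≃ₗ[ℝ] WW (p+1) := A.restrictScalars ℝ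
    let Ac : WW (p+1) ≃L[ℝ] WW (p+1) := A'.toContinuousLinearEquiv
    have hm : Measurable A := Ac.continuous.measurable
    refine ⟨hm, ?_⟩
    have : (Measure.map A volume).IsAddHaarMeasure :=
      Ac.isAddHaarMeasure_map volume
    obtain ⟨c, hc⟩ : ∃ c : ENNReal, Measure.map A volume = c • (volume : Measure (WW (p+1))) :=
      ⟨_, Measure.isAddLeftInvariant_eq_smul (Measure.map A volume) (volume : Measure (WW (p+1)))⟩
    have hball : MeasurableSet {u : WW (p+1) | nn u < 1} := (isOpen_lt nn_continuous continuous_const).measurableSet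
    have h2 := congrArg (fun m => m {u : WW (p+1) | nn u < 1}) hc
    simp only [Measure.smul_apply, Measure.map_apply hm hball] at h2
    have h3 : A ⁻¹' {u : WW (p+1) | nn u < 1} = {u : WW (p+1) | nn u < 1} := by
      ext u; simp [hnn]
    rw [h3] at h2
    have hpos : volume {u : WW (p+1) | nn u < 1} ≠ 0 := by
      refine (IsOpen.measure_pos _ (isOpen_lt nn_continuous continuous_const) ⟨0, ?_⟩).ne'
      simp [nn]
    have hfin : volume {u : WW (p+1) | nn u < 1} ≠ ⊤ := by
      refine ne_top_of_le_ne_top (measure_closedBall_lt_top (x := (0 : WW (p+1))) (r := 1)).ne (measure_mono ?_)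
      intro u hu
      simp only [mem_closedBall_zero_iff]
      exact (norm_le_nn u).trans (le_of_lt hu)
    have hc1 : c = 1 := by
      have : 1 * volume {u : WW (p+1) | nn u < 1} = c * volume {u : WW (p+1) | nn u < 1} := by
        simpa using h2
      exact ((ENNReal.mul_left_inj hpos hfin).1 this).symm
    rw [hc, hc1, one_smul]

end

section
def BX {k p : ℕ} (α β : Fin k → Fin k → ℝ) : Set (Fin k → WW p) :=
  {Y | ∀ i j, i < j → om (Y i) (Y j) ∈ Set.Ioo (α i j) (α i j + β i j)}
def pp {k : ℕ} (β : Fin k → Fin k → ℝ) : ℝ := ∏ i, ∏ j ∈ Finset.Ioi i, β i j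
def Phi {k p : ℕ} (α β : Fin k → Fin k → ℝ) (F : (Fin k → WW p) → ENNReal) : ENNReal :=
  (∫⁻ Y, (BX α β).indicator F Y) / ENNReal.ofReal (pp β)

lemma pp_pos {k : ℕ} {β : Fin k → Fin k → ℝ} (h : ∀ i j, 0 < β i j) : 0 < pp β :=
  Finset.prod_pos fun i _ => Finset.prod_pos fun j _ => h i j

lemma pp_succ {k : ℕ} (β : Fin (k+1) → Fin (k+1) → ℝ) :
    pp β = (∏ j : Fin k, β 0 j.succ) * pp (fun i j => β i.succ j.succ) := by
  simp [pp, Fin.prod_univ_succ, Fin.prod_Ioi_succ]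

lemma BX_meas {k p : ℕ} (α β : Fin k → Fin k → ℝ) : MeasurableSet (BX α β : Set (Fin k → WW p)) := by
  have : (BX α β : Set (Fin k → WW p)) = ⋂ i, ⋂ j, ⋂ (_ : i < j),
      (fun Y : Fin k → WW p => om (Y i) (Y j)) ⁻¹' Set.Ioo (α i j) (α i j + β i j) := by
    ext Y; simp [BX]
  rw [this]
  refine MeasurableSet.iInter fun i => MeasurableSet.iInter fun j => MeasurableSet.iInter fun _ => ?_
  refine measurableSet_Ioo.preimage ?_
  exact (Continuous.comp (om_continuous (p := p)) (f := fun Y : Fin k → WW p => (Y i, Y j)) (by fun_prop)).measurable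

lemma lint_scale {ι : Type*} [Fintype ι] (c d : ι → ℝ) (hd : ∀ i, 0 < d i)
    (f : (ι → ℝ) → ENNReal) (hf : Measurable f) :
    ∫⁻ t, f t = ENNReal.ofReal (∏ i, d i) * ∫⁻ x : ι → ℝ, f (fun j => c j + d j * x j) := by
  classical
  have hdet : (Matrix.diagonal d).det ≠ 0 := by
    rw [Matrix.det_diagonal]; exact (Finset.prod_pos fun i _ => hd i).ne'
  have hm : Measurable (Matrix.toLin' (Matrix.diagonal d)) :=
    (LinearMap.continuous_of_finiteDimensional _).measurable
  rw [← lintegral_add_left_eq_self f c]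
  conv_lhs => rw [← Real.smul_map_diagonal_volume_pi hdet]
  rw [lintegral_smul_measure, lintegral_map (by fun_prop) hm, Matrix.det_diagonal,
    abs_of_pos (Finset.prod_pos fun i _ => hd i)]
  simp only [smul_eq_mul]
  congr 1
  refine lintegral_congr fun x => ?_
  congr 1
  ext j
  simp [Matrix.mulVec_diagonal]

lemma lint_cons {p : ℕ} (X : Type) [MeasureSpace X] [SigmaFinite (volume : Measure X)]
    (f : (Fin (p+1) → X) → ENNReal) (hf : Measurable f) :
    ∫⁻ Y, f Y = ∫⁻ y, ∫⁻ Z, f (Fin.cons y Z) := by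
  have h := (volume_preserving_piFinSuccAbove (fun _ : Fin (p+1) => X) 0).symm
  rw [← h.lintegral_comp hf, Measure.volume_eq_prod, lintegral_prod]
  · simp [Fin.insertNthEquiv, MeasurableEquiv.piFinSuccAbove]
  · exact (hf.comp (MeasurableEquiv.measurable _)).aemeasurable

def zz {p : ℕ} (A : WW (p+1) ≃ₗ[ℂ] WW (p+1)) (t a : ℝ) (u : WW p) : WW (p+1) :=
  A (Fin.cons ⟨a, t⟩ u)

lemma lint_zz {k p : ℕ} (A : WW (p+1) ≃ₗ[ℂ] WW (p+1)) (hA : MeasurePreserving A)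
    (f : (Fin k → WW (p+1)) → ENNReal) (hf : Measurable f) :
    ∫⁻ Z, f Z = ∫⁻ t : Fin k → ℝ, ∫⁻ a : Fin k → ℝ, ∫⁻ U : Fin k → WW p,
      f (fun j => zz A (t j) (a j) (U j)) := by
  have h1 : MeasurePreserving (fun z : ℝ × (ℝ × WW p) => zz A z.1 z.2.1 z.2.2) := by
    have e1 := (volume_preserving_piFinSuccAbove (fun _ : Fin (p+1) => ℂ) 0).symm
    have e2 := Complex.volume_preserving_equiv_real_prod.symm.comp
      (Measure.measurePreserving_swap (μ := (volume : Measure ℝ)) (ν := (volume : Measure ℝ)))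
    have e3 : MeasurePreserving (fun z : (ℝ × ℝ) × WW p =>
        ((Complex.measurableEquivRealProd.symm ∘ Prod.swap) z.1, z.2)) := e2.prod (MeasurePreserving.id _)
    have e4 : MeasurePreserving (MeasurableEquiv.prodAssoc : (ℝ × ℝ) × WW p ≃ᵐ ℝ × ℝ × WW p) :=
      measurePreserving_prodAssoc _ _ _
    have := hA.comp (e1.comp (e3.comp e4.symm))
    convert! this using 1
    ext z i
    simp [zz, MeasurableEquiv.piFinSuccAbove, Fin.insertNthEquiv, MeasurableEquiv.prodAssoc, Complex.measurableEquivRealProd]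
    rfl
  have h2 : MeasurePreserving (fun (b : Fin k → ℝ × ℝ × WW p) j => zz A (b j).1 (b j).2.1 (b j).2.2) :=
    volume_preserving_pi (fun _ => h1)
  have h3 := (volume_measurePreserving_arrowProdEquivProdArrow ℝ (ℝ × WW p) (Fin k)).symm
  have h4 := (volume_measurePreserving_arrowProdEquivProdArrow ℝ (WW p) (Fin k)).symm
  have hm1 : Measurable (fun (b : Fin k → ℝ × ℝ × WW p) => f fun j => zz A (b j).1 (b j).2.1 (b j).2.2) :=
    hf.comp h2.measurable
  rw [← h2.lintegral_comp hf, ← h3.lintegral_comp hm1, Measure.volume_eq_prod, lintegral_prod]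
  · refine lintegral_congr fun t => ?_
    have hm2 : Measurable (fun b : Fin k → ℝ × WW p => f fun j => zz A (t j) (b j).1 (b j).2) := by
      exact (hm1.comp h3.measurable).comp (measurable_prodMk_left (x := t))
    refine (h4.lintegral_comp hm2).symm.trans ?_
    rw [Measure.volume_eq_prod, lintegral_prod]
    · rfl
    · exact (hm2.comp h4.measurable).aemeasurable
  · exact (hm1.comp h3.measurable).aemeasurable

end

section
def tt {k : ℕ} (α β : Fin (k+1) → Fin (k+1) → ℝ) (s : ℝ) (x : Fin k → ℝ) : Fin k → ℝ :=
  fun j => α 0 j.succ / s + (β 0 j.succ / s) * x j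
def al {k : ℕ} (α : Fin (k+1) → Fin (k+1) → ℝ) (t a : Fin k → ℝ) : Fin k → Fin k → ℝ :=
  fun i j => α i.succ j.succ - (a i * t j - t i * a j)
def FF {k p : ℕ} (F : (Fin (k+1) → WW (p+1)) → ENNReal) (A : WW (p+1) ≃ₗ[ℂ] WW (p+1))
    (y : WW (p+1)) (t a : Fin k → ℝ) : (Fin k → WW p) → ENNReal :=
  fun U => F (Fin.cons y (fun j => zz A (t j) (a j) (U j)))
def cub (k : ℕ) : Set (Fin k → ℝ) := Set.pi Set.univ (fun _ => Set.Ioo 0 1)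

lemma cub_meas (k : ℕ) : MeasurableSet (cub k) := MeasurableSet.univ_pi fun _ => measurableSet_Ioo
lemma cub_vol (k : ℕ) : volume (cub k) = 1 := by simp [cub, Real.volume_pi_Ioo]

lemma om_cons {p : ℕ} (c d : ℂ) (u v : WW p) : om (Fin.cons c u : WW (p+1)) (Fin.cons d v) =
    c.re * d.im - c.im * d.re + om u v := by
  simp [om, Fin.sum_univ_succ]; ring
lemma forall_lt_succ {k : ℕ} {P : Fin (k+1) → Fin (k+1) → Prop} :
    (∀ i j, i < j → P i j) ↔ (∀ j : Fin k, P 0 j.succ) ∧ ∀ i j : Fin k, i < j → P i.succ j.succ := by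
  constructor
  · exact fun h => ⟨fun j => h _ _ (Fin.succ_pos j), fun i j hij => h _ _ (Fin.succ_lt_succ_iff.2 hij)⟩
  · rintro ⟨h, h'⟩ i j
    refine Fin.cases ?_ (fun i => ?_) i <;> refine Fin.cases ?_ (fun j => ?_) j
    · simp
    · exact fun _ => h j
    · simp
    · exact fun hij => h' i j (Fin.succ_lt_succ_iff.1 hij)
lemma om_smul {p : ℕ} (s : ℝ) (u v : WW p) : om ((s:ℂ) • u) v = s * om u v := by
  simp only [om, Finset.mul_sum]
  refine Finset.sum_congr rfl fun i _ => ?_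
  simp; ring
lemma om_zero {p : ℕ} (v : WW p) : om 0 v = 0 := by simp [om]

lemma om_y_zz {p : ℕ} {A : WW (p+1) ≃ₗ[ℂ] WW (p+1)} {y : WW (p+1)} (hy : y ≠ 0)
    (h2 : ∀ u v, om (A u) (A v) = om u v)
    (h3 : A (Fin.cons 1 0) = (((nn y)⁻¹ : ℝ) : ℂ) • y) (t a : ℝ) (u : WW p) :
    om y (zz A t a u) = nn y * t := by
  have hs := nn_pos hy
  have : y = ((nn y : ℝ) : ℂ) • A (Fin.cons 1 0) := by
    rw [h3, smul_smul, ← Complex.ofReal_mul, mul_inv_cancel₀ hs.ne']; simp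
  rw [this, om_smul, ← this, zz, h2, om_cons]
  simp [om_zero]

lemma cons_mem_BX {k p : ℕ} {A : WW (p+1) ≃ₗ[ℂ] WW (p+1)} {y : WW (p+1)} (hy : y ≠ 0)
    (h2 : ∀ u v, om (A u) (A v) = om u v)
    (h3 : A (Fin.cons 1 0) = (((nn y)⁻¹ : ℝ) : ℂ) • y)
    (α β : Fin (k+1) → Fin (k+1) → ℝ) (hβ : ∀ i j, 0 < β i j) (x a : Fin k → ℝ) (U : Fin k → WW p) :
    (Fin.cons y (fun j => zz A (tt α β (nn y) x j) (a j) (U j)) : Fin (k+1) → WW (p+1)) ∈ BX α β ↔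
    x ∈ cub k ∧ U ∈ BX (al α (tt α β (nn y) x) a) (fun i j => β i.succ j.succ) := by
  have hs := nn_pos hy
  simp only [BX, Set.mem_ofPred_eq]
  rw [forall_lt_succ]
  simp only [Fin.cons_zero, Fin.cons_succ, om_y_zz hy h2 h3]
  refine and_congr ?_ ?_
  · simp only [cub, Set.mem_pi, Set.mem_univ, true_imp_iff]
    refine forall_congr' fun j => ?_
    have e : nn y * tt α β (nn y) x j = α 0 j.succ + β 0 j.succ * x j := by
      rw [tt]; field_simp
    rw [e, Set.mem_Ioo, Set.mem_Ioo]
    have := hβ 0 j.succ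
    constructor
    · rintro ⟨h, h'⟩
      constructor <;> nlinarith
    · rintro ⟨h, h'⟩
      constructor <;> nlinarith
  · refine forall_congr' fun i => forall_congr' fun j => imp_congr_right fun _ => ?_
    rw [zz, zz, h2, om_cons, al, Set.mem_Ioo, Set.mem_Ioo]
    simp only
    constructor
    · rintro ⟨h, h'⟩
      constructor <;> linarith
    · rintro ⟨h, h'⟩
      constructor <;> linarith

lemma sectY {k p : ℕ} {A : WW (p+1) ≃ₗ[ℂ] WW (p+1)} {y : WW (p+1)} (hy : y ≠ 0)
    (h2 : ∀ u v, om (A u) (A v) = om u v)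
    (h3 : A (Fin.cons 1 0) = (((nn y)⁻¹ : ℝ) : ℂ) • y) (h4 : MeasurePreserving A)
    (α β : Fin (k+1) → Fin (k+1) → ℝ) (hβ : ∀ i j, 0 < β i j)
    (F : (Fin (k+1) → WW (p+1)) → ENNReal) (hF : Measurable F) :
    (∫⁻ Z : Fin k → WW (p+1), (BX α β).indicator F (Fin.cons y Z)) / ENNReal.ofReal (pp β) =
      ENNReal.ofReal ((nn y ^ k)⁻¹) * ∫⁻ x : Fin k → ℝ, ∫⁻ a : Fin k → ℝ, (cub k).indicator (fun x =>
        Phi (al α (tt α β (nn y) x) a) (fun i j => β i.succ j.succ) (FF F A y (tt α β (nn y) x) a)) x := by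
  have hs := nn_pos hy
  have hcons : Measurable (fun Z : Fin k → WW (p+1) => (Fin.cons y Z : Fin (k+1) → WW (p+1))) := by
    refine measurable_pi_lambda _ fun i => ?_
    refine Fin.cases ?_ (fun i => ?_) i
    · simp
    · simpa using measurable_pi_apply i
  have hG : Measurable (fun Z : Fin k → WW (p+1) => (BX α β).indicator F (Fin.cons y Z)) :=
    (hF.indicator (BX_meas α β)).comp hcons
  have hAm : Measurable A := h4.measurable
  have hz : Measurable (fun w : (Fin k → ℝ) × (Fin k → ℝ) × (Fin k → WW p) => fun j => zz A (w.1 j) (w.2.1 j) (w.2.2 j)) := by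
    refine measurable_pi_lambda _ fun j => ?_
    refine hAm.comp ?_
    refine measurable_pi_lambda _ fun i => ?_
    refine Fin.cases ?_ (fun i => ?_) i
    · simp only [Fin.cons_zero]
      have : Measurable (fun w : ℝ × ℝ => (⟨w.1, w.2⟩ : ℂ)) := Complex.measurableEquivRealProd.symm.measurable
      exact this.comp (f := fun w : (Fin k → ℝ) × (Fin k → ℝ) × (Fin k → WW p) => (w.2.1 j, w.1 j)) (by fun_prop)
    · simp only [Fin.cons_succ]; fun_prop
  have hGz := hG.comp hz
  rw [lint_zz A h4 _ hG, lint_scale (fun j => α 0 j.succ / nn y) (fun j => β 0 j.succ / nn y)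
    (fun j => div_pos (hβ _ _) hs)]
  · have e1 : ∏ j : Fin k, β 0 j.succ / nn y = (∏ j : Fin k, β 0 j.succ) * (nn y ^ k)⁻¹ := by
      simp [Finset.prod_mul_distrib, div_eq_mul_inv]
    have hb : 0 < ∏ j : Fin k, β 0 j.succ := Finset.prod_pos fun j _ => hβ _ _
    have hb' : 0 < pp (fun i j : Fin k => β i.succ j.succ) := pp_pos fun i j => hβ _ _
    rw [e1, pp_succ, ENNReal.ofReal_mul hb.le, ENNReal.ofReal_mul hb.le, mul_assoc,
      ENNReal.mul_div_mul_left _ _ (by simpa using hb) ENNReal.ofReal_ne_top, mul_div_assoc]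
    congr 1
    rw [div_eq_mul_inv, ← lintegral_mul_const'' ]
    · refine lintegral_congr fun x => ?_
      rw [← lintegral_mul_const'']
      · refine lintegral_congr fun a => ?_
        by_cases hx : x ∈ cub k
        · rw [Set.indicator_of_mem hx, Phi, ← div_eq_mul_inv]
          congr 1
          refine lintegral_congr fun U => ?_
          have := cons_mem_BX hy h2 h3 α β hβ x a U
          simp only [hx, true_and] at this
          by_cases hU : U ∈ BX (al α (tt α β (nn y) x) a) (fun i j => β i.succ j.succ)
          · rw [Set.indicator_of_mem hU]
            exact Set.indicator_of_mem (this.2 hU) F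
          · rw [Set.indicator_of_notMem hU]
            exact Set.indicator_of_notMem (fun h => hU (this.1 h)) F
        · rw [Set.indicator_of_notMem hx]
          have : ∀ U : Fin k → WW p, (BX α β).indicator F (Fin.cons y fun j =>
              zz A (α 0 j.succ / nn y + β 0 j.succ / nn y * x j) (a j) (U j)) = 0 := fun U =>
            Set.indicator_of_notMem (fun h => hx ((cons_mem_BX hy h2 h3 α β hβ x a U).1 h).1) F
          simp [this]
      · refine Measurable.aemeasurable ?_
        refine Measurable.lintegral_prod_right' (f := fun w : (Fin k → ℝ) × (Fin k → WW p) => (BX α β).indicator F (Fin.cons y fun j =>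
              zz A (α 0 j.succ / nn y + β 0 j.succ / nn y * x j) (w.1 j) (w.2 j))) ?_
        exact hGz.comp (g := _) (f := fun w : (Fin k → ℝ) × (Fin k → WW p) =>
          ((fun j => α 0 j.succ / nn y + β 0 j.succ / nn y * x j : Fin k → ℝ), w)) (by fun_prop)
    · refine Measurable.aemeasurable ?_
      have hh : Measurable (fun w : (Fin k → ℝ) × (Fin k → ℝ) => ∫⁻ U : Fin k → WW p, (BX α β).indicator F (Fin.cons y fun j =>
              zz A (α 0 j.succ / nn y + β 0 j.succ / nn y * w.1 j) (w.2 j) (U j))) := by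
        refine Measurable.lintegral_prod_right' (f := fun w : ((Fin k → ℝ) × (Fin k → ℝ)) × (Fin k → WW p) => (BX α β).indicator F (Fin.cons y fun j =>
              zz A (α 0 j.succ / nn y + β 0 j.succ / nn y * w.1.1 j) (w.1.2 j) (w.2 j))) ?_
        exact hGz.comp (g := _) (f := fun w : ((Fin k → ℝ) × (Fin k → ℝ)) × (Fin k → WW p) =>
          ((fun j => α 0 j.succ / nn y + β 0 j.succ / nn y * w.1.1 j : Fin k → ℝ), w.1.2, w.2)) (by fun_prop)
      exact Measurable.lintegral_prod_right' hh
  · have hh : Measurable (fun w : (Fin k → ℝ) × (Fin k → ℝ) => ∫⁻ U : Fin k → WW p, (BX α β).indicator F (Fin.cons y fun j =>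
              zz A (w.1 j) (w.2 j) (U j))) := by
      refine Measurable.lintegral_prod_right' (f := fun w : ((Fin k → ℝ) × (Fin k → ℝ)) × (Fin k → WW p) => (BX α β).indicator F (Fin.cons y fun j =>
              zz A (w.1.1 j) (w.1.2 j) (w.2 j))) ?_
      exact hGz.comp (g := _) (f := fun w : ((Fin k → ℝ) × (Fin k → ℝ)) × (Fin k → WW p) =>
          (w.1.1, w.1.2, w.2)) (by fun_prop)
    exact Measurable.lintegral_prod_right' hh

end

section
lemma Phi_eq {k p : ℕ} (α β : Fin (k+1) → Fin (k+1) → ℝ) (hβ : ∀ i j, 0 < β i j)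
    (F : (Fin (k+1) → WW (p+1)) → ENNReal) (hF : Measurable F) :
    Phi α β F = ∫⁻ y, (∫⁻ Z : Fin k → WW (p+1), (BX α β).indicator F (Fin.cons y Z)) / ENNReal.ofReal (pp β) := by
  have : ENNReal.ofReal (pp β) ≠ 0 := by simpa using pp_pos hβ
  simp only [div_eq_mul_inv]
  rw [lintegral_mul_const' _ _ (ENNReal.inv_ne_top.2 this), Phi, lint_cons _ _ (hF.indicator (BX_meas α β)), div_eq_mul_inv]

lemma int_pow (p k : ℕ) (h : k ≤ p + 1) (R : ℝ) :
    ∫⁻ y : WW (p+1), {y : WW (p+1) | nn y ≤ R}.indicator (fun y => ENNReal.ofReal (nn y ^ (-((k:ℝ) + 1/2)))) y < ⊤ := by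
  have hk : (k:ℝ) ≤ p + 1 := by exact_mod_cast h
  have h1 : IntegrableOn (fun y : WW (p+1) => ‖y‖ ^ (-((k:ℝ) + 1/2))) (Metric.ball 0 (|R|+1)) := by
    rw [integrableOn_fun_norm_addHaar volume (f := fun y => y ^ (-((k:ℝ) + 1/2)))]
    have hd : Module.finrank ℝ (WW (p+1)) - 1 = 2 * p + 1 := by
      rw [Module.finrank_pi_fintype]; simp; omega
    rw [hd]
    have h2 : IntegrableOn (fun y : ℝ => y ^ (2 * (p:ℝ) + 1 - k - 1/2)) (Set.Ioo 0 (|R|+1)) := by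
      rw [intervalIntegral.integrableOn_Ioo_rpow_iff (by positivity)]
      have : (0:ℝ) ≤ p := by positivity
      linarith
    refine h2.congr_fun (fun y hy => ?_) measurableSet_Ioo
    have hy0 : 0 < y := hy.1
    simp only [smul_eq_mul]
    rw [← Real.rpow_natCast, ← Real.rpow_add hy0]
    congr 1; push_cast; ring
  refine lt_of_le_of_lt ?_ h1.lintegral_lt_top
  rw [← lintegral_indicator measurableSet_ball]
  refine lintegral_mono fun y => ?_
  by_cases hy : nn y ≤ R
  · rw [Set.indicator_of_mem (by exact hy), Set.indicator_of_mem]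
    · refine ENNReal.ofReal_le_ofReal ?_
      by_cases hy0 : y = 0
      · subst hy0; simp [nn]
      · exact Real.rpow_le_rpow_of_nonpos (norm_pos_iff.2 hy0) (norm_le_nn y) (by
          have : (0:ℝ) ≤ k := by positivity
          linarith)
    · simp only [Metric.mem_ball, dist_zero_right]
      have := norm_le_nn y; have := le_abs_self R; linarith
  · rw [Set.indicator_of_notMem (by exact hy)]; simp

def Bl {k p : ℕ} (R : ℝ) : (Fin k → WW p) → ENNReal := {Y : Fin k → WW p | ∀ i, nn (Y i) ≤ R}.indicator (fun _ => 1)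
def UBs (k p : ℕ) (R : ℝ) : Prop := ∃ C : ℝ, 0 ≤ C ∧ ∀ α β : Fin k → Fin k → ℝ, (∀ i j, 0 < β i j) →
  Phi α β (Bl R : (Fin k → WW p) → ENNReal) ≤ ENNReal.ofReal C

structure Adm {k p : ℕ} (R : ℝ) (F : (Fin k → WW p) → ENNReal) : Prop where
  meas : Measurable F
  le_one : ∀ Y, F Y ≤ 1
  lip : ∀ Y Y' : Fin k → WW p, ∀ ε, 0 ≤ ε → (∀ i, nn (Y i - Y' i) ≤ ε) → F Y ≤ F Y' + ENNReal.ofReal ε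
  supp : ∀ Y i, R < nn (Y i) → F Y = 0

def Hs (k p : ℕ) (R : ℝ) : Prop := ∃ C : ℝ, 0 ≤ C ∧ ∀ F : (Fin k → WW p) → ENNReal, Adm R F →
  ∀ (Δ : ℝ) (α β α' β' : Fin k → Fin k → ℝ), (∀ i j, 0 < β i j ∧ β i j ≤ Δ) →
  (∀ i j, 0 < β' i j ∧ β' i j ≤ Δ) → (∀ i j, |α i j - α' i j| ≤ Δ) →
  Phi α β F ≤ Phi α' β' F + ENNReal.ofReal (C * √Δ)

lemma ball_meas {k p : ℕ} (R : ℝ) : MeasurableSet {Y : Fin k → WW p | ∀ i, nn (Y i) ≤ R} := by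
  have : {Y : Fin k → WW p | ∀ i, nn (Y i) ≤ R} = ⋂ i, {Y | nn (Y i) ≤ R} := by ext; simp
  rw [this]
  refine MeasurableSet.iInter fun i => ?_
  exact (isClosed_le (nn_continuous.comp (continuous_apply i)) continuous_const).measurableSet

lemma Bl_meas {k p : ℕ} (R : ℝ) : Measurable (Bl R : (Fin k → WW p) → ENNReal) := measurable_const.indicator (ball_meas R)
lemma Bl_one {k p : ℕ} {R : ℝ} {Y : Fin k → WW p} (h : ∀ i, nn (Y i) ≤ R) : Bl R Y = 1 :=
  Set.indicator_of_mem (s := {Y : Fin k → WW p | ∀ i, nn (Y i) ≤ R}) h _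
lemma Bl_zero {k p : ℕ} {R : ℝ} {Y : Fin k → WW p} (i : Fin k) (h : R < nn (Y i)) : Bl R Y = 0 :=
  Set.indicator_of_notMem (s := {Y : Fin k → WW p | ∀ i, nn (Y i) ≤ R}) (fun hh => absurd (hh i) (not_le.2 h)) _

lemma nn_zz {p : ℕ} {A : WW (p+1) ≃ₗ[ℂ] WW (p+1)} (h1 : ∀ u, nn (A u) = nn u) (t a : ℝ) (u : WW p) :
    |a| ≤ nn (zz A t a u) ∧ nn u ≤ nn (zz A t a u) := by
  have := nn_sq_cons ⟨a, t⟩ u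
  have h2 := nn_nonneg (zz A t a u)
  rw [← h1, ← zz] at this
  have h3 : |a| ≤ ‖(⟨a, t⟩ : ℂ)‖ := Complex.abs_re_le_norm ⟨a, t⟩
  have h4 := norm_nonneg (⟨a, t⟩ : ℂ)
  have h5 := nn_nonneg u
  have h6 := abs_nonneg a
  constructor
  · refine abs_le_of_sq_le_sq' ?_ h2 |>.2
    nlinarith
  · refine abs_le_of_sq_le_sq' ?_ h2 |>.2
    nlinarith

lemma abox_vol (k : ℕ) (R : ℝ) : volume (Set.pi Set.univ (fun _ : Fin k => Set.Icc (-R) R)) = ENNReal.ofReal (2*R) ^ k := by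
  rw [volume_pi_pi]; simp [Real.volume_Icc, two_mul, -ENNReal.ofReal_mul]

/-- common estimate of the inner integral -/
lemma inner_le {k : ℕ} (R D : ℝ) (P P' : (Fin k → ℝ) → (Fin k → ℝ) → ENNReal)
    (h0 : ∀ x a, (∃ i, R < |a i|) → P x a = 0)
    (h : ∀ x ∈ cub k, ∀ a, (∀ i, |a i| ≤ R) → P x a ≤ P' x a + ENNReal.ofReal D) :
    ∫⁻ x : Fin k → ℝ, ∫⁻ a : Fin k → ℝ, (cub k).indicator (fun x => P x a) x ≤
    (∫⁻ x : Fin k → ℝ, ∫⁻ a : Fin k → ℝ, (cub k).indicator (fun x => P' x a) x) +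
      ENNReal.ofReal D * ENNReal.ofReal (2*R) ^ k := by
  have h2 : ∀ x a, (cub k).indicator (fun x => P x a) x ≤ (cub k).indicator (fun x => P' x a) x +
      (cub k).indicator 1 x * (Set.pi Set.univ (fun _ : Fin k => Set.Icc (-R) R)).indicator (fun _ => ENNReal.ofReal D) a := by
    intro x a
    by_cases hx : x ∈ cub k
    · simp only [Set.indicator_of_mem hx]
      by_cases ha : ∀ i, |a i| ≤ R
      · rw [Set.indicator_of_mem (by intro i _; exact abs_le.1 (ha i))]
        simpa using h x hx a ha
      · push Not at ha; rw [h0 x a ha]; exact zero_le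
    · simp [Set.indicator_of_notMem hx]
  have hm : MeasurableSet (Set.pi Set.univ (fun _ : Fin k => Set.Icc (-R) R)) :=
    MeasurableSet.univ_pi fun _ => measurableSet_Icc
  calc _ ≤ ∫⁻ x : Fin k → ℝ, ((∫⁻ a : Fin k → ℝ, (cub k).indicator (fun x => P' x a) x) +
        (cub k).indicator 1 x * (ENNReal.ofReal D * ENNReal.ofReal (2*R) ^ k)) := by
        refine lintegral_mono fun x => (lintegral_mono (h2 x)).trans ?_
        rw [lintegral_add_right _ ((measurable_const.indicator hm).const_mul _),
          lintegral_const_mul _ (measurable_const.indicator hm), lintegral_indicator_const hm, abox_vol]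
    _ = _ := by
        rw [lintegral_add_right _ ((measurable_one.indicator (cub_meas k)).mul_const _),
          lintegral_mul_const _ (measurable_one.indicator (cub_meas k)), lintegral_indicator_one (cub_meas k), cub_vol, one_mul]

/-- outer estimate -/
lemma outer_le {k p : ℕ} (hkp : k ≤ p + 1) (R : ℝ) : ∃ K : ℝ, 0 ≤ K ∧ ∀ (D : ℝ) (P P' : WW (p+1) → ENNReal), 0 ≤ D →
    (∀ y, R < nn y → P y = 0) →
    (∀ y, y ≠ 0 → nn y ≤ R → P y ≤ P' y + ENNReal.ofReal (D * nn y ^ (-((k:ℝ) + 1/2)))) →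
    ∫⁻ y, P y ≤ (∫⁻ y, P' y) + ENNReal.ofReal (K * D) := by
  refine ⟨(∫⁻ y : WW (p+1), {y : WW (p+1) | nn y ≤ R}.indicator (fun y => ENNReal.ofReal (nn y ^ (-((k:ℝ) + 1/2)))) y).toReal,
    ENNReal.toReal_nonneg, ?_⟩
  intro D P P' hD h0 h
  have hfin := int_pow p k hkp R
  have hm : MeasurableSet {y : WW (p+1) | nn y ≤ R} := (isClosed_le nn_continuous continuous_const).measurableSet
  have hm2 : Measurable (fun y : WW (p+1) => {y : WW (p+1) | nn y ≤ R}.indicator (fun y => ENNReal.ofReal (nn y ^ (-((k:ℝ) + 1/2)))) y) :=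
    ((nn_continuous.measurable.pow_const _).ennreal_ofReal).indicator hm
  rw [ENNReal.ofReal_mul ENNReal.toReal_nonneg, ENNReal.ofReal_toReal hfin.ne, ← lintegral_mul_const _ hm2,
    ← lintegral_add_right _ (hm2.mul_const _)]
  have hne : ∀ᵐ y : WW (p+1), y ≠ 0 := by
    exact compl_mem_ae_iff.2 (measure_singleton 0)
  refine lintegral_mono_ae ?_
  filter_upwards [hne] with y hy
  by_cases hyR : nn y ≤ R
  · rw [Set.indicator_of_mem (by exact hyR), ← ENNReal.ofReal_mul (Real.rpow_nonneg (nn_nonneg y) _), mul_comm (nn y ^ _)]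
    exact h y hy hyR
  · rw [h0 y (not_le.1 hyR)]; exact zero_le

end

section
lemma Phi_mono {k p : ℕ} (α β : Fin k → Fin k → ℝ) {F G : (Fin k → WW p) → ENNReal} (h : ∀ Y, F Y ≤ G Y) :
    Phi α β F ≤ Phi α β G := by
  unfold Phi
  gcongr with Y
  exact h Y

lemma Phi_zero {k p : ℕ} (α β : Fin k → Fin k → ℝ) {F : (Fin k → WW p) → ENNReal} (h : ∀ Y, F Y = 0) :
    Phi α β F = 0 := by
  have : F = fun _ => 0 := funext h
  simp [Phi, this]

lemma Phi_add {k p : ℕ} (α β : Fin k → Fin k → ℝ) (F G : (Fin k → WW p) → ENNReal) (hG : Measurable G) (c : ENNReal) :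
    Phi α β (fun Y => F Y + c * G Y) = Phi α β F + c * Phi α β G := by
  unfold Phi
  rw [← mul_div_assoc, ← ENNReal.add_div, ← lintegral_const_mul _ (hG.indicator (BX_meas α β)),
    ← lintegral_add_right _ ((hG.indicator (BX_meas α β)).const_mul _)]
  congr 2; ext Y
  by_cases hY : Y ∈ BX α β <;> simp [hY]

lemma pow_half {s : ℝ} (hs : 0 < s) (k : ℕ) : s ^ (-((k:ℝ) + 1/2)) = (s ^ k)⁻¹ * (√s)⁻¹ := by
  rw [Real.rpow_neg hs.le, Real.rpow_add hs, Real.rpow_natCast, ← Real.sqrt_eq_rpow, mul_inv]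

lemma UB_step (k p : ℕ) (R : ℝ) (hR : 0 < R) (hkp : k ≤ p + 1) (ih : UBs k p R) : UBs (k+1) (p+1) R := by
  obtain ⟨C, hC, h⟩ := ih
  obtain ⟨K, hK, ho⟩ := outer_le hkp R
  refine ⟨K * (C * (2*R)^k * √R), by positivity, fun α β hβ => ?_⟩
  have hm : Measurable (Bl R : (Fin (k+1) → WW (p+1)) → ENNReal) := Bl_meas R
  rw [Phi_eq α β hβ _ hm]
  refine (ho (C * (2*R)^k * √R) _ (fun _ => 0) (by positivity) ?_ ?_).trans (by simp)
  · intro y hy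
    have : ∀ Z : Fin k → WW (p+1), (BX α β).indicator (Bl R) (Fin.cons y Z) = 0 := by
      intro Z
      rw [Set.indicator_apply_eq_zero]; intro _
      exact Bl_zero 0 (by simpa using hy)
    simp [this]
  · intro y hy hyR
    obtain ⟨A, h1, h2, h3, h4⟩ := exA y hy
    have hs := nn_pos hy
    rw [sectY hy h2 h3 h4 α β hβ _ hm]
    have := inner_le R C (fun x a => Phi (al α (tt α β (nn y) x) a) (fun i j => β i.succ j.succ) (FF (Bl R) A y (tt α β (nn y) x) a))
      (fun _ _ => 0) ?_ ?_
    · calc _ ≤ ENNReal.ofReal ((nn y ^ k)⁻¹) * (0 + ENNReal.ofReal C * ENNReal.ofReal (2 * R) ^ k) := by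
            gcongr; simpa using this
        _ = ENNReal.ofReal ((nn y ^ k)⁻¹ * (C * (2 * R) ^ k)) := by
            rw [zero_add, ENNReal.ofReal_mul (p := (nn y ^ k)⁻¹) (by positivity), ENNReal.ofReal_mul hC, ENNReal.ofReal_pow (by positivity)]
        _ ≤ _ := by
            rw [zero_add]
            refine ENNReal.ofReal_le_ofReal ?_
            rw [pow_half hs]
            have h5 : 1 ≤ √R * (√(nn y))⁻¹ := by
              rw [← div_eq_mul_inv, one_le_div (Real.sqrt_pos.2 hs)]
              exact Real.sqrt_le_sqrt hyR
            calc (nn y ^ k)⁻¹ * (C * (2 * R) ^ k) = ((nn y ^ k)⁻¹ * (C * (2 * R) ^ k)) * 1 := by ring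
              _ ≤ ((nn y ^ k)⁻¹ * (C * (2 * R) ^ k)) * (√R * (√(nn y))⁻¹) := by gcongr
              _ = _ := by ring
    · rintro x a ⟨i, hi⟩
      refine Phi_zero _ _ fun U => ?_
      refine Bl_zero i.succ ?_
      simp only [Fin.cons_succ]
      exact hi.trans_le (nn_zz h1 (tt α β (nn y) x i) (a i) (U i)).1
    · intro x hx a ha
      rw [zero_add]
      refine (Phi_mono _ _ fun U => ?_).trans (h _ _ fun i j => hβ _ _)
      rw [FF]
      by_cases hU : ∀ i, nn (U i) ≤ R
      · rw [Bl_one hU]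
        exact Set.indicator_le_self' (fun _ _ => zero_le) _
      · push Not at hU
        obtain ⟨i, hi⟩ := hU
        rw [Bl_zero i.succ]
        · exact zero_le
        · simp only [Fin.cons_succ]
          exact hi.trans_le (nn_zz h1 (tt α β (nn y) x i) (a i) (U i)).2

lemma base_eq {k p : ℕ} (hk : k ≤ 1) (α β : Fin k → Fin k → ℝ) (F : (Fin k → WW p) → ENNReal) :
    Phi α β F = ∫⁻ Y, F Y := by
  have : Subsingleton (Fin k) := by
    rw [Fin.subsingleton_iff_le_one]; exact hk
  have h1 : (BX α β : Set (Fin k → WW p)) = Set.univ := by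
    ext Y; simp only [BX, Set.mem_ofPred_eq, Set.mem_univ, iff_true]
    intro i j hij; exact absurd (Subsingleton.elim i j) hij.ne
  have h2 : pp β = 1 := by
    refine Finset.prod_eq_one fun i _ => Finset.prod_eq_one fun j hj => ?_
    exact absurd (Subsingleton.elim i j) (Finset.mem_Ioi.1 hj).ne
  simp [Phi, h1, h2]

lemma UB_base (k p : ℕ) (R : ℝ) (hk : k ≤ 1) : UBs k p R := by
  have hfin : volume {Y : Fin k → WW p | ∀ i, nn (Y i) ≤ R} ≠ ⊤ := by
    refine ne_top_of_le_ne_top (measure_closedBall_lt_top (x := (0 : Fin k → WW p)) (r := |R|)).ne (measure_mono ?_)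
    intro Y hY
    rw [mem_closedBall_zero_iff, pi_norm_le_iff_of_nonneg (abs_nonneg R)]
    exact fun i => (norm_le_nn _).trans ((hY i).trans (le_abs_self R))
  refine ⟨(volume {Y : Fin k → WW p | ∀ i, nn (Y i) ≤ R}).toReal, ENNReal.toReal_nonneg, fun α β _ => ?_⟩
  rw [base_eq hk, Bl, lintegral_indicator_const (ball_meas R), ENNReal.ofReal_toReal hfin, one_mul]

lemma H_base (k p : ℕ) (R : ℝ) (hk : k ≤ 1) : Hs k p R :=
  ⟨0, le_rfl, fun F _ Δ α β α' β' _ _ _ => by rw [base_eq hk, base_eq hk]; simp⟩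

lemma UB_all (k p : ℕ) (R : ℝ) (hR : 0 < R) (hkp : k ≤ p + 1) : UBs k p R := by
  induction k generalizing p with
  | zero => exact UB_base 0 p R (by norm_num)
  | succ k ih =>
    by_cases h : k + 1 ≤ 1
    · exact UB_base _ p R h
    · obtain ⟨p, rfl⟩ : ∃ q, p = q + 1 := ⟨p - 1, by omega⟩
      exact UB_step k p R hR (by omega) (ih p (by omega))

end

section
lemma min_sqrt {z : ℝ} (hz : 0 ≤ z) : min 1 (2 * z) ≤ 2 * √z := by
  have h := Real.sq_sqrt hz
  have h0 := Real.sqrt_nonneg z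
  by_cases h1 : z ≤ 1
  · have : √z ≤ 1 := Real.sqrt_le_one.2 h1
    exact (min_le_right _ _).trans (by nlinarith)
  · have : 1 ≤ √z := Real.one_le_sqrt.2 (by linarith)
    exact (min_le_left _ _).trans (by linarith)

lemma zz_sub {p : ℕ} (A : WW (p+1) ≃ₗ[ℂ] WW (p+1)) (h1 : ∀ u, nn (A u) = nn u) (t t' a : ℝ) (u u' : WW p) :
    nn (zz A t a u - zz A t' a u') ^ 2 = (t - t') ^ 2 + nn (u - u') ^ 2 := by
  have : zz A t a u - zz A t' a u' = A (Fin.cons ⟨0, t - t'⟩ (u - u')) := by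
    rw [zz, zz, ← map_sub]; congr 1
    ext i; refine Fin.cases ?_ (fun i => ?_) i
    · simp [Complex.ext_iff]
    · simp
  rw [this, h1, nn_sq_cons, ← Complex.normSq_eq_norm_sq, Complex.normSq_mk]; ring

lemma nn_zero {p : ℕ} : nn (0 : WW p) = 0 := by simp [nn]

lemma FF_adm {k p : ℕ} {R : ℝ} {F : (Fin (k+1) → WW (p+1)) → ENNReal} (hF : Adm R F) {A : WW (p+1) ≃ₗ[ℂ] WW (p+1)}
    (h1 : ∀ u, nn (A u) = nn u) (h4 : MeasurePreserving A) (y : WW (p+1)) (t a : Fin k → ℝ) :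
    Adm R (FF F A y t a) := by
  refine ⟨?_, fun U => hF.le_one _, ?_, ?_⟩
  · refine hF.meas.comp (measurable_pi_lambda _ fun i => ?_)
    refine Fin.cases ?_ (fun i => ?_) i
    · simp
    · simp only [Fin.cons_succ]
      refine h4.measurable.comp (measurable_pi_lambda _ fun j => ?_)
      refine Fin.cases ?_ (fun j => ?_) j
      · simp
      · simp only [Fin.cons_succ]; fun_prop
  · intro U U' ε hε h
    refine hF.lip _ _ ε hε fun i => ?_
    refine Fin.cases ?_ (fun i => ?_) i
    · simpa [nn_zero] using hε
    · simp only [Fin.cons_succ]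
      refine abs_le_of_sq_le_sq' ?_ hε |>.2
      rw [zz_sub A h1]
      have := h i; have := nn_nonneg (U i - U' i); nlinarith
  · intro U i hi
    refine hF.supp _ i.succ ?_
    simp only [Fin.cons_succ]
    exact hi.trans_le (nn_zz h1 _ _ _).2

lemma H_step (k p : ℕ) (R : ℝ) (hR : 0 < R) (hkp : k ≤ p + 1) (ih : Hs k p R) : Hs (k+1) (p+1) R := by
  obtain ⟨C, hC, h⟩ := ih
  obtain ⟨B, hB, hub⟩ := UB_all k p R hR hkp
  obtain ⟨K, hK, ho⟩ := outer_le hkp R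
  set C2 := C * √(5*R) + 2 * B with hC2
  have hC20 : 0 ≤ C2 := by positivity
  refine ⟨K * (C2 * (2*R)^k), by positivity, fun F hF Δ α β α' β' hβ hβ' hα => ?_⟩
  have hΔ : 0 < Δ := (hβ 0 0).1.trans_le (hβ 0 0).2
  rw [Phi_eq α β (fun i j => (hβ i j).1) _ hF.meas, Phi_eq α' β' (fun i j => (hβ' i j).1) _ hF.meas, mul_assoc]
  refine ho (C2 * (2*R)^k * √Δ) _ _ (by positivity) ?_ ?_
  · intro y hy
    have : ∀ Z : Fin k → WW (p+1), (BX α β).indicator F (Fin.cons y Z) = 0 := by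
      intro Z
      rw [Set.indicator_apply_eq_zero]; intro _
      exact hF.supp _ 0 (by simpa using hy)
    simp [this]
  · intro y hy hyR
    obtain ⟨A, h1, h2, h3, h4⟩ := exA y hy
    have hs := nn_pos hy
    set s := nn y with hsdef
    rw [sectY hy h2 h3 h4 α β (fun i j => (hβ i j).1) _ hF.meas, sectY hy h2 h3 h4 α' β' (fun i j => (hβ' i j).1) _ hF.meas]
    have := inner_le R (C2 * √(Δ / s)) (fun x a => Phi (al α (tt α β s x) a) (fun i j => β i.succ j.succ) (FF F A y (tt α β s x) a))
      (fun x a => Phi (al α' (tt α' β' s x) a) (fun i j => β' i.succ j.succ) (FF F A y (tt α' β' s x) a)) ?_ ?_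
    · refine (mul_le_mul_right this _).trans (le_of_eq ?_)
      rw [mul_add]
      congr 1
      rw [← ENNReal.ofReal_pow (by positivity), ← ENNReal.ofReal_mul (by positivity), ← ENNReal.ofReal_mul (by positivity)]
      congr 1
      rw [pow_half hs, Real.sqrt_div hΔ.le, ← hsdef]
      field_simp
    · rintro x a ⟨i, hi⟩
      refine Phi_zero _ _ fun U => hF.supp _ i.succ ?_
      simp only [Fin.cons_succ]
      exact hi.trans_le (nn_zz h1 _ (a i) (U i)).1
    · intro x hx a ha
      have hzs : 0 < Δ / s := by positivity
      have hdt : ∀ j, |tt α β s x j - tt α' β' s x j| ≤ 2 * (Δ / s) := by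
        intro j
        have hx1 := hx j trivial
        have e : tt α β s x j - tt α' β' s x j =
          ((α 0 j.succ - α' 0 j.succ) + (β 0 j.succ - β' 0 j.succ) * x j) / s := by
          simp only [tt]; field_simp; ring
        rw [e, abs_div, abs_of_pos hs, ← mul_div_assoc]
        gcongr
        have e1 : |(β 0 j.succ - β' 0 j.succ) * x j| ≤ Δ := by
          rw [abs_mul, abs_of_pos hx1.1]
          have : |β 0 j.succ - β' 0 j.succ| ≤ Δ := by
            have := hβ 0 j.succ; have := hβ' 0 j.succ
            rw [abs_le]; constructor <;> linarith
          have hx2 := hx1.2; have hx3 := hx1.1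
          have := abs_nonneg (β 0 j.succ - β' 0 j.succ)
          nlinarith
        have := abs_add_le (α 0 j.succ - α' 0 j.succ) ((β 0 j.succ - β' 0 j.succ) * x j)
        have := hα 0 j.succ
        linarith
      have hRs : 1 ≤ R / s := by rw [one_le_div hs]; exact hyR
      have hΔ' : Δ ≤ 5 * R * (Δ / s) := by
        have : 5 * R * (Δ / s) = 5 * Δ * (R / s) := by ring
        rw [this]; nlinarith
      have step1 := h (FF F A y (tt α β s x) a) (FF_adm hF h1 h4 y _ a) (5 * R * (Δ / s))
        (al α (tt α β s x) a) (fun i j => β i.succ j.succ) (al α' (tt α' β' s x) a) (fun i j => β' i.succ j.succ)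
        (fun i j => ⟨(hβ _ _).1, (hβ _ _).2.trans hΔ'⟩) (fun i j => ⟨(hβ' _ _).1, (hβ' _ _).2.trans hΔ'⟩) ?_
      · have step2 : Phi (al α' (tt α' β' s x) a) (fun i j => β' i.succ j.succ) (FF F A y (tt α β s x) a) ≤
          Phi (al α' (tt α' β' s x) a) (fun i j => β' i.succ j.succ) (FF F A y (tt α' β' s x) a) + ENNReal.ofReal (2 * √(Δ / s)) * ENNReal.ofReal B := by
          refine le_trans (Phi_mono _ _ (G := fun U => FF F A y (tt α' β' s x) a U + ENNReal.ofReal (2 * √(Δ / s)) * Bl R U) fun U => ?_) ?_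
          · by_cases hU : ∀ i, nn (U i) ≤ R
            · rw [Bl_one hU, mul_one]
              have l1 : FF F A y (tt α β s x) a U ≤ FF F A y (tt α' β' s x) a U + ENNReal.ofReal (2 * (Δ / s)) := by
                refine hF.lip _ _ _ (by positivity) fun i => ?_
                refine Fin.cases ?_ (fun i => ?_) i
                · simp only [Fin.cons_zero, sub_self, nn_zero]; positivity
                · simp only [Fin.cons_succ]
                  refine abs_le_of_sq_le_sq' ?_ (by positivity) |>.2
                  rw [zz_sub A h1, sub_self, nn_zero]
                  have := hdt i
                  rw [← sq_abs]; nlinarith [abs_nonneg (tt α β s x i - tt α' β' s x i)]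
              have l2 : FF F A y (tt α β s x) a U ≤ FF F A y (tt α' β' s x) a U + ENNReal.ofReal 1 := by
                refine (hF.le_one _).trans ?_
                simp
              refine le_trans ?_ (add_le_add_right (ENNReal.ofReal_le_ofReal (min_sqrt hzs.le)) _)
              rcases min_choice 1 (2 * (Δ / s)) with e | e <;> rw [e]
              · exact l2
              · exact l1
            · push Not at hU
              obtain ⟨i, hi⟩ := hU
              rw [(FF_adm hF h1 h4 y _ a).supp U i hi]; exact zero_le
          · rw [Phi_add _ _ _ _ (Bl_meas R)]
            gcongr
            exact hub _ _ fun i j => (hβ' _ _).1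
        refine step1.trans ((add_le_add_left step2 _).trans (le_of_eq ?_))
        rw [add_assoc]; congr 1
        rw [← ENNReal.ofReal_mul (by positivity), ← ENNReal.ofReal_add (by positivity) (by positivity), Real.sqrt_mul (by positivity)]
        congr 1; rw [hC2]; ring
      · intro i j
        have e : al α (tt α β s x) a i j - al α' (tt α' β' s x) a i j = (α i.succ j.succ - α' i.succ j.succ)
          - a i * (tt α β s x j - tt α' β' s x j) + a j * (tt α β s x i - tt α' β' s x i) := by
          simp only [al]; ring
        have b1 : ∀ i j, |a i * (tt α β s x j - tt α' β' s x j)| ≤ R * (2 * (Δ / s)) := by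
          intro i j; rw [abs_mul]; gcongr
          · exact ha i
          · exact hdt j
        have hΔ'' : Δ ≤ R * (Δ / s) := by
          have : R * (Δ / s) = Δ * (R / s) := by ring
          rw [this]; nlinarith
        have := hα i.succ j.succ
        have := abs_le.1 (b1 i j); have := abs_le.1 (b1 j i); have := abs_le.1 (hα i.succ j.succ)
        rw [e, abs_le]; constructor <;> linarith

lemma H_all (k p : ℕ) (R : ℝ) (hR : 0 < R) (hkp : k ≤ p + 1) : Hs k p R := by
  induction k generalizing p with
  | zero => exact H_base 0 p R (by norm_num)
  | succ k ih =>
    by_cases h : k + 1 ≤ 1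
    · exact H_base _ p R h
    · obtain ⟨p, rfl⟩ : ∃ q, p = q + 1 := ⟨p - 1, by omega⟩
      exact H_step k p R hR (by omega) (ih p (by omega))

end

section
abbrev UU (ι κ : Type) := (ι → ℝ) × (κ → ℝ)

structure Dat (p : ℕ) (ι κ : Type) [Fintype ι] [Fintype κ] where
  L1 : (ι → ℝ) ≃ₗ[ℝ] WW p
  L2 : (κ → ℝ) →ₗ[ℝ] WW p
  B : (κ → ℝ) →ₗ[ℝ] (κ → ℝ) →ₗ[ℝ] ℝ

variable {p : ℕ} {ι κ : Type} [Fintype ι] [Fintype κ]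

def Dat.b (D : Dat p ι κ) (u v : UU ι κ) : ℝ :=
  om (D.L1 u.1 + D.L2 u.2) (D.L1 v.1 + D.L2 v.2) + D.B u.2 v.2

lemma lin_bound {E F : Type*} [NormedAddCommGroup E] [NormedSpace ℝ E] [FiniteDimensional ℝ E]
    [NormedAddCommGroup F] [NormedSpace ℝ F] (f : E →ₗ[ℝ] F) : ∃ n : ℝ, 1 ≤ n ∧ ∀ x, ‖f x‖ ≤ n * ‖x‖ :=
  ⟨‖LinearMap.toContinuousLinearMap f‖ + 1, by linarith [norm_nonneg (LinearMap.toContinuousLinearMap f)], fun x => by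
    have := (LinearMap.toContinuousLinearMap f).le_opNorm x
    have h := norm_nonneg x
    simp only [LinearMap.coe_toContinuousLinearMap'] at this
    nlinarith⟩

lemma nn_bound (p : ℕ) : ∃ n : ℝ, 1 ≤ n ∧ ∀ z : WW p, nn z ≤ n * ‖z‖ :=
  lin_bound ((WithLp.linearEquiv 2 ℝ (WW p)).symm : WW p →ₗ[ℝ] EuclideanSpace ℂ (Fin p))

lemma Dat.bounds (D : Dat p ι κ) : ∃ n : ℝ, 1 ≤ n ∧ (∀ z, ‖D.L1.symm z‖ ≤ n * nn z) ∧
    (∀ q, ‖D.L1.symm (D.L2 q)‖ ≤ n * ‖q‖) ∧ (∀ y q, nn (D.L1 y + D.L2 q) ≤ n * (‖y‖ + ‖q‖)) ∧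
    (∀ q q', |D.B q q'| ≤ n * (‖q‖ * ‖q'‖)) := by
  obtain ⟨a, ha, h1⟩ := lin_bound D.L1.symm.toLinearMap
  obtain ⟨b, hb, h2⟩ := lin_bound (D.L1.symm.toLinearMap ∘ₗ D.L2)
  obtain ⟨c, hc, h3⟩ := nn_bound p
  obtain ⟨d, hd, h4⟩ := lin_bound D.L1.toLinearMap
  obtain ⟨e, he, h5⟩ := lin_bound D.L2
  let BB : (κ → ℝ) →ₗ[ℝ] ((κ → ℝ) →L[ℝ] ℝ) := (LinearMap.toContinuousLinearMap : _ ≃ₗ[ℝ] ((κ → ℝ) →L[ℝ] ℝ)).toLinearMap ∘ₗ D.B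
  obtain ⟨f, hf, h6⟩ := lin_bound BB
  have key : ∀ t x : ℝ, 0 ≤ x → t ≤ a + b + c * (d + e) + f → t * x ≤ (a + b + c * (d + e) + f) * x :=
    fun t x hx ht => mul_le_mul_of_nonneg_right ht hx
  have hcde : 0 ≤ c * (d + e) := by positivity
  refine ⟨a + b + c * (d + e) + f, by linarith, fun z => ?_, fun q => ?_, fun y q => ?_, fun q q' => ?_⟩
  · refine (h1 z).trans ?_
    have := norm_le_nn z
    calc a * ‖z‖ ≤ a * nn z := by gcongr
      _ ≤ _ := key _ _ (nn_nonneg z) (by linarith)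
  · exact (h2 q).trans (key _ _ (norm_nonneg _) (by linarith))
  · refine (h3 _).trans (le_trans ?_ (key (c * (d + e)) _ (by positivity) (by linarith)))
    rw [mul_assoc]; gcongr
    refine (norm_add_le _ _).trans ?_
    have := h4 y; have := h5 q
    simp only [LinearEquiv.coe_coe] at *
    nlinarith [norm_nonneg y, norm_nonneg q]
  · have := (BB q).le_opNorm q'
    have h7 := h6 q
    calc |D.B q q'| = ‖BB q q'‖ := rfl
      _ ≤ ‖BB q‖ * ‖q'‖ := this
      _ ≤ f * ‖q‖ * ‖q'‖ := by gcongr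
      _ = f * (‖q‖ * ‖q'‖) := by ring
      _ ≤ _ := key _ _ (by positivity) (by linarith)

lemma lint_lin {E F : Type*} [NormedAddCommGroup E] [NormedSpace ℝ E] [FiniteDimensional ℝ E] [MeasurableSpace E] [BorelSpace E]
    [NormedAddCommGroup F] [NormedSpace ℝ F] [FiniteDimensional ℝ F] [MeasurableSpace F] [BorelSpace F]
    (μ : Measure E) [μ.IsAddHaarMeasure] (ν : Measure F) [ν.IsAddHaarMeasure] (L : E ≃ₗ[ℝ] F) :
    ∃ c : NNReal, ∀ f : E → ENNReal, Measurable f → ∫⁻ x, f x ∂μ = c * ∫⁻ z, f (L.symm z) ∂ν := by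
  let Lc := L.toContinuousLinearEquiv
  have := Lc.isAddHaarMeasure_map μ
  have : ProperSpace F := FiniteDimensional.proper ℝ F
  obtain ⟨c, h⟩ : ∃ c : NNReal, Measure.map Lc μ = c • ν := ⟨_, Measure.isAddLeftInvariant_eq_smul _ _⟩
  refine ⟨c, fun f hf => ?_⟩
  have hm : Measurable (fun z => f (Lc.symm z)) := hf.comp Lc.symm.continuous.measurable
  calc ∫⁻ x, f x ∂μ = ∫⁻ x, f (Lc.symm (Lc x)) ∂μ := by simp
    _ = ∫⁻ z, f (Lc.symm z) ∂(Measure.map Lc μ) := (lintegral_map hm Lc.continuous.measurable).symm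
    _ = _ := by
      rw [h, lintegral_smul_measure]; rfl

def Dat.box {k : ℕ} (D : Dat p ι κ) (α β : Fin k → Fin k → ℝ) : Set (Fin k → UU ι κ) :=
  {U | ∀ i j, i < j → D.b (U i) (U j) ∈ Set.Ioo (α i j) (α i j + β i j)}

lemma Dat.b_continuous (D : Dat p ι κ) : Continuous (fun z : UU ι κ × UU ι κ => D.b z.1 z.2) := by
  have h1 : Continuous D.L1 := D.L1.toLinearMap.continuous_of_finiteDimensional
  have h2 : Continuous D.L2 := D.L2.continuous_of_finiteDimensional
  have h3 : Continuous (fun z : (κ → ℝ) × (κ → ℝ) => D.B z.1 z.2) := by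
    let BB : (κ → ℝ) →ₗ[ℝ] ((κ → ℝ) →L[ℝ] ℝ) := (LinearMap.toContinuousLinearMap : _ ≃ₗ[ℝ] ((κ → ℝ) →L[ℝ] ℝ)).toLinearMap ∘ₗ D.B
    have : Continuous BB := BB.continuous_of_finiteDimensional
    exact (this.comp continuous_fst).clm_apply continuous_snd
  unfold Dat.b
  refine Continuous.add ?_ ?_
  · exact (om_continuous (p := p)).comp (f := fun z : UU ι κ × UU ι κ => (D.L1 z.1.1 + D.L2 z.1.2, D.L1 z.2.1 + D.L2 z.2.2)) (by fun_prop)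
  · exact h3.comp (f := fun z : UU ι κ × UU ι κ => (z.1.2, z.2.2)) (by fun_prop)

lemma Dat.box_open {k : ℕ} (D : Dat p ι κ) (α β : Fin k → Fin k → ℝ) : IsOpen (D.box α β) := by
  have : D.box α β = ⋂ i, ⋂ j, ⋂ (_ : i < j),
      (fun U : Fin k → UU ι κ => D.b (U i) (U j)) ⁻¹' Set.Ioo (α i j) (α i j + β i j) := by
    ext Y; simp [Dat.box]
  rw [this]
  refine isOpen_iInter_of_finite fun i => isOpen_iInter_of_finite fun j => isOpen_iInter_of_finite fun _ => ?_
  exact isOpen_Ioo.preimage (D.b_continuous.comp (f := fun U : Fin k → UU ι κ => (U i, U j)) (by fun_prop))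

def zip {k : ℕ} (Y : Fin k → ι → ℝ) (q : Fin k → κ → ℝ) : Fin k → UU ι κ := fun i => (Y i, q i)
def Fq {k : ℕ} (D : Dat p ι κ) (F : (Fin k → UU ι κ) → ENNReal) (q : Fin k → κ → ℝ) : (Fin k → WW p) → ENNReal :=
  fun Z => F (fun i => (D.L1.symm (Z i - D.L2 (q i)), q i))

lemma theta {k : ℕ} (D : Dat p ι κ) : ∃ c : NNReal, ∀ (F : (Fin k → UU ι κ) → ENNReal), Measurable F →
    ∀ (q : Fin k → κ → ℝ) (α β : Fin k → Fin k → ℝ),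
    (∫⁻ Y : Fin k → ι → ℝ, (D.box α β).indicator F (zip Y q)) / ENNReal.ofReal (pp β) =
      c * Phi (fun i j => α i j - D.B (q i) (q j)) β (Fq D F q) := by
  have i1 : (volume : Measure (Fin k → ι → ℝ)).IsAddHaarMeasure := Measure.pi.isAddHaarMeasure _
  have i2 : (volume : Measure (Fin k → WW p)).IsAddHaarMeasure := Measure.pi.isAddHaarMeasure _
  obtain ⟨c, hc⟩ := lint_lin (volume : Measure (Fin k → ι → ℝ)) (volume : Measure (Fin k → WW p))
    (LinearEquiv.piCongrRight fun _ => D.L1)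
  refine ⟨c, fun F hF q α β => ?_⟩
  have hz : Measurable (fun Y : Fin k → ι → ℝ => zip Y q) := by unfold zip; fun_prop
  rw [hc (fun Y => (D.box α β).indicator F (zip Y q)) ((hF.indicator (D.box_open α β).measurableSet).comp hz), mul_div_assoc, Phi]
  congr 2
  rw [← lintegral_sub_right_eq_self _ (fun i => D.L2 (q i))]
  refine lintegral_congr fun Z => ?_
  have e : ∀ i, D.L1 (D.L1.symm (Z i - D.L2 (q i))) + D.L2 (q i) = Z i := fun i => by simp
  have hiff : (zip ((LinearEquiv.piCongrRight fun _ => D.L1).symm (Z - fun i => D.L2 (q i))) q) ∈ D.box α β ↔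
      Z ∈ BX (fun i j => α i j - D.B (q i) (q j)) β := by
    simp only [Dat.box, BX, Set.mem_ofPred_eq]
    refine forall_congr' fun i => forall_congr' fun j => imp_congr_right fun _ => ?_
    have : D.b (zip ((LinearEquiv.piCongrRight fun _ => D.L1).symm (Z - fun i => D.L2 (q i))) q i)
        (zip ((LinearEquiv.piCongrRight fun _ => D.L1).symm (Z - fun i => D.L2 (q i))) q j) = om (Z i) (Z j) + D.B (q i) (q j) := by
      simp [Dat.b, zip]
    rw [this, Set.mem_Ioo, Set.mem_Ioo]
    constructor
    · rintro ⟨h, h'⟩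
      constructor <;> linarith
    · rintro ⟨h, h'⟩
      constructor <;> linarith
  by_cases h : Z ∈ BX (fun i j => α i j - D.B (q i) (q j)) β
  · rw [Set.indicator_of_mem h, Set.indicator_of_mem (hiff.2 h)]; rfl
  · rw [Set.indicator_of_notMem h, Set.indicator_of_notMem (fun h' => h (hiff.1 h'))]

end

section
variable {p : ℕ} {ι κ : Type} [Fintype ι] [Fintype κ]

structure Nrm (R0 Λ : ℝ) (Ξ : UU ι κ → ℝ) : Prop where
  R0pos : 0 < R0
  Lpos : 0 ≤ Λ
  hom : ∀ (s : ℝ) u, 0 < s → Ξ (s • u) = s * Ξ u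
  lip : ∀ u v, |Ξ u - Ξ v| ≤ Λ * ‖u - v‖
  low : ∀ u, ‖u‖ ≤ R0 * Ξ u

lemma Nrm.nonneg {R0 Λ : ℝ} {Ξ : UU ι κ → ℝ} (h : Nrm R0 Λ Ξ) (u : UU ι κ) : 0 ≤ Ξ u :=
  nonneg_of_mul_nonneg_right ((norm_nonneg u).trans (h.low u)) h.R0pos

lemma Nrm.cont {R0 Λ : ℝ} {Ξ : UU ι κ → ℝ} (h : Nrm R0 Λ Ξ) : Continuous Ξ :=
  (LipschitzWith.of_dist_le_mul (K := ⟨Λ, h.Lpos⟩) fun u v => by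
    rw [Real.dist_eq, dist_eq_norm]; exact h.lip u v).continuous

def cap {k : ℕ} (Ξ : UU ι κ → ℝ) (ρ ε : ℝ) (U : Fin k → UU ι κ) : ENNReal :=
  ENNReal.ofReal (min 1 ((ρ + ε - ‖fun i => Ξ (U i)‖) / ε))

def rg {k : ℕ} (Ξ : UU ι κ → ℝ) (ρ : ℝ) : Set (Fin k → UU ι κ) := {U | ∀ i, Ξ (U i) < ρ}

lemma rg_open {k : ℕ} {R0 Λ : ℝ} {Ξ : UU ι κ → ℝ} (h : Nrm R0 Λ Ξ) (ρ : ℝ) : IsOpen (rg Ξ ρ : Set (Fin k → UU ι κ)) := by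
  have : (rg Ξ ρ : Set (Fin k → UU ι κ)) = ⋂ i, (fun U => Ξ (U i)) ⁻¹' Set.Iio ρ := by ext; simp [rg]
  rw [this]
  exact isOpen_iInter_of_finite fun i => isOpen_Iio.preimage (h.cont.comp (continuous_apply i))

section
variable {k : ℕ} {R0 Λ : ℝ} {Ξ : UU ι κ → ℝ}

lemma cap_meas (h : Nrm R0 Λ Ξ) (ρ ε : ℝ) : Measurable (cap Ξ ρ ε : (Fin k → UU ι κ) → ENNReal) := by
  have : Continuous (fun U : Fin k → UU ι κ => ‖fun i => Ξ (U i)‖) :=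
    (continuous_pi fun i => h.cont.comp (continuous_apply i)).norm
  unfold cap
  have := this.measurable
  fun_prop

lemma cap_le_one (ρ ε : ℝ) (U : Fin k → UU ι κ) : cap Ξ ρ ε U ≤ 1 := by
  unfold cap
  rw [ENNReal.ofReal_le_one]; exact min_le_left _ _

lemma cap_lip (h : Nrm R0 Λ Ξ) (ρ ε d : ℝ) (hε : 0 < ε) (hd : 0 ≤ d) (U U' : Fin k → UU ι κ) (hU : ∀ i, ‖U i - U' i‖ ≤ d) :
    cap Ξ ρ ε U ≤ cap Ξ ρ ε U' + ENNReal.ofReal (Λ * d / ε) := by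
  have hL := h.Lpos
  have h1 : ‖fun i => Ξ (U' i)‖ ≤ ‖fun i => Ξ (U i)‖ + Λ * d := by
    have h2 : ‖(fun i => Ξ (U i)) - (fun i => Ξ (U' i))‖ ≤ Λ * d := by
      rw [pi_norm_le_iff_of_nonneg (by positivity)]
      intro i
      exact (h.lip _ _).trans (by gcongr; exact hU i)
    have h3 := norm_sub_norm_le (fun i => Ξ (U' i)) (fun i => Ξ (U i))
    rw [norm_sub_rev] at h3; linarith
  unfold cap
  have h0 : 0 ≤ Λ * d / ε := by positivity
  refine (ENNReal.ofReal_le_ofReal ?_).trans ENNReal.ofReal_add_le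
  have h4 : (ρ + ε - ‖fun i => Ξ (U i)‖) / ε ≤ (ρ + ε - ‖fun i => Ξ (U' i)‖) / ε + Λ * d / ε := by
    rw [← add_div]; gcongr; linarith
  rcases min_cases 1 ((ρ + ε - ‖fun i => Ξ (U' i)‖) / ε) with ⟨h5, _⟩ | ⟨h5, _⟩ <;> rw [h5]
  · exact (min_le_left _ _).trans (by linarith)
  · exact (min_le_right _ _).trans h4

lemma cap_supp {ρ ε : ℝ} (hε : 0 < ε) {U : Fin k → UU ι κ} (hU : cap Ξ ρ ε U ≠ 0) : U ∈ rg Ξ (ρ + ε) := by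
  intro i
  by_contra hi
  push Not at hi
  apply hU
  have := norm_le_pi_norm (fun i => Ξ (U i)) i
  have h2 := le_abs_self (Ξ (U i))
  rw [Real.norm_eq_abs] at this
  unfold cap
  rw [ENNReal.ofReal_eq_zero]
  refine (min_le_right _ _).trans (div_nonpos_of_nonpos_of_nonneg (by linarith) hε.le)

lemma cap_ge (h : Nrm R0 Λ Ξ) {ρ ε : ℝ} (hε : 0 < ε) (hρ : 0 ≤ ρ) {U : Fin k → UU ι κ} (hU : U ∈ rg Ξ ρ) : cap Ξ ρ ε U = 1 := by
  unfold cap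
  have : ‖fun i => Ξ (U i)‖ ≤ ρ := by
    rw [pi_norm_le_iff_of_nonneg hρ]
    intro i
    rw [Real.norm_eq_abs, abs_of_nonneg (h.nonneg _)]; exact (hU i).le
  rw [min_eq_left, ENNReal.ofReal_one]
  rw [le_div_iff₀ hε]; linarith

lemma rg_bound (h : Nrm R0 Λ Ξ) {ρ : ℝ} {U : Fin k → UU ι κ} (hU : U ∈ rg Ξ ρ) (i) : ‖U i‖ ≤ R0 * ρ :=
  (h.low _).trans (by have := h.R0pos; gcongr; exact (hU i).le)

def VG (D : Dat p ι κ) (F : (Fin k → UU ι κ) → ENNReal) (α β : Fin k → Fin k → ℝ) (q : Fin k → κ → ℝ) : ENNReal :=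
  (∫⁻ Y : Fin k → ι → ℝ, (D.box α β).indicator F (zip Y q)) / ENNReal.ofReal (pp β)

lemma VG_mono (D : Dat p ι κ) {F G : (Fin k → UU ι κ) → ENNReal} (h : ∀ U, F U ≤ G U) (α β : Fin k → Fin k → ℝ) (q : Fin k → κ → ℝ) :
    VG D F α β q ≤ VG D G α β q := by
  unfold VG
  gcongr with Y
  exact h _

def nb (R : ℝ) : (Fin k → UU ι κ) → ENNReal := {U | ∀ i, ‖U i‖ ≤ R}.indicator 1

lemma nb_meas (R : ℝ) : Measurable (nb R : (Fin k → UU ι κ) → ENNReal) := by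
  refine measurable_one.indicator ?_
  have : {U : Fin k → UU ι κ | ∀ i, ‖U i‖ ≤ R} = ⋂ i, {U | ‖U i‖ ≤ R} := by ext; simp
  rw [this]
  exact MeasurableSet.iInter fun i => measurableSet_le (by fun_prop) measurable_const

lemma Fq_supp {D : Dat p ι κ} {n R : ℝ} (hn : 1 ≤ n) (h3 : ∀ y q, nn (D.L1 y + D.L2 q) ≤ n * (‖y‖ + ‖q‖))
    {q : Fin k → κ → ℝ} {Z : Fin k → WW p} {i : Fin k}
    (hU : ‖((D.L1.symm (Z i - D.L2 (q i)), q i) : UU ι κ)‖ ≤ R) : nn (Z i) ≤ n * (2 * R) := by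
  have := h3 (D.L1.symm (Z i - D.L2 (q i))) (q i)
  simp only [LinearEquiv.apply_symm_apply, sub_add_cancel] at this
  refine this.trans ?_
  have h1 := (norm_fst_le _).trans hU
  have h2 := (norm_snd_le _).trans hU
  gcongr
  simp only at h1 h2
  linarith

lemma ub_nb (D : Dat p ι κ) (hk : k ≤ p + 1) (R : ℝ) (hR : 0 < R) : ∃ C : NNReal, ∀ (α β : Fin k → Fin k → ℝ) (q : Fin k → κ → ℝ),
    (∀ i j, 0 < β i j) → VG D (nb R) α β q ≤ C := by
  obtain ⟨n, hn, -, -, h3, -⟩ := D.bounds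
  obtain ⟨c, hc⟩ := theta (k := k) D
  obtain ⟨C, hC, hU⟩ := UB_all k p (n * (2 * R)) (by positivity) hk
  refine ⟨c * C.toNNReal, fun α β q hβ => ?_⟩
  rw [VG, hc _ (nb_meas R)]
  push_cast
  gcongr
  refine le_trans (Phi_mono _ _ fun Z => ?_) (hU _ _ hβ)
  unfold Fq nb
  by_cases h : (fun i => ((D.L1.symm (Z i - D.L2 (q i)), q i) : UU ι κ)) ∈ {U : Fin k → UU ι κ | ∀ i, ‖U i‖ ≤ R}
  · rw [Set.indicator_of_mem h, Bl_one fun i => Fq_supp hn h3 (h i)]; rfl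
  · rw [Set.indicator_of_notMem h]; exact zero_le

lemma hs_cap (D : Dat p ι κ) (hk : k ≤ p + 1) (R0 Λ : ℝ) (hR0 : 0 < R0) (hL : 0 ≤ Λ) : ∃ C : NNReal, ∀ Ξ : UU ι κ → ℝ, Nrm R0 Λ Ξ →
    ∀ (ρ ε Δ : ℝ) (α β α' β' : Fin k → Fin k → ℝ) (q q' : Fin k → κ → ℝ), 0 ≤ ρ → ρ ≤ 4 → 0 < ε → ε ≤ 1 → 0 < Δ → Δ ≤ 1 →
    (∀ i j, 0 < β i j ∧ β i j ≤ Δ) → (∀ i j, 0 < β' i j ∧ β' i j ≤ Δ) → (∀ i j, |α i j - α' i j| ≤ Δ) →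
    (∀ i, ‖q i - q' i‖ ≤ Δ) →
    VG D (cap Ξ ρ ε) α β q ≤ VG D (cap Ξ ρ ε) α' β' q' + ENNReal.ofReal (C * (ε⁻¹ * √Δ)) := by
  obtain ⟨n, hn, h1, h2, h3, h4⟩ := D.bounds
  obtain ⟨c, hc⟩ := theta (k := k) D
  set R := R0 * 5 with hR
  have hRpos : 0 < R := by positivity
  set R' := n * (2 * R) with hR'
  obtain ⟨C1, hC1, hU⟩ := UB_all k p R' (by positivity) hk
  obtain ⟨C2, hC2, hH⟩ := H_all k p R' (by positivity) hk
  set K := 1 + 2 * n * (R + 1) with hK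
  have hK1 : 1 ≤ K := by have : 0 ≤ 2 * n * (R + 1) := by positivity
                         linarith
  refine ⟨c * (Λ * n * C1 + (1 + Λ * n) * C2 * √K).toNNReal, fun Ξ hΞ ρ ε Δ α β α' β' q q' hρ hρ4 hε hε1 hΔ hΔ1 hβ hβ' hα hq => ?_⟩
  have hsup : ∀ (q : Fin k → κ → ℝ) Z, Fq D (cap Ξ ρ ε) q Z ≠ 0 → (∀ i, nn (Z i) ≤ R') ∧ ∀ i, ‖q i‖ ≤ R := by
    intro q Z hZ
    have hb : ∀ i, ‖((D.L1.symm (Z i - D.L2 (q i)), q i) : UU ι κ)‖ ≤ R := fun i =>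
      (rg_bound hΞ (cap_supp hε hZ) i).trans (by rw [hR]; gcongr; linarith)
    exact ⟨fun i => Fq_supp hn h3 (hb i), fun i => (norm_snd_le _).trans (hb i)⟩
  have hcm := cap_meas (k := k) hΞ ρ ε
  have hFm : ∀ q : Fin k → κ → ℝ, Measurable (Fq D (cap Ξ ρ ε) q) := fun q => by
    have hc1 : Continuous D.L1.symm := D.L1.symm.toLinearMap.continuous_of_finiteDimensional
    refine hcm.comp (measurable_pi_lambda _ fun i => Measurable.prodMk ?_ measurable_const)
    exact (hc1.comp (f := fun Z : Fin k → WW p => Z i - D.L2 (q i)) (by fun_prop)).measurable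
  by_cases hqR : ∀ i, ‖q i‖ ≤ R
  swap
  · have : VG D (cap Ξ ρ ε) α β q = 0 := by
      rw [VG, hc _ hcm, Phi_zero, mul_zero]
      intro Z
      by_contra hZ
      exact hqR (hsup q Z hZ).2
    rw [this]; exact zero_le
  have hqR' : ∀ i, ‖q' i‖ ≤ R + 1 := fun i => by
    have := norm_sub_norm_le (q' i) (q i)
    rw [norm_sub_rev] at this
    linarith [hq i, hqR i]
  -- step 1
  have s1 : ∀ Z, Fq D (cap Ξ ρ ε) q Z ≤ Fq D (cap Ξ ρ ε) q' Z + ENNReal.ofReal (Λ * (n * Δ) / ε) * Bl R' Z := by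
    intro Z
    by_cases hZ : Fq D (cap Ξ ρ ε) q Z = 0
    · rw [hZ]; exact zero_le
    rw [Bl_one (hsup q Z hZ).1, mul_one]
    refine cap_lip hΞ ρ ε (n * Δ) hε (by positivity) _ _ fun i => ?_
    rw [Prod.mk_sub_mk, ← map_sub]
    refine max_le ?_ ((hq i).trans (by nlinarith))
    have : Z i - D.L2 (q i) - (Z i - D.L2 (q' i)) = D.L2 (q' i - q i) := by rw [map_sub]; abel
    simp only
    rw [this]
    refine (h2 _).trans ?_
    rw [norm_sub_rev]; gcongr; exact hq i
  set a := ε / (1 + Λ * n) with ha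
  have hLn : 0 < 1 + Λ * n := by positivity
  have ha0 : 0 < a := by positivity
  have ha1 : a ≤ 1 := by rw [ha, div_le_one hLn]; nlinarith [mul_nonneg hL (by linarith : 0 ≤ n)]
  have adm : Adm R' (fun Z => 0 + ENNReal.ofReal a * Fq D (cap Ξ ρ ε) q' Z) := by
    refine ⟨by have := hFm q'; fun_prop, fun Z => ?_, fun Z Z' e he hZ => ?_, fun Z i hi => ?_⟩
    · rw [zero_add]
      refine mul_le_one' (ENNReal.ofReal_le_one.2 ha1) (cap_le_one _ _ _)
    · have := cap_lip hΞ ρ ε (n * e) hε (by positivity) (fun i => ((D.L1.symm (Z i - D.L2 (q' i)), q' i) : UU ι κ))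
        (fun i => ((D.L1.symm (Z' i - D.L2 (q' i)), q' i) : UU ι κ)) fun i => by
          rw [Prod.mk_sub_mk, ← map_sub, sub_self]
          have e1 : Z i - D.L2 (q' i) - (Z' i - D.L2 (q' i)) = Z i - Z' i := by abel
          rw [e1]
          refine max_le ((h1 _).trans ?_) (by simp only [norm_zero]; positivity)
          gcongr; exact hZ i
      rw [zero_add, zero_add]
      calc _ ≤ ENNReal.ofReal a * (_ + _) := mul_le_mul_right this _
        _ = ENNReal.ofReal a * Fq D (cap Ξ ρ ε) q' Z' + ENNReal.ofReal (a * (Λ * (n * e) / ε)) := by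
          rw [mul_add, ← ENNReal.ofReal_mul ha0.le]; rfl
        _ ≤ _ := by
          gcongr
          rw [ha, div_mul_div_comm, div_le_iff₀ (by positivity)]
          nlinarith [mul_nonneg hε.le he]
    · have : Fq D (cap Ξ ρ ε) q' Z = 0 := by
        by_contra h
        exact absurd ((hsup q' Z h).1 i) (not_le.2 hi)
      simp [this]
  have s2 := hH _ adm (K * Δ) (fun i j => α i j - D.B (q i) (q j)) β (fun i j => α' i j - D.B (q' i) (q' j)) β'
    (fun i j => ⟨(hβ i j).1, (hβ i j).2.trans (by nlinarith)⟩) (fun i j => ⟨(hβ' i j).1, (hβ' i j).2.trans (by nlinarith)⟩)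
    (fun i j => by
      have e1 : α i j - D.B (q i) (q j) - (α' i j - D.B (q' i) (q' j)) =
        (α i j - α' i j) - (D.B (q i - q' i) (q j) + D.B (q' i) (q j - q' j)) := by
        simp only [map_sub, LinearMap.sub_apply]; ring
      rw [e1]
      have t1 := abs_sub (α i j - α' i j) (D.B (q i - q' i) (q j) + D.B (q' i) (q j - q' j))
      have t2 := abs_add_le (D.B (q i - q' i) (q j)) (D.B (q' i) (q j - q' j))
      have t3 : |D.B (q i - q' i) (q j)| ≤ n * (Δ * (R + 1)) := (h4 _ _).trans (by
        gcongr
        · exact hq i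
        · linarith [hqR j])
      have t4 : |D.B (q' i) (q j - q' j)| ≤ n * ((R + 1) * Δ) := (h4 _ _).trans (by
        gcongr
        · exact hqR' i
        · exact hq j)
      have := hα i j
      rw [hK]; nlinarith)
  rw [Phi_add _ _ (fun _ => 0) _ (hFm q'), Phi_add _ _ (fun _ => 0) _ (hFm q'), Phi_zero _ _ (fun _ => rfl), Phi_zero _ _ (fun _ => rfl), zero_add, zero_add] at s2
  have s3 : Phi (fun i j => α i j - D.B (q i) (q j)) β (Fq D (cap Ξ ρ ε) q') ≤
      Phi (fun i j => α' i j - D.B (q' i) (q' j)) β' (Fq D (cap Ξ ρ ε) q') + ENNReal.ofReal (a⁻¹ * (C2 * √(K * Δ))) := by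
    have haa : ENNReal.ofReal a⁻¹ * ENNReal.ofReal a = 1 := by
      rw [← ENNReal.ofReal_mul (by positivity), inv_mul_cancel₀ ha0.ne', ENNReal.ofReal_one]
    have := mul_le_mul_right s2 (ENNReal.ofReal a⁻¹)
    rw [mul_add, ← mul_assoc, ← mul_assoc, haa, one_mul, one_mul, ← ENNReal.ofReal_mul (by positivity)] at this
    exact this
  have s4 := Phi_mono (fun i j => α i j - D.B (q i) (q j)) β s1
  rw [Phi_add _ _ _ _ (Bl_meas R')] at s4
  have s5 := hU (fun i j => α i j - D.B (q i) (q j)) β (fun i j => (hβ i j).1)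
  rw [VG, VG, hc _ hcm, hc _ hcm]
  calc _ ≤ (c : ENNReal) * (Phi (fun i j => α' i j - D.B (q' i) (q' j)) β' (Fq D (cap Ξ ρ ε) q') + ENNReal.ofReal (a⁻¹ * (C2 * √(K * Δ)))
        + ENNReal.ofReal (Λ * (n * Δ) / ε) * ENNReal.ofReal C1) := by
        gcongr
        exact s4.trans (add_le_add s3 (mul_le_mul_right s5 _))
    _ = (c : ENNReal) * Phi (fun i j => α' i j - D.B (q' i) (q' j)) β' (Fq D (cap Ξ ρ ε) q') + c * (ENNReal.ofReal (a⁻¹ * (C2 * √(K * Δ)) + Λ * (n * Δ) / ε * C1)) := by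
        rw [ENNReal.ofReal_add (by positivity) (by positivity), ENNReal.ofReal_mul (p := Λ * (n * Δ) / ε) (by positivity)]; ring
    _ ≤ _ := by
        gcongr
        push_cast
        rw [← ENNReal.ofReal_coe_nnreal (p := c), ← ENNReal.ofReal_mul (by positivity), mul_assoc, Real.coe_toNNReal _ (by positivity)]
        apply ENNReal.ofReal_le_ofReal
        gcongr
        have : Δ ≤ √Δ := Real.le_sqrt_of_sq_le (by nlinarith)
        rw [Real.sqrt_mul (by positivity), ha, inv_div]
        have e : (1 + Λ * n) / ε * (C2 * (√K * √Δ)) + Λ * (n * Δ) / ε * C1 = (Λ * n * C1 * Δ + (1 + Λ * n) * C2 * √K * √Δ) * ε⁻¹ := by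
          field_simp; ring
        rw [e]
        have : (Λ * n * C1 * Δ + (1 + Λ * n) * C2 * √K * √Δ) ≤ (Λ * n * C1 * √Δ + (1 + Λ * n) * C2 * √K * √Δ) := by gcongr
        calc _ ≤ (Λ * n * C1 * √Δ + (1 + Λ * n) * C2 * √K * √Δ) * ε⁻¹ := by gcongr
          _ = _ := by ring
end

end

section
section
variable {p : ℕ} {ι κ : Type} [Fintype ι] [Fintype κ] {k : ℕ} {R0 Λ : ℝ} {Ξ : UU ι κ → ℝ}

lemma pp_t {k : ℕ} (t : Fin k → ℝ) (β : Fin k → Fin k → ℝ) :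
    pp (fun i j => t i * t j * β i j) = (∏ i, t i) ^ (k - 1) * pp β := by
  induction k with
  | zero => simp [pp]
  | succ k ih =>
    rw [pp_succ, pp_succ, ih (fun i => t i.succ), Fin.prod_univ_succ, Finset.prod_mul_distrib, Finset.prod_mul_distrib,
      Finset.prod_const, Finset.card_univ, Fintype.card_fin, mul_pow]
    rcases k with _ | k
    · simp
    · simp only [Nat.add_sub_cancel]; ring

lemma pp_s {k : ℕ} (s : ℝ) (β : Fin k → Fin k → ℝ) :
    pp (fun i j => s ^ 2 * β i j) = s ^ (k * (k - 1)) * pp β := by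
  have := pp_t (fun _ : Fin k => s) β
  rw [Finset.prod_const, Finset.card_univ, Fintype.card_fin, ← pow_mul] at this
  rw [← this]; congr; ext i j; ring

lemma lint_smul {E : Type*} [NormedAddCommGroup E] [NormedSpace ℝ E] [FiniteDimensional ℝ E] [MeasurableSpace E] [BorelSpace E]
    (μ : Measure E) [μ.IsAddHaarMeasure] (s : ℝ) (hs : 0 < s) (f : E → ENNReal) :
    ∫⁻ x, f x ∂μ = ENNReal.ofReal (s ^ Module.finrank ℝ E) * ∫⁻ x, f (s • x) ∂μ := by
  have h := Measure.map_addHaar_smul μ hs.ne'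
  have h2 : ∫⁻ x, f (s • x) ∂μ = ∫⁻ x, f x ∂(Measure.map (s • ·) μ) :=
    (lintegral_map_equiv f (MeasurableEquiv.smul₀ s hs.ne')).symm
  rw [h2, h, lintegral_smul_measure, smul_eq_mul, ← mul_assoc, ← ENNReal.ofReal_mul (by positivity),
    abs_of_pos (by positivity), mul_inv_cancel₀ (by positivity), ENNReal.ofReal_one, one_mul]

lemma Dat.b_smul (D : Dat p ι κ) (s : ℝ) (u v : UU ι κ) : D.b (s • u) (s • v) = s ^ 2 * D.b u v := by
  have h : ∀ u v : WW p, om (s • u) (s • v) = s ^ 2 * om u v := fun u v => by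
    have := om_smul s u ((s:ℂ) • v)
    simp only [om, Finset.mul_sum] at *
    refine Finset.sum_congr rfl fun i _ => ?_
    simp; ring
  simp only [Dat.b, Prod.smul_fst, Prod.smul_snd, map_smul, ← smul_add, h, LinearMap.smul_apply, smul_eq_mul]
  ring

lemma box_smul (D : Dat p ι κ) {s : ℝ} (hs : 0 < s) (α β : Fin k → Fin k → ℝ) (U : Fin k → UU ι κ) :
    s • U ∈ D.box (fun i j => s ^ 2 * α i j) (fun i j => s ^ 2 * β i j) ↔ U ∈ D.box α β := by
  simp only [Dat.box, Set.mem_ofPred_eq, Pi.smul_apply, D.b_smul, Set.mem_Ioo, ← mul_add]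
  have : 0 < s ^ 2 := by positivity
  simp only [mul_lt_mul_iff_right₀ this]

lemma VG_scale (hι : Fintype.card ι = 2 * (k - 1)) (D : Dat p ι κ) {s : ℝ} (hs : 0 < s) (F : (Fin k → UU ι κ) → ENNReal)
    (α β : Fin k → Fin k → ℝ) (q : Fin k → κ → ℝ) :
    VG D F (fun i j => s ^ 2 * α i j) (fun i j => s ^ 2 * β i j) (s • q) =
      ENNReal.ofReal (s ^ (k * (k - 1))) * VG D (fun U => F (s • U)) α β q := by
  have i1 : (volume : Measure (Fin k → ι → ℝ)).IsAddHaarMeasure := Measure.pi.isAddHaarMeasure _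
  have hd : Module.finrank ℝ (Fin k → ι → ℝ) = k * (k - 1) + k * (k - 1) := by
    rw [Module.finrank_pi_fintype]; simp [hι]; ring
  unfold VG
  rw [lint_smul _ s hs, hd, pow_add, ENNReal.ofReal_mul (by positivity), pp_s, ENNReal.ofReal_mul (p := s ^ (k * (k - 1))) (by positivity)]
  have h0 : ENNReal.ofReal (s ^ (k * (k - 1))) ≠ 0 := by simp; positivity
  have e : ∀ Y : Fin k → ι → ℝ, (D.box (fun i j => s ^ 2 * α i j) (fun i j => s ^ 2 * β i j)).indicator F (zip (s • Y) (s • q)) =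
      (D.box α β).indicator (fun U => F (s • U)) (zip Y q) := fun Y => by
    have h1 : zip (s • Y) (s • q) = s • zip Y q := rfl
    rw [h1]
    by_cases h : zip Y q ∈ D.box α β
    · rw [Set.indicator_of_mem h, Set.indicator_of_mem ((box_smul D hs _ _ _).2 h)]
    · rw [Set.indicator_of_notMem h, Set.indicator_of_notMem fun h' => h ((box_smul D hs _ _ _).1 h')]
  simp only [e]
  rw [mul_assoc, ENNReal.mul_div_mul_left _ _ h0 ENNReal.ofReal_ne_top, mul_div_assoc]

def VV (D : Dat p ι κ) (Ξ : UU ι κ → ℝ) (ρ : ℝ) (α β : Fin k → Fin k → ℝ) (q : Fin k → κ → ℝ) : ENNReal :=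
  VG D ((rg Ξ ρ).indicator 1) α β q

lemma rg_smul (h : Nrm R0 Λ Ξ) {s ρ : ℝ} (hs : 0 < s) (U : Fin k → UU ι κ) : s • U ∈ rg Ξ (s * ρ) ↔ U ∈ rg Ξ ρ := by
  simp only [rg, Set.mem_ofPred_eq, Pi.smul_apply, h.hom _ _ hs, mul_lt_mul_iff_right₀ hs]

lemma VV_scale (hι : Fintype.card ι = 2 * (k - 1)) (D : Dat p ι κ) (h : Nrm R0 Λ Ξ) {s : ℝ} (hs : 0 < s) (ρ : ℝ)
    (α β : Fin k → Fin k → ℝ) (q : Fin k → κ → ℝ) :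
    VV D Ξ (s * ρ) (fun i j => s ^ 2 * α i j) (fun i j => s ^ 2 * β i j) (s • q) =
      ENNReal.ofReal (s ^ (k * (k - 1))) * VV D Ξ ρ α β q := by
  unfold VV
  rw [VG_scale hι D hs]
  congr 2; ext U
  by_cases hU : U ∈ rg Ξ ρ
  · rw [Set.indicator_of_mem hU, Set.indicator_of_mem ((rg_smul h hs U).2 hU)]; rfl
  · rw [Set.indicator_of_notMem hU, Set.indicator_of_notMem fun h' => hU ((rg_smul h hs U).1 h')]

lemma nb_scale (hι : Fintype.card ι = 2 * (k - 1)) (D : Dat p ι κ) {s : ℝ} (hs : 0 < s) (R : ℝ)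
    (α β : Fin k → Fin k → ℝ) (q : Fin k → κ → ℝ) :
    VG D (nb (s * R)) (fun i j => s ^ 2 * α i j) (fun i j => s ^ 2 * β i j) (s • q) =
      ENNReal.ofReal (s ^ (k * (k - 1))) * VG D (nb R) α β q := by
  rw [VG_scale hι D hs]
  congr 2; ext U
  have : s • U ∈ {U : Fin k → UU ι κ | ∀ i, ‖U i‖ ≤ s * R} ↔ U ∈ {U : Fin k → UU ι κ | ∀ i, ‖U i‖ ≤ R} := by
    simp only [Set.mem_ofPred_eq, Pi.smul_apply, norm_smul, Real.norm_eq_abs, abs_of_pos hs, mul_le_mul_iff_right₀ hs]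
  unfold nb
  by_cases hU : U ∈ {U : Fin k → UU ι κ | ∀ i, ‖U i‖ ≤ R}
  · rw [Set.indicator_of_mem hU, Set.indicator_of_mem (this.2 hU)]; rfl
  · rw [Set.indicator_of_notMem hU, Set.indicator_of_notMem fun h' => hU (this.1 h')]

lemma ub_nb_T (hι : Fintype.card ι = 2 * (k - 1)) (D : Dat p ι κ) (hk : k ≤ p + 1) (R : ℝ) (hR : 0 < R) : ∃ C : NNReal, ∀ (T : ℝ) (α β : Fin k → Fin k → ℝ) (q : Fin k → κ → ℝ),
    0 < T → (∀ i j, 0 < β i j) → VG D (nb (T * R)) α β q ≤ ENNReal.ofReal (T ^ (k * (k - 1))) * C := by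
  obtain ⟨C, hC⟩ := ub_nb (k := k) D hk R hR
  refine ⟨C, fun T α β q hT hβ => ?_⟩
  have := nb_scale hι D hT R (fun i j => α i j / T ^ 2) (fun i j => β i j / T ^ 2) (T⁻¹ • q)
  simp only [smul_smul, mul_inv_cancel₀ hT.ne', one_smul, mul_div_cancel₀ _ (pow_pos hT 2).ne'] at this
  rw [this]
  gcongr
  exact hC _ _ _ fun i j => by have := hβ i j; positivity

lemma VV_zero (D : Dat p ι κ) (h : Nrm R0 Λ Ξ) {ρ : ℝ} {α β : Fin k → Fin k → ℝ} {q : Fin k → κ → ℝ}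
    (i : Fin k) (hq : R0 * ρ < ‖q i‖) : VV D Ξ ρ α β q = 0 := by
  have : ∀ Y : Fin k → ι → ℝ, (D.box α β).indicator ((rg Ξ ρ).indicator (1 : (Fin k → UU ι κ) → ENNReal)) (zip Y q) = 0 := fun Y => by
    have : zip Y q ∉ rg Ξ ρ := fun hh => by
      have := (norm_snd_le _).trans (rg_bound h hh i)
      simp only [zip] at this
      linarith
    refine Set.indicator_apply_eq_zero.2 fun _ => Set.indicator_of_notMem this _
  simp [VV, VG, this]

lemma hs_VV (D : Dat p ι κ) (hk : k ≤ p + 1) (R0 Λ : ℝ) (hR0 : 0 < R0) (hL : 0 ≤ Λ) : ∃ C : NNReal, ∀ Ξ : UU ι κ → ℝ, Nrm R0 Λ Ξ →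
    ∀ (ρ ε Δ : ℝ) (α β α' β' : Fin k → Fin k → ℝ) (q q' : Fin k → κ → ℝ), 0 ≤ ρ → ρ ≤ 4 → 0 < ε → ε ≤ 1 → 0 < Δ → Δ ≤ 1 →
    (∀ i j, 0 < β i j ∧ β i j ≤ Δ) → (∀ i j, 0 < β' i j ∧ β' i j ≤ Δ) → (∀ i j, |α i j - α' i j| ≤ Δ) →
    (∀ i, ‖q i - q' i‖ ≤ Δ) →
    VV D Ξ ρ α β q ≤ VV D Ξ (ρ + ε) α' β' q' + ENNReal.ofReal (C * (ε⁻¹ * √Δ)) := by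
  obtain ⟨C, hC⟩ := hs_cap (k := k) D hk R0 Λ hR0 hL
  refine ⟨C, fun Ξ hΞ ρ ε Δ α β α' β' q q' hρ hρ4 hε hε1 hΔ hΔ1 hβ hβ' hα hq => ?_⟩
  refine le_trans (VG_mono D (fun U => ?_) α β q) ((hC Ξ hΞ ρ ε Δ α β α' β' q q' hρ hρ4 hε hε1 hΔ hΔ1 hβ hβ' hα hq).trans
    (add_le_add_left (VG_mono D (fun U => ?_) α' β' q') _))
  · by_cases hU : U ∈ rg Ξ ρ
    · rw [Set.indicator_of_mem hU, cap_ge hΞ hε hρ hU]; rfl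
    · rw [Set.indicator_of_notMem hU]; exact zero_le
  · by_cases hU : U ∈ rg Ξ (ρ + ε)
    · rw [Set.indicator_of_mem hU]; exact cap_le_one _ _ _
    · have : cap Ξ ρ ε U = 0 := by
        by_contra h; exact hU (cap_supp hε h)
      rw [this]; exact zero_le

def vint (D : Dat p ι κ) (Ξ : UU ι κ → ℝ) (ρ : ℝ) (α β : Fin k → Fin k → ℝ) (φ : (Fin k → κ → ℝ) → (Fin k → κ → ℝ)) : ENNReal :=
  ∫⁻ q, VV D Ξ ρ α β (φ q)

lemma hs_int (D : Dat p ι κ) (hk : k ≤ p + 1) (R0 Λ : ℝ) (hR0 : 0 < R0) (hL : 0 ≤ Λ) : ∃ C : NNReal, ∀ Ξ : UU ι κ → ℝ, Nrm R0 Λ Ξ →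
    ∀ (ρ ε Δ : ℝ) (α β α' β' : Fin k → Fin k → ℝ) (φ ψ : (Fin k → κ → ℝ) → (Fin k → κ → ℝ)), 0 ≤ ρ → ρ ≤ 4 → 0 < ε → ε ≤ 1 → 0 < Δ → Δ ≤ 1 →
    (∀ i j, 0 < β i j ∧ β i j ≤ Δ) → (∀ i j, 0 < β' i j ∧ β' i j ≤ Δ) → (∀ i j, |α i j - α' i j| ≤ Δ) →
    (∀ q i, ‖φ q i - ψ q i‖ ≤ Δ) → (∀ q i, ‖φ q i - q i‖ ≤ 1) →
    vint D Ξ ρ α β φ ≤ vint D Ξ (ρ + ε) α' β' ψ + ENNReal.ofReal (C * (ε⁻¹ * √Δ)) := by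
  obtain ⟨C, hC⟩ := hs_VV (k := k) D hk R0 Λ hR0 hL
  set Bq : Set (Fin k → κ → ℝ) := Metric.closedBall 0 (R0 * 4 + 1) with hB
  have hfin : volume Bq < ⊤ := measure_closedBall_lt_top
  refine ⟨C * (volume Bq).toNNReal, fun Ξ hΞ ρ ε Δ α β α' β' φ ψ hρ hρ4 hε hε1 hΔ hΔ1 hβ hβ' hα h1 h2 => ?_⟩
  unfold vint
  calc ∫⁻ q, VV D Ξ ρ α β (φ q) ≤ ∫⁻ q, (VV D Ξ (ρ + ε) α' β' (ψ q) + Bq.indicator (fun _ => ENNReal.ofReal (C * (ε⁻¹ * √Δ))) q) := by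
        refine lintegral_mono fun q => ?_
        by_cases hq : q ∈ Bq
        · rw [Set.indicator_of_mem hq]
          exact hC Ξ hΞ ρ ε Δ α β α' β' _ _ hρ hρ4 hε hε1 hΔ hΔ1 hβ hβ' hα (h1 q)
        · have : ∃ i, R0 * ρ < ‖φ q i‖ := by
            by_contra! hh
            apply hq
            rw [hB, mem_closedBall_zero_iff, pi_norm_le_iff_of_nonneg (by positivity)]
            intro i
            have t := norm_sub_norm_le (q i) (φ q i)
            rw [norm_sub_rev] at t
            have := h2 q i; have := hh i
            nlinarith
          obtain ⟨i, hi⟩ := this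
          simp only
          rw [VV_zero D hΞ i hi]; exact zero_le
    _ = (∫⁻ q, VV D Ξ (ρ + ε) α' β' (ψ q)) + ENNReal.ofReal (C * (ε⁻¹ * √Δ)) * volume Bq := by
        rw [lintegral_add_right _ (measurable_const.indicator Metric.isClosed_closedBall.measurableSet),
          lintegral_indicator_const Metric.isClosed_closedBall.measurableSet]
    _ = _ := by
        congr 1
        rw [← ENNReal.coe_toNNReal hfin.ne, ← ENNReal.ofReal_coe_nnreal (p := (volume Bq).toNNReal), ← ENNReal.ofReal_mul (by positivity)]
        congr 1; push_cast; simp; ring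

lemma vint_scale (hι : Fintype.card ι = 2 * (k - 1)) (D : Dat p ι κ) (h : Nrm R0 Λ Ξ) {s : ℝ} (hs : 0 < s) (ρ : ℝ)
    (α β : Fin k → Fin k → ℝ) :
    vint D Ξ (s * ρ) (fun i j => s ^ 2 * α i j) (fun i j => s ^ 2 * β i j) id =
      ENNReal.ofReal (s ^ (k * (k - 1) + k * Fintype.card κ)) * vint D Ξ ρ α β id := by
  have i1 : (volume : Measure (Fin k → κ → ℝ)).IsAddHaarMeasure := Measure.pi.isAddHaarMeasure _
  have hd : Module.finrank ℝ (Fin k → κ → ℝ) = k * Fintype.card κ := by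
    rw [Module.finrank_pi_fintype]; simp
  unfold vint
  rw [lint_smul _ s hs, hd]
  simp only [id, VV_scale hι D h hs]
  rw [lintegral_const_mul' _ _ ENNReal.ofReal_ne_top, ← mul_assoc, ← ENNReal.ofReal_mul (by positivity), pow_add, mul_comm (s ^ (k * (k - 1)))]
end

end

section
set_option linter.unusedSectionVars false
section
variable {A B : Type} [Fintype A] [Fintype B]

def fz (P : A → B → ℤ) : A → B → ℝ := fun a b => (P a b : ℝ)
def flo (x : A → B → ℝ) : A → B → ℤ := fun a b => ⌊x a b⌋
def cb (A B : Type) : Set (A → B → ℝ) := {x | ∀ a b, x a b ∈ Set.Ico (0:ℝ) 1}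

lemma cb_eq : cb A B = Set.univ.pi (fun _ => Set.univ.pi fun _ => Set.Ico (0:ℝ) 1) := by
  ext; simp [cb]
lemma cb_meas : MeasurableSet (cb A B) := by
  rw [cb_eq]
  exact MeasurableSet.univ_pi fun _ => MeasurableSet.univ_pi fun _ => measurableSet_Ico
lemma cb_vol : volume (cb A B) = 1 := by
  rw [cb_eq, volume_pi_pi]
  simp [volume_pi_pi]

lemma flo_iff (x : A → B → ℝ) (P : A → B → ℤ) : x - fz P ∈ cb A B ↔ P = flo x := by
  simp only [cb, fz, flo, Set.mem_ofPred_eq, Pi.sub_apply, Set.mem_Ico, funext_iff]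
  refine forall_congr' fun a => forall_congr' fun b => ?_
  rw [eq_comm, Int.floor_eq_iff]
  constructor <;> rintro ⟨h, h'⟩ <;> constructor <;> linarith

lemma tile (f : (A → B → ℝ) → ENNReal) (hf : Measurable f) :
    ∫⁻ x, f x = ∑' P : A → B → ℤ, ∫⁻ x in cb A B, f (x + fz P) := by
  have i1 : (volume : Measure (A → B → ℝ)).IsAddHaarMeasure := Measure.pi.isAddHaarMeasure _
  have h1 : ∀ x, f x = ∑' P : A → B → ℤ, (cb A B).indicator (fun z => f (z + fz P)) (x - fz P) := fun x => by
    rw [tsum_eq_single (flo x), Set.indicator_of_mem ((flo_iff x _).2 rfl), sub_add_cancel]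
    intro P hP
    exact Set.indicator_of_notMem (fun h => hP ((flo_iff x P).1 h)) _
  have h2 : ∀ P : A → B → ℤ, Measurable ((cb A B).indicator (fun z => f (z + fz P))) := fun P =>
    (hf.comp (measurable_id.add_const _)).indicator cb_meas
  calc ∫⁻ x, f x = ∫⁻ x, ∑' P : A → B → ℤ, (cb A B).indicator (fun z => f (z + fz P)) (x - fz P) := lintegral_congr h1
    _ = ∑' P : A → B → ℤ, ∫⁻ x, (cb A B).indicator (fun z => f (z + fz P)) (x - fz P) :=
      lintegral_tsum fun P => ((h2 P).comp (measurable_id.sub_const _)).aemeasurable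
    _ = _ := by
      congr 1; ext P
      rw [lintegral_sub_right_eq_self (fun x => (cb A B).indicator (fun z => f (z + fz P)) x), lintegral_indicator cb_meas]

lemma sum_floor (g : (A → B → ℤ) → ENNReal) : ∫⁻ x : A → B → ℝ, g (flo x) = ∑' P, g P := by
  have hfl : Measurable (flo : (A → B → ℝ) → (A → B → ℤ)) := by
    unfold flo
    refine measurable_pi_lambda _ fun a => measurable_pi_lambda _ fun b => Int.measurable_floor.comp ?_
    fun_prop
  rw [tile (fun x => g (flo x)) ((Measurable.of_discrete (f := g)).comp hfl)]
  congr 1; ext P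
  have : ∀ x ∈ cb A B, g (flo (x + fz P)) = g P := fun x hx => by
    rw [← (flo_iff (x + fz P) P).1 (by simpa using hx)]
  rw [setLIntegral_congr_fun cb_meas this, setLIntegral_const, cb_vol, mul_one]

lemma per_shift (f : (A → B → ℝ) → ENNReal) (hf : Measurable f) (hp : ∀ x P, f (x + fz P) = f x) (x0 : A → B → ℝ) :
    ∫⁻ x in cb A B, f (x + x0) = ∫⁻ x in cb A B, f x := by
  have i1 : (volume : Measure (A → B → ℝ)).IsAddHaarMeasure := Measure.pi.isAddHaarMeasure _
  have hi : Measurable ((cb A B).indicator (fun _ => (1:ENNReal))) := measurable_const.indicator cb_meas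
  have hi2 : ∀ c : A → B → ℝ, Measurable (fun x => (cb A B).indicator (fun _ => (1:ENNReal)) (x + c)) :=
    fun c => hi.comp (measurable_id.add_const _)
  have e1 : ∫⁻ x in cb A B, f (x + x0) = ∫⁻ x, (cb A B).indicator (fun _ => 1) (x - x0) * f x := by
    rw [← lintegral_add_right_eq_self (fun x => (cb A B).indicator (fun _ => 1) (x - x0) * f x) x0, ← lintegral_indicator cb_meas]
    refine lintegral_congr fun x => ?_
    by_cases h : x ∈ cb A B <;> simp [h]
  rw [e1, tile]
  · have e2 : ∀ P : A → B → ℤ, ∫⁻ x in cb A B, (cb A B).indicator (fun _ => 1) (x + fz P - x0) * f (x + fz P) =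
        ∫⁻ x in cb A B, (cb A B).indicator (fun _ => 1) (x + (fz P - x0)) * f x := fun P => by
      refine lintegral_congr fun x => ?_
      rw [hp, add_sub_assoc]
    simp only [e2]
    rw [← lintegral_tsum (f := fun P x => (cb A B).indicator (fun _ => 1) (x + (fz P - x0)) * f x) fun P => ((hi2 _).mul hf).aemeasurable]
    refine lintegral_congr fun x => ?_
    rw [ENNReal.tsum_mul_right, tsum_eq_single (-flo (x - x0)), Set.indicator_of_mem, one_mul]
    · have := (flo_iff (x - x0) _).2 rfl
      convert! this using 1
      ext a b; simp [fz]; ring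
    · intro P hP
      refine Set.indicator_of_notMem (fun h => hP ?_) _
      rw [eq_neg_iff_add_eq_zero, ← sub_neg_eq_add, sub_eq_add_neg, neg_neg, add_comm, ← eq_neg_iff_add_eq_zero, eq_comm]
      rw [← (flo_iff (x - x0) (-P)).1]
      convert! h using 1
      ext a b; simp [fz]; ring
  · simp only [sub_eq_add_neg]
    exact (hi2 _).mul hf
end

end

section
set_option linter.unusedSectionVars false
section
variable {A ι κ : Type} [Fintype A] [Fintype ι] [Fintype κ]

def aX (X : ι → κ → ℝ) (Q : A → κ → ℝ) : A → ι → ℝ := fun s a => ∑ b, X a b * Q s b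

lemma aX_add (X X' : ι → κ → ℝ) (Q : A → κ → ℝ) : aX (X + X') Q = aX X Q + aX X' Q := by
  ext s a; simp [aX, add_mul, Finset.sum_add_distrib]

lemma aX_fz (X : ι → κ → ℤ) (Q : A → κ → ℤ) : ∃ P, aX (fz X) (fz Q) = fz P :=
  ⟨fun s a => ∑ b, X a b * Q s b, by ext s a; simp [aX, fz]⟩

lemma aX_cont (Q : A → κ → ℝ) : Continuous (fun X : ι → κ → ℝ => aX X Q) := by
  unfold aX; fun_prop

lemma aX_surj {Q : A → κ → ℝ} (h : LinearIndependent ℝ Q) (t : A → ι → ℝ) : ∃ X : ι → κ → ℝ, aX X Q = t := by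
  classical
  have h1 : ∀ a : ι, ∃ φ : (κ → ℝ) →ₗ[ℝ] ℝ, ∀ s, φ (Q s) = t s a := fun a => by
    obtain ⟨φ, hφ⟩ := LinearMap.exists_leftInverse_of_injective _ (LinearMap.ker_eq_bot.2 h)
    refine ⟨(Finsupp.linearCombination ℝ (fun s => t s a)) ∘ₗ φ, fun s => ?_⟩
    have := LinearMap.congr_fun hφ (Finsupp.single s 1)
    simp only [LinearMap.comp_apply, Finsupp.linearCombination_single, one_smul, LinearMap.id_apply] at this
    simp [this]
  choose φ hφ using h1
  refine ⟨fun a b => φ a (Pi.single b 1), ?_⟩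
  ext s a
  rw [← hφ a s, LinearMap.pi_apply_eq_sum_univ (φ a) (Q s)]
  simp only [aX, smul_eq_mul]
  refine Finset.sum_congr rfl fun b _ => ?_
  rw [mul_comm]; congr 2
  ext j; simp [Pi.single_apply, eq_comm]

lemma unfold_eq {Q : A → κ → ℤ} (h : LinearIndependent ℝ (fz Q)) (G : (A → ι → ℝ) → ENNReal) (hG : Measurable G) :
    ∫⁻ X in cb ι κ, ∑' P, G (fz P + aX X (fz Q)) = ∫⁻ Y, G Y := by
  set Ψ : (A → ι → ℝ) → ENNReal := fun Y => ∑' P, G (fz P + Y) with hΨ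
  have hm : Measurable Ψ := Measurable.tsum fun P => hG.comp (measurable_id.const_add _)
  have hper : ∀ Y P, Ψ (Y + fz P) = Ψ Y := fun Y P => by
    simp only [hΨ]
    rw [← Equiv.tsum_eq (Equiv.addRight P) (fun P' => G (fz P' + Y))]
    congr 1; ext P'; congr 1
    ext s a; simp [fz]; ring
  have hc := (aX_cont (ι := ι) (fz Q)).measurable
  have h1 : ∀ t, ∫⁻ X in cb ι κ, Ψ (aX X (fz Q)) = ∫⁻ X in cb ι κ, Ψ (aX X (fz Q) + t) := fun t => by
    obtain ⟨X0, hX0⟩ := aX_surj h t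
    rw [← per_shift (fun X => Ψ (aX X (fz Q))) (hm.comp hc) _ X0]
    · simp only [aX_add, hX0]
    · intro X P
      obtain ⟨P', hP'⟩ := aX_fz P Q
      rw [aX_add, hP', hper]
  have h2 : ∫⁻ X in cb ι κ, Ψ (aX X (fz Q)) = ∫⁻ t in cb A ι, ∫⁻ X in cb ι κ, Ψ (aX X (fz Q) + t) := by
    rw [← lintegral_congr h1, setLIntegral_const, cb_vol, mul_one]
  change ∫⁻ X in cb ι κ, Ψ (aX X (fz Q)) = _
  rw [h2, lintegral_lintegral_swap]
  · have : ∀ X : ι → κ → ℝ, ∫⁻ t in cb A ι, Ψ (aX X (fz Q) + t) = ∫⁻ Y, G Y := fun X => by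
      simp only [add_comm (aX X (fz Q))]
      rw [per_shift Ψ hm hper, hΨ, tile G hG, lintegral_tsum]
      · simp only [add_comm]
      · exact fun P => (hG.comp (measurable_id.const_add _)).aemeasurable
    simp only [this]
    rw [setLIntegral_const, cb_vol, mul_one]
  · exact (hm.comp (f := fun z : (A → ι → ℝ) × (ι → κ → ℝ) => aX z.2 (fz Q) + z.1) ((hc.comp measurable_snd).add measurable_fst)).aemeasurable

lemma torus_le (σ : A → Prop) [DecidablePred σ] {Q : A → κ → ℤ} (h : LinearIndependent ℝ (fun s : {s // σ s} => fz Q s))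
    (H H' : (A → ι → ℝ) → ENNReal) (hH' : Measurable H')
    (hle : ∀ Y e, (∀ s, σ s → e s = 0) → e ∈ cb A ι → H Y ≤ H' (Y + e)) :
    ∫⁻ X in cb ι κ, ∑' P, H (fz P + aX X (fz Q)) ≤ ∫⁻ Y, H' Y := by
  let E := MeasurableEquiv.piEquivPiSubtypeProd (fun _ : A => ι → ℝ) σ
  have hE := volume_preserving_piEquivPiSubtypeProd (fun _ : A => ι → ℝ) σ
  let G : ({s // σ s} → ι → ℝ) → ENNReal := fun y => ∫⁻ w : {s // ¬ σ s} → ι → ℝ, H' (E.symm (y, w))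
  have hm : Measurable (fun z => H' (E.symm z)) := hH'.comp E.symm.measurable
  have hG : Measurable G := hm.lintegral_prod_right'
  have e1 : ∫⁻ Y, H' Y = ∫⁻ y, G y := by
    have := hE.symm.lintegral_comp_emb E.symm.measurableEmbedding H'
    rw [← this]
    exact lintegral_prod _ hm.aemeasurable
  rw [e1, ← unfold_eq (Q := fun s : {s // σ s} => Q s) h G hG]
  refine lintegral_mono fun X => ?_
  let E2 := Equiv.piEquivPiSubtypeProd σ (fun _ : A => ι → ℤ)
  simp only
  rw [← Equiv.tsum_eq E2.symm, ENNReal.tsum_prod (f := fun a b => H (fz (E2.symm (a, b)) + aX X (fz Q)))]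
  refine ENNReal.tsum_le_tsum fun Ps => ?_
  set y := fz Ps + aX X (fz fun s : {s // σ s} => Q s) with hy
  set z := aX X (fz fun s : {s // ¬ σ s} => Q s) with hz
  have i1 : (volume : Measure ({s // ¬ σ s} → ι → ℝ)).IsAddHaarMeasure := Measure.pi.isAddHaarMeasure _
  have hmy : Measurable (fun w => H' (E.symm (y, w + z))) :=
    hm.comp (measurable_const.prodMk (measurable_id.add_const _))
  have e2 : G y = ∑' Pw, ∫⁻ w in cb {s // ¬ σ s} ι, H' (E.symm (y, w + fz Pw + z)) := by
    simp only [G]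
    rw [← lintegral_add_right_eq_self _ z, tile _ hmy]
  change _ ≤ G y
  rw [e2]
  refine ENNReal.tsum_le_tsum fun Pw => ?_
  have e3 : ∀ c : ENNReal, c = ∫⁻ w in cb {s // ¬ σ s} ι, c := fun c => by rw [setLIntegral_const, cb_vol, mul_one]
  rw [e3 (H _)]
  refine setLIntegral_mono (hm.comp (measurable_const.prodMk ((measurable_id.add_const _).add_const _))) fun w hw => ?_
  refine (hle _ (fun s => if hs : σ s then 0 else w ⟨s, hs⟩) (fun s hs => by simp [hs]) (fun s a => ?_)).trans (le_of_eq ?_)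
  · by_cases hs : σ s
    · simp [hs]
    · simp only [hs, dite_false]; exact hw _ _
  · congr 1
    ext s a
    by_cases hs : σ s
    · simp [E2, E, MeasurableEquiv.piEquivPiSubtypeProd, fz, hs, hy, aX]
    · simp [E2, E, MeasurableEquiv.piEquivPiSubtypeProd, fz, hs, hz, aX]; ring
end

end

section
set_option linter.unusedSectionVars false
section
variable {A κ : Type} [Fintype A] [Fintype κ] [DecidableEq A] [DecidableEq κ]

lemma coord_sub (n : ℕ) : ∀ W : Submodule ℝ (κ → ℝ), Module.finrank ℝ W ≤ n →
    ∃ J : Finset κ, J.card ≤ n ∧ ∀ w ∈ W, (∀ j ∈ J, w j = 0) → w = 0 := by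
  induction n with
  | zero =>
    intro W hW
    have : W = ⊥ := Submodule.finrank_eq_zero.1 (Nat.le_zero.1 hW)
    exact ⟨∅, by simp, fun w hw _ => by simpa [this] using hw⟩
  | succ n ih =>
    intro W hW
    by_cases hb : ∀ w ∈ W, w = 0
    · exact ⟨∅, by simp, fun w hw _ => hb w hw⟩
    push Not at hb
    obtain ⟨w, hw, hw0⟩ := hb
    obtain ⟨j, hj⟩ : ∃ j, w j ≠ 0 := by
      by_contra! h; exact hw0 (funext h)
    have hlt : W ⊓ LinearMap.ker (LinearMap.proj j : (κ → ℝ) →ₗ[ℝ] ℝ) < W := by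
      refine lt_of_le_of_ne inf_le_left fun h => hj ?_
      have : w ∈ W ⊓ LinearMap.ker (LinearMap.proj j : (κ → ℝ) →ₗ[ℝ] ℝ) := by rw [h]; exact hw
      simpa using this.2
    obtain ⟨J, hJ, hJ2⟩ := ih (W ⊓ LinearMap.ker (LinearMap.proj j : (κ → ℝ) →ₗ[ℝ] ℝ)) (by have := Submodule.finrank_lt_finrank_of_lt hlt; omega)
    refine ⟨insert j J, (Finset.card_insert_le _ _).trans (by omega), fun v hv hv2 => hJ2 v ⟨hv, ?_⟩ fun i hi => hv2 i (Finset.mem_insert_of_mem hi)⟩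
    simpa using hv2 j (Finset.mem_insert_self _ _)

def bxf (A κ : Type) [Fintype A] [Fintype κ] [DecidableEq A] [DecidableEq κ] (N : ℕ) : Finset (A → κ → ℤ) :=
  Fintype.piFinset fun _ => Fintype.piFinset fun _ => Finset.Icc (-(N:ℤ)) N

lemma bxf_card (N : ℕ) : (bxf A κ N).card = (2 * N + 1) ^ (Fintype.card κ * Fintype.card A) := by
  simp only [bxf, Fintype.card_piFinset, Int.card_Icc, Finset.prod_const, Finset.card_univ, ← pow_mul]
  congr 1; omega

lemma mem_bxf {N : ℕ} {Q : A → κ → ℤ} : Q ∈ bxf A κ N ↔ ∀ s b, -(N:ℤ) ≤ Q s b ∧ Q s b ≤ N := by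
  simp [bxf, Fintype.mem_piFinset]

open Classical in
lemma count_dep (N : ℕ) (σ : Finset A) :
    ((bxf A κ N).filter fun Q => ∀ s, fz Q s ∈ Submodule.span ℝ (fz Q '' σ)).card ≤
      (2 * N + 1) ^ (σ.card * (Fintype.card A - σ.card) + Fintype.card κ * σ.card) := by
  rw [pow_add]
  refine (Finset.card_le_mul_card_image (f := fun (Q : A → κ → ℤ) (s : σ) => Q s) _ ((2 * N + 1) ^ (σ.card * (Fintype.card A - σ.card))) ?_).trans ?_
  · intro q hq
    set W : Submodule ℝ (κ → ℝ) := Submodule.span ℝ (Set.range (fz q)) with hW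
    have hr : Module.finrank ℝ W ≤ σ.card := by
      refine (finrank_range_le_card (R := ℝ) (fz q)).trans (by simp)
    obtain ⟨J, hJ, hJ2⟩ := coord_sub _ W hr
    have key : ∀ Q : A → κ → ℤ, (∀ s, fz Q s ∈ Submodule.span ℝ (fz Q '' σ)) → (fun s : σ => Q s) = q → ∀ s, fz Q s ∈ W := by
      intro Q h1 h2 s
      have : fz Q '' σ = Set.range (fz q) := by
        ext x
        simp only [Set.mem_image, Finset.mem_coe, Set.mem_range, ← h2, Subtype.exists]
        constructor
        · rintro ⟨a, ha, h⟩; exact ⟨a, ha, h⟩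
        · rintro ⟨a, ha, h⟩; exact ⟨a, ha, h⟩
      rw [hW, ← this]; exact h1 s
    refine (Finset.card_le_card_of_injOn (t := bxf {s // s ∉ σ} J N) (fun Q s j => Q s j) ?_ ?_).trans ?_
    · intro Q hQ
      simp only [Finset.coe_filter, Finset.mem_filter, Set.mem_ofPred_eq] at hQ
      refine mem_bxf.2 fun s b => mem_bxf.1 hQ.1.1 s b
    · intro Q hQ Q' hQ' h
      simp only [Finset.coe_filter, Finset.mem_filter, Set.mem_ofPred_eq] at hQ hQ'
      funext s
      by_cases hs : s ∈ σ
      · have := congrFun (hQ.2.trans hQ'.2.symm) ⟨s, hs⟩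
        exact this
      · have h1 := key Q hQ.1.2 hQ.2 s
        have h2 := key Q' hQ'.1.2 hQ'.2 s
        have h3 := hJ2 _ (W.sub_mem h1 h2) fun j hj => by
          have := congrFun (congrFun h ⟨s, hs⟩) ⟨j, hj⟩
          simp only at this
          simp [fz, this]
        funext b
        have := congrFun h3 b
        simp only [fz, Pi.sub_apply, Pi.zero_apply, sub_eq_zero, Int.cast_inj] at this
        exact this
    · rw [bxf_card]
      refine Nat.pow_le_pow_right (by omega) ?_
      simp only [Fintype.card_coe]
      rw [Fintype.card_subtype_compl]
      simp only [Fintype.card_coe]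
      gcongr
  · refine Nat.mul_le_mul_left _ ?_
    refine (Finset.card_le_card (t := bxf σ κ N) fun q hq => ?_).trans (by rw [bxf_card]; simp)
    obtain ⟨Q, hQ, rfl⟩ := Finset.mem_image.1 hq
    exact mem_bxf.2 fun s b => mem_bxf.1 (Finset.mem_filter.1 hQ).1 s b

lemma exists_sigma (Q : A → κ → ℤ) : ∃ σ : Finset A, LinearIndependent ℝ (fun s : {s // s ∈ σ} => fz Q s) ∧
    ∀ s, fz Q s ∈ Submodule.span ℝ (fz Q '' σ) := by
  obtain ⟨K, a, ha, h1, h2⟩ := exists_linearIndependent' ℝ (fz Q)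
  classical
  have : Finite K := Finite.of_injective a ha
  have := Fintype.ofFinite K
  refine ⟨Finset.univ.image a, ?_, fun s => ?_⟩
  · have hh : ∀ s : {s // s ∈ Finset.univ.image a}, ∃ x, a x = s := fun s => by
      obtain ⟨x, -, hx⟩ := Finset.mem_image.1 s.2
      exact ⟨x, hx⟩
    choose g hg using hh
    have := h2.comp g (fun s t hst => Subtype.ext (by rw [← hg s, ← hg t, hst]))
    convert! this using 1
    ext s; simp [hg]
  · have : fz Q '' (Finset.univ.image a) = Set.range (fz Q ∘ a) := by
      ext x; simp
    rw [this, h1]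
    exact Submodule.subset_span ⟨s, rfl⟩
end

end

section
set_option linter.unusedSectionVars false
section
variable {p k : ℕ} {ι κ : Type} [Fintype ι] [Fintype κ]

lemma om_add_left {p : ℕ} (u u' v : WW p) : om (u + u') v = om u v + om u' v := by
  simp only [om, ← Finset.sum_add_distrib]; refine Finset.sum_congr rfl fun i _ => ?_; simp; ring
lemma om_add_right {p : ℕ} (u v v' : WW p) : om u (v + v') = om u v + om u v' := by
  simp only [om, ← Finset.sum_add_distrib]; refine Finset.sum_congr rfl fun i _ => ?_; simp; ring
lemma om_bound {p : ℕ} (u v : WW p) : |om u v| ≤ p * 2 * (‖u‖ * ‖v‖) := by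
  refine (Finset.abs_sum_le_sum_abs _ _).trans ?_
  have : ∀ i ∈ Finset.univ, |(u i).re * (v i).im - (u i).im * (v i).re| ≤ 2 * (‖u‖ * ‖v‖) := fun i _ => by
    have h1 := (Complex.abs_re_le_norm (u i)).trans (norm_le_pi_norm u i)
    have h2 := (Complex.abs_im_le_norm (u i)).trans (norm_le_pi_norm u i)
    have h3 := (Complex.abs_re_le_norm (v i)).trans (norm_le_pi_norm v i)
    have h4 := (Complex.abs_im_le_norm (v i)).trans (norm_le_pi_norm v i)
    refine (abs_sub _ _).trans ?_
    rw [abs_mul, abs_mul]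
    have := mul_le_mul h1 h4 (abs_nonneg _) (norm_nonneg _)
    have := mul_le_mul h2 h3 (abs_nonneg _) (norm_nonneg _)
    linarith
  refine (Finset.sum_le_sum this).trans ?_
  simp; linarith

lemma Dat.b_add_left (D : Dat p ι κ) (u u' v : UU ι κ) : D.b (u + u') v = D.b u v + D.b u' v := by
  unfold Dat.b
  have : D.L1 (u + u').1 + D.L2 (u + u').2 = (D.L1 u.1 + D.L2 u.2) + (D.L1 u'.1 + D.L2 u'.2) := by
    simp; abel
  rw [this, om_add_left]; simp; ring
lemma Dat.b_add_right (D : Dat p ι κ) (u v v' : UU ι κ) : D.b u (v + v') = D.b u v + D.b u v' := by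
  unfold Dat.b
  have : D.L1 (v + v').1 + D.L2 (v + v').2 = (D.L1 v.1 + D.L2 v.2) + (D.L1 v'.1 + D.L2 v'.2) := by
    simp; abel
  rw [this, om_add_right]; simp; ring

lemma Dat.b_bound (D : Dat p ι κ) : ∃ n : ℝ, 1 ≤ n ∧ ∀ u v, |D.b u v| ≤ n * (‖u‖ * ‖v‖) := by
  obtain ⟨n, hn, -, -, h3, h4⟩ := D.bounds
  refine ⟨p * 2 * (2 * n) ^ 2 + n, by nlinarith [Nat.cast_nonneg (α := ℝ) p, sq_nonneg (2 * n)], fun u v => ?_⟩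
  have hz : ∀ u : UU ι κ, ‖D.L1 u.1 + D.L2 u.2‖ ≤ 2 * n * ‖u‖ := fun u => by
    refine (norm_le_nn _).trans ((h3 _ _).trans ?_)
    have := norm_fst_le u; have := norm_snd_le u
    nlinarith
  unfold Dat.b
  refine (abs_add_le _ _).trans ?_
  have e1 := (om_bound (D.L1 u.1 + D.L2 u.2) (D.L1 v.1 + D.L2 v.2)).trans
    (mul_le_mul_of_nonneg_left (mul_le_mul (hz u) (hz v) (norm_nonneg _) (by positivity)) (by positivity))
  have e2 := (h4 u.2 v.2).trans (mul_le_mul_of_nonneg_left (mul_le_mul (norm_snd_le u) (norm_snd_le v) (norm_nonneg _) (norm_nonneg _)) (by linarith))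
  nlinarith

lemma Dat.b_zero_left (D : Dat p ι κ) (v : UU ι κ) : D.b 0 v = 0 := by
  have := D.b_add_left 0 0 v; simp at this; exact this
lemma Dat.b_zero_right (D : Dat p ι κ) (v : UU ι κ) : D.b v 0 = 0 := by
  have := D.b_add_right v 0 0; simp at this; exact this

def tw (T : ℝ) (W : Fin k → Prop) [DecidablePred W] : Fin k → ℝ := fun i => if W i then T else 1

lemma nb_one {R : ℝ} {U : Fin k → UU ι κ} (h : ∀ i, ‖U i‖ ≤ R) : nb R U = 1 := by
  have : U ∈ {U : Fin k → UU ι κ | ∀ i, ‖U i‖ ≤ R} := h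
  rw [nb, Set.indicator_of_mem this]; rfl
lemma nb_zero {R : ℝ} {U : Fin k → UU ι κ} (h : ¬ ∀ i, ‖U i‖ ≤ R) : nb R U = 0 := by
  have : U ∉ {U : Fin k → UU ι κ | ∀ i, ‖U i‖ ≤ R} := h
  rw [nb, Set.indicator_of_notMem this]


lemma fat (D : Dat p ι κ) (R : ℝ) (hR : 0 ≤ R) : ∃ K : ℝ, 0 < K ∧ ∀ (T : ℝ) (α β : Fin k → Fin k → ℝ) (W : Fin k → Prop) [DecidablePred W]
    (Y e : Fin k → ι → ℝ) (q : Fin k → κ → ℝ), 1 ≤ T → (∀ i j, 0 < β i j) → (∀ i, ¬ W i → e i = 0) → (∀ i, ‖e i‖ ≤ 1) →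
    (D.box α β).indicator (nb (T * R)) (zip Y q) ≤
      (D.box (fun i j => α i j - K * (tw T W i * tw T W j)) (fun i j => tw T W i * tw T W j * (β i j + 2 * K))).indicator
        (nb (T * (R + 1))) (zip (Y + e) q) := by
  obtain ⟨n, hn, hb⟩ := D.b_bound
  refine ⟨n * (2 * (R + 1)), by positivity, fun T α β W _ Y e q hT hβ he0 he1 => ?_⟩
  by_cases h : zip Y q ∈ D.box α β
  swap
  · rw [Set.indicator_of_notMem h]; exact zero_le
  by_cases h2 : ∀ i, ‖zip Y q i‖ ≤ T * R
  swap
  · rw [Set.indicator_of_mem h, nb_zero h2]; exact zero_le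
  have hs : ∀ i, zip (Y + e) q i = zip Y q i + (e i, 0) := fun i => by simp [zip]
  have hen : ∀ i, ‖((e i, 0) : UU ι κ)‖ ≤ 1 := fun i => by simp [Prod.norm_def, he1 i]
  have hn2 : ∀ i, ‖zip (Y + e) q i‖ ≤ T * (R + 1) := fun i => by
    rw [hs]; refine (norm_add_le _ _).trans ?_
    have := h2 i; have := hen i; nlinarith
  have ht1 : ∀ i, 1 ≤ tw T W i := fun i => by unfold tw; split_ifs <;> linarith
  have key : ∀ i j, |D.b (zip (Y + e) q i) (zip (Y + e) q j) - D.b (zip Y q i) (zip Y q j)| ≤ n * (2 * (R + 1)) * (tw T W i * tw T W j) := by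
    intro i j
    have e1 : D.b (zip (Y + e) q i) (zip (Y + e) q j) - D.b (zip Y q i) (zip Y q j) =
        D.b (zip Y q i) (e j, 0) + D.b (e i, 0) (zip (Y + e) q j) := by
      conv_lhs => enter [1]; rw [hs i, D.b_add_left]
      rw [hs j, D.b_add_right]; ring
    by_cases hW : W i ∨ W j
    · have ht : T ≤ tw T W i * tw T W j := by
        rcases hW with h | h
        · have : tw T W i = T := by simp [tw, h]
          rw [this]; nlinarith [ht1 j]
        · have : tw T W j = T := by simp [tw, h]
          rw [this]; nlinarith [ht1 i]
      rw [e1]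
      refine (abs_add_le _ _).trans ?_
      have a1 := (hb (zip Y q i) (e j, 0)).trans (mul_le_mul_of_nonneg_left (mul_le_mul (h2 i) (hen j) (norm_nonneg _) (by positivity)) (by linarith))
      have a2 := (hb (e i, 0) (zip (Y + e) q j)).trans (mul_le_mul_of_nonneg_left (mul_le_mul (hen i) (hn2 j) (norm_nonneg _) (by positivity)) (by linarith))
      have a3 : n * (2 * (R + 1)) * T ≤ n * (2 * (R + 1)) * (tw T W i * tw T W j) := by gcongr
      nlinarith
    · push Not at hW
      have z1 := he0 i hW.1
      have z2 := he0 j hW.2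
      rw [e1, z1, z2]
      have : ((0, 0) : UU ι κ) = 0 := rfl
      rw [this, D.b_zero_left, D.b_zero_right]
      simp
      have := ht1 i; have := ht1 j
      positivity
  have hm : zip (Y + e) q ∈ D.box (fun i j => α i j - n * (2 * (R + 1)) * (tw T W i * tw T W j))
      (fun i j => tw T W i * tw T W j * (β i j + 2 * (n * (2 * (R + 1))))) := by
    intro i j hij
    obtain ⟨l, r⟩ := h i j hij
    have := abs_le.1 (key i j)
    have ht : 1 ≤ tw T W i * tw T W j := by have := ht1 i; have := ht1 j; nlinarith
    have := hβ i j
    have : β i j ≤ tw T W i * tw T W j * β i j := by nlinarith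
    constructor <;> simp only <;> nlinarith
  rw [Set.indicator_of_mem h, Set.indicator_of_mem hm, nb_one h2, nb_one hn2]

lemma fat_int (hι : Fintype.card ι = 2 * (k - 1)) (D : Dat p ι κ) (hk : k ≤ p + 1) (R : ℝ) (hR : 0 ≤ R) (K : ℝ) (hK : 0 < K) (β : Fin k → Fin k → ℝ) (hβ : ∀ i j, 0 < β i j) :
    ∃ C : NNReal, ∀ (T : ℝ) (α : Fin k → Fin k → ℝ) (W : Fin k → Prop) [DecidablePred W] (q : Fin k → κ → ℝ), 1 ≤ T →
    ∫⁻ Y, (D.box α (fun i j => tw T W i * tw T W j * (β i j + 2 * K))).indicator (nb (T * (R + 1))) (zip Y q) ≤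
      C * ENNReal.ofReal (T ^ (k * (k - 1) + (Finset.univ.filter W).card * (k - 1))) := by
  obtain ⟨C, hC⟩ := ub_nb_T hι D hk (R + 1) (by positivity)
  have hb2 : ∀ i j, 0 < β i j + 2 * K := fun i j => by have := hβ i j; positivity
  refine ⟨C * Real.toNNReal (pp (fun i j => β i j + 2 * K)), fun T α W _ q hT => ?_⟩
  have ht1 : ∀ i, 0 < tw T W i := fun i => by unfold tw; split_ifs <;> linarith
  have hpos : ∀ i j, 0 < tw T W i * tw T W j * (β i j + 2 * K) := fun i j => by have := ht1 i; have := ht1 j; have := hb2 i j; positivity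
  have := hC T α _ q (by linarith) hpos
  have hp := pp_pos hpos
  unfold VG at this
  rw [ENNReal.div_le_iff (by simpa using hp) ENNReal.ofReal_ne_top] at this
  refine this.trans (le_of_eq ?_)
  rw [pp_t]
  have : ∏ i, tw T W i = T ^ (Finset.univ.filter W).card := by
    simp [tw, Finset.prod_ite]
  rw [this, ENNReal.ofReal_mul (by positivity), ← pow_mul, pow_add, ENNReal.ofReal_mul (by positivity)]
  simp only [ENNReal.coe_mul, ENNReal.ofReal]
  ring
end

end

section
set_option linter.unusedSectionVars false
section
variable {p k : ℕ} {A ι κ : Type} [Fintype A] [DecidableEq A] [Fintype ι] [Fintype κ] [DecidableEq κ]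

lemma li_univ {Q : A → κ → ℤ} {σ : Finset A} (hσ : σ = Finset.univ) (h : LinearIndependent ℝ (fun s : {s // s ∈ σ} => fz Q s)) :
    LinearIndependent ℝ (fz Q) := by
  subst hσ
  exact h.comp (fun s : A => (⟨s, Finset.mem_univ s⟩ : {s // s ∈ Finset.univ})) (fun a b hab => by simpa using hab)

lemma cnt_sum (N : ℕ) (g : (A → κ → ℤ) → ENNReal) (w : Finset A → ENNReal) (h1 : ∀ Q, g Q ≠ 0 → Q ∈ bxf A κ N)
    (h2 : ∀ Q σ, LinearIndependent ℝ (fun s : {s // s ∈ σ} => fz Q s) → g Q ≤ w σ) :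
    ∑' Q, g Q ≤ ∑ σ, ((2 * N + 1 : ℕ) : ENNReal) ^ (σ.card * (Fintype.card A - σ.card) + Fintype.card κ * σ.card) * w σ := by
  classical
  rw [tsum_eq_sum (s := bxf A κ N) (fun Q hQ => by by_contra h; exact hQ (h1 Q h))]
  have : ∀ Q ∈ bxf A κ N, g Q ≤ ∑ σ : Finset A, if (∀ s, fz Q s ∈ Submodule.span ℝ (fz Q '' σ)) then w σ else 0 := fun Q _ => by
    obtain ⟨σ, a, b⟩ := exists_sigma Q
    refine le_trans ?_ (Finset.single_le_sum (fun i _ => zero_le) (Finset.mem_univ σ))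
    rw [if_pos b]; exact h2 Q σ a
  refine (Finset.sum_le_sum this).trans ?_
  rw [Finset.sum_comm]
  refine Finset.sum_le_sum fun σ _ => ?_
  rw [← Finset.sum_filter, Finset.sum_const, nsmul_eq_mul]
  have := count_dep (κ := κ) N σ
  refine mul_le_mul_left ?_ _
  rw [← Nat.cast_pow]
  refine Nat.cast_le.2 (le_trans (le_of_eq ?_) this)
  congr!

def aa (f : (Fin k → UU ι κ) → ENNReal) (X : ι → κ → ℝ) (Q : Fin k → κ → ℤ) : ENNReal := ∑' P, f (zip (fz P + aX X (fz Q)) (fz Q))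
def NN (f : (Fin k → UU ι κ) → ENNReal) (X : ι → κ → ℝ) : ENNReal := ∑' Q, aa f X Q
def mm (f : (Fin k → UU ι κ) → ENNReal) (Q : Fin k → κ → ℤ) : ENNReal := ∫⁻ Y, f (zip Y (fz Q))
def SS (f : (Fin k → UU ι κ) → ENNReal) : ENNReal := ∑' Q, mm f Q

def HH (f : (Fin k → UU ι κ) → ENNReal) (q q' : Fin k → κ → ℝ) (Y : Fin k ⊕ Fin k → ι → ℝ) : ENNReal :=
  f (zip (fun i => Y (.inl i)) q) * f (zip (fun i => Y (.inr i)) q')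

lemma zip_meas (q : Fin k → κ → ℝ) : Measurable (fun Y : Fin k → ι → ℝ => zip Y q) := by unfold zip; fun_prop

lemma HH_int2 (f g : (Fin k → UU ι κ) → ENNReal) (hf : Measurable f) (hg : Measurable g) (q q' : Fin k → κ → ℝ) :
    ∫⁻ Y : Fin k ⊕ Fin k → ι → ℝ, f (zip (fun i => Y (.inl i)) q) * g (zip (fun i => Y (.inr i)) q') = (∫⁻ Y, f (zip Y q)) * ∫⁻ Y, g (zip Y q') := by
  have := volume_measurePreserving_sumPiEquivProdPi (fun _ : Fin k ⊕ Fin k => ι → ℝ)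
  rw [← lintegral_prod_mul (μ := volume) (ν := volume) (f := fun Y => f (zip Y q)) (g := fun Y => g (zip Y q')) (hf.comp (zip_meas q)).aemeasurable (hg.comp (zip_meas q')).aemeasurable]
  have h2 := this.lintegral_comp_emb (MeasurableEquiv.measurableEmbedding _)
    (fun z : (Fin k → ι → ℝ) × (Fin k → ι → ℝ) => f (zip z.1 q) * g (zip z.2 q'))
  exact h2

lemma aa_mul (f : (Fin k → UU ι κ) → ENNReal) (X : ι → κ → ℝ) (Q Q' : Fin k → κ → ℤ) :
    aa f X Q * aa f X Q' = ∑' P, HH f (fz Q) (fz Q') (fz P + aX X (fz (Sum.elim Q Q'))) := by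
  unfold aa
  rw [← ENNReal.tsum_mul_right]
  simp_rw [← ENNReal.tsum_mul_left]
  rw [← ENNReal.tsum_prod (f := fun P P' => f (zip (fz P + aX X (fz Q)) (fz Q)) * f (zip (fz P' + aX X (fz Q')) (fz Q'))),
    ← (Equiv.sumArrowEquivProdArrow (Fin k) (Fin k) (ι → ℤ)).tsum_eq]
  rfl

lemma aa_meas {f : (Fin k → UU ι κ) → ENNReal} (hf : Measurable f) (Q : Fin k → κ → ℤ) : Measurable (fun X => aa f X Q) := by
  unfold aa
  exact Measurable.tsum fun P => hf.comp ((zip_meas (fz Q)).comp ((aX_cont (fz Q)).measurable.const_add _))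
lemma NN_meas {f : (Fin k → UU ι κ) → ENNReal} (hf : Measurable f) : Measurable (fun X => NN f X) :=
  Measurable.tsum fun Q => aa_meas hf Q

lemma mean_low {f : (Fin k → UU ι κ) → ENNReal} (hf : Measurable f) :
    open Classical in
    SS f ≤ (∫⁻ X in cb ι κ, NN f X) + ∑' Q, if LinearIndependent ℝ (fz Q) then 0 else mm f Q := by
  classical
  unfold NN SS
  rw [lintegral_tsum (fun Q => (aa_meas hf Q).aemeasurable), ← ENNReal.tsum_add]
  refine ENNReal.tsum_le_tsum fun Q => ?_
  split_ifs with h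
  · unfold aa
    rw [unfold_eq h (fun Y => f (zip Y (fz Q))) (hf.comp (zip_meas _))]
    exact le_add_right le_rfl
  · exact le_add_left le_rfl

def sp (Q : Fin k ⊕ Fin k → κ → ℤ) : Prop := LinearIndependent ℝ (fz Q)

def EE (f : (Fin k → UU ι κ) → ENNReal) (Q : Fin k ⊕ Fin k → κ → ℤ) : ENNReal :=
  ∫⁻ X in cb ι κ, ∑' P, HH f (fz fun i => Q (.inl i)) (fz fun i => Q (.inr i)) (fz P + aX X (fz Q))

lemma mom2 {f : (Fin k → UU ι κ) → ENNReal} (hf : Measurable f) :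
    open Classical in
    (∫⁻ X in cb ι κ, NN f X * NN f X) ≤ SS f * SS f + ∑' Q, if LinearIndependent ℝ (fz Q) then 0 else EE f Q := by
  classical
  have e1 : ∀ X : ι → κ → ℝ, NN f X * NN f X = ∑' z : (Fin k → κ → ℤ) × (Fin k → κ → ℤ), aa f X z.1 * aa f X z.2 := fun X => by
    rw [ENNReal.tsum_prod (f := fun a b => aa f X a * aa f X b)]
    simp_rw [ENNReal.tsum_mul_left, ENNReal.tsum_mul_right]; rfl
  have e2 : SS f * SS f = ∑' z : (Fin k → κ → ℤ) × (Fin k → κ → ℤ), mm f z.1 * mm f z.2 := by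
    rw [ENNReal.tsum_prod (f := fun a b => mm f a * mm f b)]
    simp_rw [ENNReal.tsum_mul_left, ENNReal.tsum_mul_right]; rfl
  simp_rw [e1]
  have hm : ∀ z : (Fin k → κ → ℤ) × (Fin k → κ → ℤ), AEMeasurable (fun X : ι → κ → ℝ => aa f X z.1 * aa f X z.2) (volume.restrict (cb ι κ)) :=
    fun z => ((aa_meas hf z.1).mul (aa_meas hf z.2)).aemeasurable
  rw [lintegral_tsum (f := fun (z : (Fin k → κ → ℤ) × (Fin k → κ → ℤ)) (X : ι → κ → ℝ) => aa f X z.1 * aa f X z.2) hm, e2,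
    ← (Equiv.sumArrowEquivProdArrow (Fin k) (Fin k) (κ → ℤ)).symm.tsum_eq (fun Q => if LinearIndependent ℝ (fz Q) then 0 else EE f Q), ← ENNReal.tsum_add]
  refine ENNReal.tsum_le_tsum fun z => ?_
  have e3 : (Equiv.sumArrowEquivProdArrow (Fin k) (Fin k) (κ → ℤ)).symm z = Sum.elim z.1 z.2 := rfl
  rw [e3]
  simp_rw [aa_mul]
  have hH : Measurable (HH f (fz z.1) (fz z.2) : (Fin k ⊕ Fin k → ι → ℝ) → ENNReal) :=
    (hf.comp ((zip_meas _).comp (by fun_prop))).mul (hf.comp ((zip_meas _).comp (by fun_prop)))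
  split_ifs with h
  · have := unfold_eq h _ hH
    rw [add_zero]
    refine le_of_eq (Eq.trans this ?_)
    exact HH_int2 f f hf hf _ _
  · exact le_add_left (le_of_eq rfl)
end

end

section
set_option linter.unusedSectionVars false
section
variable {p k : ℕ} {A ι κ : Type} [Fintype A] [DecidableEq A] [Fintype ι] [Fintype κ] [DecidableEq κ]

lemma cnt_T (R0 : ℝ) (hR0 : 0 ≤ R0) (c : NNReal) (E : ℕ) : ∃ C : NNReal, ∀ (T : ℝ) (g : (A → κ → ℤ) → ENNReal), 1 ≤ T →
    (∀ Q, g Q ≠ 0 → ∀ s b, |(Q s b : ℝ)| ≤ T * R0) →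
    (∀ (Q : A → κ → ℤ) (σ : Finset A), LinearIndependent ℝ (fun s : {s // s ∈ σ} => fz Q s) → g Q ≠ 0 →
      ∃ x, σ.card * (Fintype.card A - σ.card) + Fintype.card κ * σ.card + x ≤ E ∧ g Q ≤ c * ENNReal.ofReal (T ^ x)) →
    ∑' Q, g Q ≤ C * ENNReal.ofReal (T ^ E) := by
  let ex : Finset A → ℕ := fun σ => σ.card * (Fintype.card A - σ.card) + Fintype.card κ * σ.card
  refine ⟨∑ σ, (Real.toNNReal (2 * R0 + 3)) ^ (ex σ) * c, fun T g hT h1 h2 => ?_⟩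
  refine (cnt_sum ⌈T * R0⌉₊ g (fun σ => if ex σ ≤ E then c * ENNReal.ofReal (T ^ (E - ex σ)) else 0) ?_ ?_).trans ?_
  · intro Q hQ
    refine mem_bxf.2 fun s b => ?_
    have := abs_le.1 ((h1 Q hQ s b).trans (Nat.le_ceil _))
    exact ⟨by exact_mod_cast this.1, by exact_mod_cast this.2⟩
  · intro Q σ hσ
    by_cases h0 : g Q = 0
    · rw [h0]; exact zero_le
    obtain ⟨x, hx, hg⟩ := h2 Q σ hσ h0
    change ex σ + x ≤ E at hx
    rw [if_pos (by omega)]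
    refine hg.trans ?_
    gcongr
    omega
  · push_cast
    rw [Finset.sum_mul]
    refine Finset.sum_le_sum fun σ _ => ?_
    split_ifs with h
    swap
    · simp
    have hN : (2 * (⌈T * R0⌉₊ : ENNReal) + 1) ≤ ENNReal.ofReal ((2 * R0 + 3) * T) := by
      have : (2 * (⌈T * R0⌉₊ : ENNReal) + 1) = ENNReal.ofReal (2 * (⌈T * R0⌉₊ : ℝ) + 1) := by
        rw [ENNReal.ofReal_add (by positivity) (by positivity), ENNReal.ofReal_mul (by positivity)]; simp
      rw [this]
      refine ENNReal.ofReal_le_ofReal ?_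
      have := Nat.ceil_lt_add_one (show 0 ≤ T * R0 by positivity)
      nlinarith
    calc _ ≤ ENNReal.ofReal ((2 * R0 + 3) * T) ^ (ex σ) * (c * ENNReal.ofReal (T ^ (E - ex σ))) := by gcongr
      _ = ENNReal.ofReal (2 * R0 + 3) ^ (ex σ) * c * ENNReal.ofReal (T ^ (ex σ + (E - ex σ))) := by
        rw [ENNReal.ofReal_mul (by positivity), mul_pow, pow_add T, ENNReal.ofReal_mul (by positivity), ENNReal.ofReal_pow (by positivity) (ex σ)]
        ring
      _ = _ := by rw [Nat.add_sub_cancel' h]; rfl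

def ff (D : Dat p ι κ) (Ξ : UU ι κ → ℝ) (T : ℝ) (α β : Fin k → Fin k → ℝ) : (Fin k → UU ι κ) → ENNReal :=
  (D.box α β).indicator ((rg Ξ T).indicator 1)

variable {R0 Λ : ℝ} {Ξ : UU ι κ → ℝ}
lemma ff_meas (D : Dat p ι κ) (h : Nrm R0 Λ Ξ) (T : ℝ) (α β : Fin k → Fin k → ℝ) : Measurable (ff D Ξ T α β) :=
  (measurable_const.indicator (rg_open h T).measurableSet).indicator (D.box_open α β).measurableSet

lemma ff_le (D : Dat p ι κ) (h : Nrm R0 Λ Ξ) (T : ℝ) (α β : Fin k → Fin k → ℝ) (U : Fin k → UU ι κ) :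
    ff D Ξ T α β U ≤ (D.box α β).indicator (nb (T * R0)) U := by
  unfold ff
  refine Set.indicator_le_indicator ?_
  by_cases hU : U ∈ rg Ξ T
  · rw [nb_one (fun i => by rw [mul_comm]; exact rg_bound h hU i), Set.indicator_of_mem hU]; rfl
  · rw [Set.indicator_of_notMem hU]; exact zero_le

lemma ff_ne {D : Dat p ι κ} (h : Nrm R0 Λ Ξ) {T : ℝ} {α β : Fin k → Fin k → ℝ} {Y : Fin k → ι → ℝ} {Q : Fin k → κ → ℤ}
    (hU : ff D Ξ T α β (zip Y (fz Q)) ≠ 0) (s : Fin k) (b : κ) : |(Q s b : ℝ)| ≤ T * R0 := by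
  have h2 : zip Y (fz Q) ∈ rg Ξ T := by
    by_contra h'
    apply hU
    unfold ff
    rw [Set.indicator_apply_eq_zero]; intro _; rw [Set.indicator_of_notMem h']
  have := rg_bound h h2 s
  rw [mul_comm]
  exact ((norm_le_pi_norm (fz Q s) b).trans (norm_snd_le (zip Y (fz Q) s))).trans this

lemma cb_norm {A B : Type} [Fintype A] [Fintype B] {e : A → B → ℝ} (he : e ∈ cb A B) (i : A) : ‖e i‖ ≤ 1 := by
  refine (pi_norm_le_iff_of_nonneg zero_le_one).2 fun b => ?_
  have := he i b
  rw [Real.norm_eq_abs, abs_of_nonneg this.1]; exact this.2.le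

lemma box_nb_meas (D : Dat p ι κ) (R : ℝ) (α β : Fin k → Fin k → ℝ) : Measurable ((D.box α β).indicator (nb R)) :=
  (nb_meas R).indicator (D.box_open α β).measurableSet

lemma est_mm (hι : Fintype.card ι = 2 * (k - 1)) (D : Dat p ι κ) (hk : k ≤ p + 1) (R0 Λ : ℝ) (hR0 : 0 ≤ R0) (β : Fin k → Fin k → ℝ) (hβ : ∀ i j, 0 < β i j) :
    ∃ C : NNReal, ∀ (Ξ : UU ι κ → ℝ), Nrm R0 Λ Ξ → ∀ (T : ℝ) (α : Fin k → Fin k → ℝ), 1 ≤ T → ∀ Q, mm (ff D Ξ T α β) Q ≤ C * ENNReal.ofReal (T ^ (k * (k - 1))) := by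
  obtain ⟨K, hK, hf⟩ := fat (k := k) D R0 hR0
  obtain ⟨C, hC⟩ := fat_int hι D hk R0 hR0 K hK β hβ
  refine ⟨C, fun Ξ h T α hT Q => ?_⟩
  have := hC T (fun i j => α i j - K * (tw T (fun _ : Fin k => False) i * tw T (fun _ : Fin k => False) j)) (fun _ => False) (fz Q) hT
  simp only [Finset.filter_false, Finset.card_empty, zero_mul, add_zero] at this
  refine le_trans (lintegral_mono fun Y => ?_) this
  refine (ff_le D h T α β _).trans ?_
  have := hf T α β (fun _ => False) Y 0 (fz Q) hT hβ (fun _ _ => rfl) (fun _ => by simp)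
  rwa [add_zero] at this

lemma est_EE (hι : Fintype.card ι = 2 * (k - 1)) (D : Dat p ι κ) (hk : k ≤ p + 1) (R0 Λ : ℝ) (hR0 : 0 ≤ R0) (β : Fin k → Fin k → ℝ) (hβ : ∀ i j, 0 < β i j) :
    ∃ C : NNReal, ∀ (Ξ : UU ι κ → ℝ), Nrm R0 Λ Ξ → ∀ (T : ℝ) (α : Fin k → Fin k → ℝ), 1 ≤ T → ∀ (Q : Fin k ⊕ Fin k → κ → ℤ) (σ : Finset (Fin k ⊕ Fin k)),
      LinearIndependent ℝ (fun s : {s // s ∈ σ} => fz Q s) →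
      EE (ff D Ξ T α β) Q ≤ C * ENNReal.ofReal (T ^ (2 * (k * (k - 1)) + (2 * k - σ.card) * (k - 1))) := by
  obtain ⟨K, hK, hf⟩ := fat (k := k) D R0 hR0
  obtain ⟨C, hC⟩ := fat_int hι D hk R0 hR0 K hK β hβ
  refine ⟨C * C, fun Ξ h T α hT Q σ hσ => ?_⟩
  let W1 : Fin k → Prop := fun i => Sum.inl i ∉ σ
  let W2 : Fin k → Prop := fun i => Sum.inr i ∉ σ
  let F (W : Fin k → Prop) [DecidablePred W] : (Fin k → UU ι κ) → ENNReal := 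
    (D.box (fun i j => α i j - K * (tw T W i * tw T W j)) (fun i j => tw T W i * tw T W j * (β i j + 2 * K))).indicator
        (nb (T * (R0 + 1)))
  have hFm : ∀ W [DecidablePred W], Measurable (F W) := fun W _ => box_nb_meas _ _ _ _
  have hcard : (Finset.univ.filter W1).card + (Finset.univ.filter W2).card = 2 * k - σ.card := by
    have : σᶜ.card = 2 * k - σ.card := by rw [Finset.card_compl]; simp; ring_nf
    rw [← this, ← Finset.card_toLeft_add_card_toRight (u := σᶜ)]
    congr 1
    · congr 1; ext i; simp [W1]
    · congr 1; ext i; simp [W2]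
  have := torus_le (fun s => s ∈ σ) hσ (HH (ff D Ξ T α β) (fz fun i => Q (.inl i)) (fz fun i => Q (.inr i)))
    (fun Y : Fin k ⊕ Fin k → ι → ℝ => F W1 (zip (fun i => Y (.inl i)) (fz fun i => Q (.inl i))) * F W2 (zip (fun i => Y (.inr i)) (fz fun i => Q (.inr i))))
    (((hFm W1).comp ((zip_meas _).comp (by fun_prop))).mul ((hFm W2).comp ((zip_meas _).comp (by fun_prop)))) ?_
  · refine (show _ ≤ _ from this).trans ?_
    rw [HH_int2 _ _ (hFm W1) (hFm W2)]
    refine (mul_le_mul' (hC T _ W1 _ hT) (hC T _ W2 _ hT)).trans (le_of_eq ?_)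
    rw [← hcard]
    have : 2 * (k * (k - 1)) + ((Finset.univ.filter W1).card + (Finset.univ.filter W2).card) * (k - 1) = 
      (k * (k - 1) + (Finset.univ.filter W1).card * (k - 1)) + (k * (k - 1) + (Finset.univ.filter W2).card * (k - 1)) := by ring
    rw [this, pow_add T (k * (k - 1) + (Finset.univ.filter W1).card * (k - 1)), ENNReal.ofReal_mul (by positivity)]
    push_cast; ring
  · intro Y e he0 he
    refine mul_le_mul' ((ff_le D h T α β _).trans ?_) ((ff_le D h T α β _).trans ?_)
    · exact hf T α β W1 (fun i => Y (.inl i)) (fun i => e (.inl i)) _ hT hβ (fun i hi => he0 _ (not_not.1 hi)) (fun i => cb_norm he _)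
    · exact hf T α β W2 (fun i => Y (.inr i)) (fun i => e (.inr i)) _ hT hβ (fun i hi => he0 _ (not_not.1 hi)) (fun i => cb_norm he _)

lemma EE_ne {D : Dat p ι κ} (h : Nrm R0 Λ Ξ) {T : ℝ} {α β : Fin k → Fin k → ℝ} {Q : Fin k ⊕ Fin k → κ → ℤ}
    (hU : EE (ff D Ξ T α β) Q ≠ 0) (s : Fin k ⊕ Fin k) (b : κ) : |(Q s b : ℝ)| ≤ T * R0 := by
  by_contra hc
  apply hU
  have : ∀ Y, HH (ff D Ξ T α β) (fz fun i => Q (.inl i)) (fz fun i => Q (.inr i)) Y = 0 := fun Y => by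
    by_contra hY
    apply hc
    rcases s with s | s
    · exact ff_ne h (Q := fun i => Q (.inl i)) (left_ne_zero_of_mul hY) s b
    · exact ff_ne h (Q := fun i => Q (.inr i)) (right_ne_zero_of_mul hY) s b
  unfold EE
  simp [this]

lemma mm_ne {D : Dat p ι κ} (h : Nrm R0 Λ Ξ) {T : ℝ} {α β : Fin k → Fin k → ℝ} {Q : Fin k → κ → ℤ}
    (hU : mm (ff D Ξ T α β) Q ≠ 0) (s : Fin k) (b : κ) : |(Q s b : ℝ)| ≤ T * R0 := by
  by_contra hc
  apply hU
  have : ∀ Y, ff D Ξ T α β (zip Y (fz Q)) = 0 := fun Y => by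
    by_contra hY
    exact hc (ff_ne h hY s b)
  unfold mm
  simp [this]

lemma arith1 {k l s : ℕ} (hk : 2 ≤ k) (hl : 3 * k - 1 ≤ l) (hs : s < 2 * k) :
    s * (2 * k - s) + l * s + (2 * (k * (k - 1)) + (2 * k - s) * (k - 1) + 1) ≤ 2 * (k * (k - 1) + k * l) := by
  obtain ⟨r, hr⟩ : ∃ r, 2 * k = s + r := ⟨2 * k - s, by omega⟩
  obtain ⟨m, rfl⟩ : ∃ m, k = m + 1 := ⟨k - 1, by omega⟩
  have e1 : 2 * (m + 1) - s = r := by omega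
  rw [e1, Nat.add_sub_cancel]
  have e2 : 2 * ((m + 1) * m + (m + 1) * l) = 2 * ((m + 1) * m) + (s + r) * l := by rw [← hr]; ring
  rw [e2]
  have hr1 : 1 ≤ r := by omega
  have h3 : s + m + 1 ≤ l := by omega
  have : r * (s + m + 1) ≤ r * l := Nat.mul_le_mul_left _ h3
  nlinarith

lemma arith2 {k l s : ℕ} (hl : 3 * k - 1 ≤ l) (hs : s < k) :
    s * (k - s) + l * s + (k * (k - 1) + 1) ≤ k * (k - 1) + k * l := by
  obtain ⟨r, hr⟩ : ∃ r, k = s + r := ⟨k - s, by omega⟩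
  have e1 : k - s = r := by omega
  rw [e1]
  have e2 : k * l = (s + r) * l := by rw [hr]
  rw [e2]
  have hr1 : 1 ≤ r := by omega
  have : r * (s + 1) ≤ r * l := Nat.mul_le_mul_left _ (by omega)
  nlinarith

lemma arith3 {k l s : ℕ} (hl : 3 * k - 1 ≤ l) (hs : s ≤ k) :
    s * (k - s) + l * s + (k * (k - 1)) ≤ k * (k - 1) + k * l := by
  rcases hs.lt_or_eq with h | h
  · have := arith2 hl h; omega
  · subst h; simp; rw [mul_comm]; omega

/-- variance data -/
lemma est_all (hι : Fintype.card ι = 2 * (k - 1)) (D : Dat p ι κ) (hk2 : 2 ≤ k) (hk : k ≤ p + 1) (hl : 3 * k - 1 ≤ Fintype.card κ)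
    (R0 Λ : ℝ) (hR0 : 0 ≤ R0) (β : Fin k → Fin k → ℝ) (hβ : ∀ i j, 0 < β i j) :
    open Classical in
    ∃ C : NNReal, ∀ (Ξ : UU ι κ → ℝ), Nrm R0 Λ Ξ → ∀ (T : ℝ) (α : Fin k → Fin k → ℝ), 1 ≤ T →
      SS (ff D Ξ T α β) ≤ C * ENNReal.ofReal (T ^ (k * (k - 1) + k * Fintype.card κ)) ∧
      (ENNReal.ofReal T * ∑' Q, if LinearIndependent ℝ (fz Q) then 0 else mm (ff D Ξ T α β) Q) ≤ C * ENNReal.ofReal (T ^ (k * (k - 1) + k * Fintype.card κ)) ∧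
      (ENNReal.ofReal T * ∑' Q, if LinearIndependent ℝ (fz Q) then 0 else EE (ff D Ξ T α β) Q) ≤ C * ENNReal.ofReal (T ^ (2 * (k * (k - 1) + k * Fintype.card κ))) := by
  classical
  obtain ⟨c1, h1⟩ := est_mm hι D hk R0 Λ hR0 β hβ
  obtain ⟨c2, h2⟩ := est_EE hι D hk R0 Λ hR0 β hβ
  obtain ⟨C1, H1⟩ := cnt_T (A := Fin k) (κ := κ) R0 hR0 c1 (k * (k - 1) + k * Fintype.card κ)
  obtain ⟨C2, H2⟩ := cnt_T (A := Fin k ⊕ Fin k) (κ := κ) R0 hR0 c2 (2 * (k * (k - 1) + k * Fintype.card κ))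
  have m : ∀ (a b : NNReal) (z : ENNReal), a ≤ b → a * z ≤ b * z := fun a b z h => by gcongr
  refine ⟨max C1 C2, fun Ξ h T α hT => ⟨?_, ?_, ?_⟩⟩
  · refine (H1 T _ hT (fun Q hQ => mm_ne h hQ) (fun Q σ hσ _ => ⟨k * (k - 1), ?_, h1 Ξ h T α hT Q⟩)).trans (m _ _ _ (le_max_left _ _))
    simpa using arith3 hl (by simpa using σ.card_le_univ)
  · rw [← ENNReal.tsum_mul_left]
    refine (H1 T _ hT (fun Q hQ => ?_) (fun Q σ hσ hQ => ⟨k * (k - 1) + 1, ?_, ?_⟩)).trans (m _ _ _ (le_max_left _ _))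
    · split_ifs at hQ with hl
      · simp at hQ
      · exact mm_ne h (right_ne_zero_of_mul hQ)
    · split_ifs at hQ with hl'
      · simp at hQ
      · have : σ.card < k := by
          refine lt_of_le_of_ne (by simpa using σ.card_le_univ) fun hc => hl' (li_univ ?_ hσ)
          exact Finset.card_eq_iff_eq_univ _ |>.1 (by simpa using hc)
        simpa using arith2 hl this
    · split_ifs at hQ ⊢ with hl
      · simp
      · rw [pow_succ, ENNReal.ofReal_mul (by positivity), ← mul_assoc, mul_comm]
        gcongr
        exact h1 Ξ h T α hT Q
  · rw [← ENNReal.tsum_mul_left]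
    refine (H2 T _ hT (fun Q hQ => ?_) (fun Q σ hσ hQ => ⟨2 * (k * (k - 1)) + (2 * k - σ.card) * (k - 1) + 1, ?_, ?_⟩)).trans (m _ _ _ (le_max_right _ _))
    · split_ifs at hQ with hl
      · simp at hQ
      · exact EE_ne h (right_ne_zero_of_mul hQ)
    · split_ifs at hQ with hl'
      · simp at hQ
      · have : σ.card < 2 * k := by
          refine lt_of_le_of_ne (by simpa [two_mul] using σ.card_le_univ) fun hc => hl' (li_univ ?_ hσ)
          exact Finset.card_eq_iff_eq_univ _ |>.1 (by simpa [two_mul] using hc)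
        have := arith1 hk2 hl this
        simpa [two_mul] using this
    · split_ifs at hQ ⊢ with hl
      · simp
      · rw [pow_succ, ENNReal.ofReal_mul (by positivity), ← mul_assoc, mul_comm]
        gcongr
        exact h2 Ξ h T α hT Q σ hσ

lemma sq_id (n s : ENNReal) (hn : n ≠ ⊤) (hs : s ≠ ⊤) : ENNReal.ofReal ((n.toReal - s.toReal) ^ 2) + 2 * (n * s) = n * n + s * s := by
  lift n to NNReal using hn
  lift s to NNReal using hs
  have e : ∀ x : NNReal, (x : ENNReal) = ENNReal.ofReal (x : ℝ) := fun x => by simp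
  rw [e n, e s, ← ENNReal.ofReal_mul (by positivity), ← ENNReal.ofReal_mul (by positivity), ← ENNReal.ofReal_mul (by positivity),
    show (2:ENNReal) = ENNReal.ofReal 2 by simp, ← ENNReal.ofReal_mul (by positivity), ← ENNReal.ofReal_add (by positivity) (by positivity), ← ENNReal.ofReal_add (by positivity) (by positivity)]
  congr 1; simp; ring

lemma variance (hι : Fintype.card ι = 2 * (k - 1)) (D : Dat p ι κ) (hk2 : 2 ≤ k) (hk : k ≤ p + 1) (hl : 3 * k - 1 ≤ Fintype.card κ)
    (R0 Λ : ℝ) (hR0 : 0 ≤ R0) (β : Fin k → Fin k → ℝ) (hβ : ∀ i j, 0 < β i j) :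
    ∃ C : NNReal, ∀ (Ξ : UU ι κ → ℝ), Nrm R0 Λ Ξ → ∀ (T : ℝ) (α : Fin k → Fin k → ℝ), 1 ≤ T →
      SS (ff D Ξ T α β) ≠ ⊤ ∧ (∀ᵐ X ∂(volume.restrict (cb ι κ)), NN (ff D Ξ T α β) X ≠ ⊤) ∧
      ENNReal.ofReal T * ∫⁻ X in cb ι κ, ENNReal.ofReal (((NN (ff D Ξ T α β) X).toReal - (SS (ff D Ξ T α β)).toReal) ^ 2) ≤
        C * ENNReal.ofReal (T ^ (2 * (k * (k - 1) + k * Fintype.card κ))) := by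
  classical
  obtain ⟨C, hC⟩ := est_all hι D hk2 hk hl R0 Λ hR0 β hβ
  refine ⟨C + 2 * C * C, fun Ξ h T α hT => ?_⟩
  obtain ⟨a1, a2, a3⟩ := hC Ξ h T α hT
  set f := ff D Ξ T α β with hf
  have hfm : Measurable f := ff_meas D h T α β
  have hS : SS f ≠ ⊤ := ne_top_of_le_ne_top (by finiteness) a1
  have hT0 : ENNReal.ofReal T ≠ 0 := by simp; linarith
  have b1 := mean_low hfm
  have b2 := mom2 hfm
  set Δ := ∑' Q, if LinearIndependent ℝ (fz Q) then 0 else mm f Q with hΔ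
  set E := ∑' Q, if LinearIndependent ℝ (fz Q) then 0 else EE f Q with hE
  have hEt : E ≠ ⊤ := fun h => by
    rw [h, ENNReal.mul_top hT0] at a3
    exact absurd a3 (not_le.2 (lt_top_iff_ne_top.2 (by finiteness)))
  have hNm := NN_meas hfm
  have hfin : ∫⁻ X in cb ι κ, NN f X * NN f X ≠ ⊤ := ne_top_of_le_ne_top (by finiteness) b2
  have hae : ∀ᵐ X ∂(volume.restrict (cb ι κ)), NN f X ≠ ⊤ := by
    filter_upwards [ae_lt_top (hNm.mul hNm) hfin] with X hX hc
    simp [hc] at hX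
  refine ⟨hS, hae, ?_⟩
  have key : (∫⁻ X in cb ι κ, ENNReal.ofReal (((NN f X).toReal - (SS f).toReal) ^ 2)) + 2 * ((∫⁻ X in cb ι κ, NN f X) * SS f) =
      (∫⁻ X in cb ι κ, NN f X * NN f X) + SS f * SS f := by
    have e1 : (∫⁻ X in cb ι κ, NN f X * NN f X) + SS f * SS f = ∫⁻ X in cb ι κ, (NN f X * NN f X + SS f * SS f) := by
      rw [lintegral_add_left (f := fun X => NN f X * NN f X) (hNm.mul hNm), setLIntegral_const, cb_vol, mul_one]
    have e2 : 2 * ((∫⁻ X in cb ι κ, NN f X) * SS f) = ∫⁻ X in cb ι κ, 2 * (NN f X * SS f) := by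
      rw [lintegral_const_mul (f := fun X => NN f X * SS f) _ (hNm.mul_const _), lintegral_mul_const (f := fun X => NN f X) _ hNm]
    rw [e1, e2, ← lintegral_add_right (g := fun X => 2 * (NN f X * SS f)) _ ((hNm.mul_const _).const_mul _)]
    refine lintegral_congr_ae ?_
    filter_upwards [hae] with X hX
    exact sq_id _ _ hX hS
  set V := ∫⁻ X in cb ι κ, ENNReal.ofReal (((NN f X).toReal - (SS f).toReal) ^ 2)
  set M := ∫⁻ X in cb ι κ, NN f X
  set S := SS f
  have c1 : V + 2 * (S * S) ≤ (E + 2 * (S * Δ)) + 2 * (S * S) := by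
    calc V + 2 * (S * S) ≤ V + 2 * ((M + Δ) * S) := by gcongr
      _ = (V + 2 * (M * S)) + 2 * (S * Δ) := by ring
      _ ≤ ((S * S + E) + S * S) + 2 * (S * Δ) := by rw [key]; gcongr
      _ = _ := by ring
  have c2 : V ≤ E + 2 * (S * Δ) := (ENNReal.add_le_add_iff_right (by finiteness)).1 c1
  calc ENNReal.ofReal T * V ≤ ENNReal.ofReal T * (E + 2 * (S * Δ)) := by gcongr
    _ = ENNReal.ofReal T * E + 2 * (S * (ENNReal.ofReal T * Δ)) := by ring
    _ ≤ C * ENNReal.ofReal (T ^ (2 * (k * (k - 1) + k * Fintype.card κ))) + 2 * ((C * ENNReal.ofReal (T ^ (k * (k - 1) + k * Fintype.card κ))) * (C * ENNReal.ofReal (T ^ (k * (k - 1) + k * Fintype.card κ)))) := by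
      gcongr
    _ = _ := by
      rw [mul_comm 2 (k * (k - 1) + k * Fintype.card κ), pow_mul, pow_two (T ^ _), ENNReal.ofReal_mul (by positivity)]
      push_cast; ring
end

end

section
set_option linter.unusedSectionVars false
section
variable {p k : ℕ} {ι κ : Type} [Fintype ι] [Fintype κ] [DecidableEq κ] {R0 Λ : ℝ} {Ξ : UU ι κ → ℝ}

def phT (T : ℝ) (q : Fin k → κ → ℝ) : Fin k → κ → ℝ := T⁻¹ • fz (flo (T • q))

lemma phT_near {T : ℝ} (hT : 0 < T) (q : Fin k → κ → ℝ) (i : Fin k) : ‖phT T q i - q i‖ ≤ T⁻¹ := by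
  refine (pi_norm_le_iff_of_nonneg (by positivity)).2 fun b => ?_
  simp only [phT, fz, flo, Pi.sub_apply, Pi.smul_apply, smul_eq_mul, Real.norm_eq_abs]
  have e : T⁻¹ * (⌊T * q i b⌋ : ℝ) - q i b = - (T⁻¹ * Int.fract (T * q i b)) := by
    have := Int.self_sub_floor (T * q i b)
    rw [← this]; field_simp; ring
  rw [e, abs_neg, abs_of_nonneg (mul_nonneg (by positivity) (Int.fract_nonneg _))]
  have := (Int.fract_lt_one (T * q i b)).le
  have hT' : 0 < T⁻¹ := by positivity
  nlinarith

lemma mean_eq (hι : Fintype.card ι = 2 * (k - 1)) (D : Dat p ι κ) (h : Nrm R0 Λ Ξ) (α β : Fin k → Fin k → ℝ) (hβ : ∀ i j, 0 < β i j) {T : ℝ} (hT : 0 < T) :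
    SS (ff D Ξ T α β) = ENNReal.ofReal (pp β * T ^ (k * (k - 1) + k * Fintype.card κ)) *
      vint D Ξ 1 (fun i j => α i j / T ^ 2) (fun i j => β i j / T ^ 2) (phT T) := by
  have i1 : (volume : Measure (Fin k → κ → ℝ)).IsAddHaarMeasure := Measure.pi.isAddHaarMeasure _
  have hd : Module.finrank ℝ (Fin k → κ → ℝ) = k * Fintype.card κ := by
    rw [Module.finrank_pi_fintype]; simp
  have hp := pp_pos hβ
  have e1 : ∀ Q, mm (ff D Ξ T α β) Q = ENNReal.ofReal (pp β * T ^ (k * (k - 1))) * VV D Ξ 1 (fun i j => α i j / T ^ 2) (fun i j => β i j / T ^ 2) (T⁻¹ • fz Q) := fun Q => by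
    have := VV_scale hι D h hT 1 (fun i j => α i j / T ^ 2) (fun i j => β i j / T ^ 2) (T⁻¹ • fz Q)
    simp only [smul_smul, mul_inv_cancel₀ hT.ne', one_smul, mul_div_cancel₀ _ (pow_pos hT 2).ne', mul_one] at this
    rw [ENNReal.ofReal_mul hp.le, mul_assoc, ← this, VV, VG, ENNReal.mul_div_cancel (by simpa using hp) ENNReal.ofReal_ne_top]
    rfl
  unfold SS vint
  simp_rw [e1]
  rw [ENNReal.tsum_mul_left, ← sum_floor (fun Q => VV D Ξ 1 (fun i j => α i j / T ^ 2) (fun i j => β i j / T ^ 2) (T⁻¹ • fz Q)),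
    lint_smul _ T hT, hd, ← mul_assoc, ← ENNReal.ofReal_mul (by positivity)]
  congr 2
  rw [pow_add]; ring

def vm (k : ℕ) (D : Dat p ι κ) (Ξ : UU ι κ → ℝ) (m : ℕ) : ENNReal := vint (k := k) D Ξ 1 (fun _ _ => - (m:ℝ)⁻¹) (fun _ _ => 2 * (m:ℝ)⁻¹) id
def cc (k : ℕ) (D : Dat p ι κ) (Ξ : UU ι κ → ℝ) : ENNReal := Filter.limsup (vm k D Ξ) Filter.atTop

lemma vm_bds (hι : Fintype.card ι = 2 * (k - 1)) (D : Dat p ι κ) (hk : k ≤ p + 1) (R0 Λ : ℝ) (hR0 : 0 < R0) (hL : 0 ≤ Λ) (α β : Fin k → Fin k → ℝ) (hβ : ∀ i j, 0 < β i j) :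
    ∃ C : NNReal, ∃ K : ℝ, 1 ≤ K ∧ ∀ Ξ : UU ι κ → ℝ, Nrm R0 Λ Ξ → ∀ (T ε : ℝ), K ≤ T → 0 < ε → ε ≤ 1/2 →
      (vint D Ξ 1 (fun i j => α i j / T ^ 2) (fun i j => β i j / T ^ 2) (phT T) ≤
        ENNReal.ofReal ((1 + ε) ^ (k * (k - 1) + k * Fintype.card κ)) * cc k D Ξ + ENNReal.ofReal (C * (ε⁻¹ * √(K / T)))) ∧
      (ENNReal.ofReal ((1 - ε) ^ (k * (k - 1) + k * Fintype.card κ)) * cc k D Ξ ≤ 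
      vint D Ξ 1 (fun i j => α i j / T ^ 2) (fun i j => β i j / T ^ 2) (phT T) + ENNReal.ofReal (C * (ε⁻¹ * √(K / T)))) := by
  obtain ⟨C, hC⟩ := hs_int (k := k) D hk R0 Λ hR0 hL
  obtain ⟨K, hK1, hK⟩ : ∃ K : ℝ, 1 ≤ K ∧ ∀ i j, β i j ≤ K ∧ 2 * |α i j| ≤ K := by
    refine ⟨1 + ∑ i, ∑ j, (β i j + 2 * |α i j|), ?_, ?_⟩
    · have : 0 ≤ ∑ i, ∑ j, (β i j + 2 * |α i j|) := Finset.sum_nonneg fun i _ => Finset.sum_nonneg fun j _ => by have := hβ i j; positivity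
      linarith
    · intro i j
      have : β i j + 2 * |α i j| ≤ ∑ i, ∑ j, (β i j + 2 * |α i j|) := by
        refine le_trans ?_ (Finset.single_le_sum (f := fun i => ∑ j, (β i j + 2 * |α i j|)) (fun i _ => Finset.sum_nonneg fun j _ => by have := hβ i j; positivity) (Finset.mem_univ i))
        exact Finset.single_le_sum (f := fun j => (β i j + 2 * |α i j|)) (fun j _ => by have := hβ i j; positivity) (Finset.mem_univ j)
      have := hβ i j; have := abs_nonneg (α i j)
      constructor <;> linarith
  refine ⟨C, K, hK1, fun Ξ h T ε hT hε hε2 => ?_⟩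
  have hT1 : 1 ≤ T := hK1.trans hT
  have hT0 : 0 < T := by linarith
  have hΔ : 0 < K / T := by positivity
  have hΔ1 : K / T ≤ 1 := (div_le_one hT0).2 hT
  have hTT : ∀ x, 0 ≤ x → x / T ^ 2 ≤ x / T := fun x hx => by
    gcongr; nlinarith
  have hβ1 : ∀ i j, 0 < β i j / T ^ 2 ∧ β i j / T ^ 2 ≤ K / T := fun i j => by
    have := hβ i j
    refine ⟨by positivity, (hTT _ this.le).trans ?_⟩
    have := (hK i j).1
    gcongr
  have hph : ∀ q i, ‖phT (k := k) (κ := κ) T q i - q i‖ ≤ K / T := fun q i => (phT_near hT0 q i).trans (by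
    rw [inv_eq_one_div]; gcongr)
  -- large m
  obtain ⟨m0, hm0⟩ : ∃ m0 : ℕ, 16 * T / K ≤ m0 := exists_nat_ge _
  have hm : ∀ m : ℕ, m0 ≤ m → 1 ≤ m → (m:ℝ)⁻¹ * 16 ≤ K / T := fun m h1 h2 => by
    have h3 : 16 * T / K ≤ m := hm0.trans (by exact_mod_cast h1)
    have h4 : (0:ℝ) < m := by exact_mod_cast h2
    rw [div_le_iff₀ (by linarith)] at h3
    rw [inv_mul_eq_div, div_le_div_iff₀ h4 hT0]; linarith
  have gen : ∀ s : ℝ, 0 < s → s ≤ 2 → ∀ m : ℕ, m0 ≤ m → 1 ≤ m → (∀ i j : Fin k, 0 < s ^ 2 * (2 * (m:ℝ)⁻¹) ∧ s ^ 2 * (2 * (m:ℝ)⁻¹) ≤ K / T) ∧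
      (∀ i j, |α i j / T ^ 2 - s ^ 2 * (- (m:ℝ)⁻¹)| ≤ K / T) := fun s hs hs2 m h1 h2 => by
    have h3 := hm m h1 h2
    have h4 : (0:ℝ) < m := by exact_mod_cast h2
    have h5 : 0 < (m:ℝ)⁻¹ := by positivity
    have h6 : s ^ 2 ≤ 4 := by nlinarith
    have h7 : s ^ 2 * (m:ℝ)⁻¹ ≤ 4 * (m:ℝ)⁻¹ := by gcongr
    refine ⟨fun i j => ⟨by positivity, by linarith⟩, fun i j => ?_⟩
    have e := abs_sub (α i j / T ^ 2) (s ^ 2 * (- (m:ℝ)⁻¹))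
    rw [abs_div, abs_of_pos (pow_pos hT0 2)] at e
    have e2 : |s ^ 2 * (- (m:ℝ)⁻¹)| = s ^ 2 * (m:ℝ)⁻¹ := by rw [mul_neg, abs_neg, abs_of_pos (by positivity)]
    have e3 := hTT _ (abs_nonneg (α i j))
    have e4 : |α i j| / T ≤ (K / 2) / T := by have := (hK i j).2; gcongr; linarith
    have e5 : (K / 2) / T = K / T / 2 := by ring
    linarith
  have hev : ∀ᶠ m : ℕ in Filter.atTop, m0 ≤ m ∧ 1 ≤ m := (Filter.eventually_ge_atTop m0).and (Filter.eventually_ge_atTop 1)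
  have sc : ∀ (s : ℝ) (m : ℕ), 0 < s → vint (k := k) D Ξ s (fun _ _ => s ^ 2 * (- (m:ℝ)⁻¹)) (fun _ _ => s ^ 2 * (2 * (m:ℝ)⁻¹)) id =
      ENNReal.ofReal (s ^ (k * (k - 1) + k * Fintype.card κ)) * vm k D Ξ m := fun s m hs => by
    have := vint_scale hι D h hs 1 (fun _ _ => - (m:ℝ)⁻¹) (fun _ _ => 2 * (m:ℝ)⁻¹)
    rw [mul_one] at this; exact this
  constructor
  · set w := vint D Ξ 1 (fun i j => α i j / T ^ 2) (fun i j => β i j / T ^ 2) (phT T)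
    set er := ENNReal.ofReal (C * (ε⁻¹ * √(K / T)))
    have ha : 0 < (1 + ε) ^ (k * (k - 1) + k * Fintype.card κ) := by positivity
    have ha0 : ENNReal.ofReal ((1 + ε) ^ (k * (k - 1) + k * Fintype.card κ)) ≠ 0 := by simpa using ha
    have : ∀ᶠ m in Filter.atTop, (w - er) / ENNReal.ofReal ((1 + ε) ^ (k * (k - 1) + k * Fintype.card κ)) ≤ vm k D Ξ m := by
      filter_upwards [hev] with m hm
      refine ENNReal.div_le_of_le_mul' (tsub_le_iff_right.2 ?_)
      rw [← sc _ _ (by positivity)]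
      exact hC Ξ h 1 ε (K / T) _ _ _ _ _ _ zero_le_one (by norm_num) hε (by linarith) hΔ hΔ1 hβ1 (gen _ (by positivity) (by linarith) m hm.1 hm.2).1
        (gen _ (by positivity) (by linarith) m hm.1 hm.2).2 hph (fun q i => (hph q i).trans hΔ1)
    have h2 : (w - er) / ENNReal.ofReal ((1 + ε) ^ (k * (k - 1) + k * Fintype.card κ)) ≤ cc k D Ξ :=
      Filter.le_limsup_of_frequently_le' this.frequently
    rw [ENNReal.div_le_iff ha0 ENNReal.ofReal_ne_top, mul_comm] at h2
    exact tsub_le_iff_right.1 h2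
  · set w := vint D Ξ 1 (fun i j => α i j / T ^ 2) (fun i j => β i j / T ^ 2) (phT T)
    set er := ENNReal.ofReal (C * (ε⁻¹ * √(K / T)))
    have hs : 0 < 1 - ε := by linarith
    have ha : 0 < (1 - ε) ^ (k * (k - 1) + k * Fintype.card κ) := by positivity
    have ha0 : ENNReal.ofReal ((1 - ε) ^ (k * (k - 1) + k * Fintype.card κ)) ≠ 0 := by simpa using ha
    have : ∀ᶠ m in Filter.atTop, vm k D Ξ m ≤ (w + er) / ENNReal.ofReal ((1 - ε) ^ (k * (k - 1) + k * Fintype.card κ)) := by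
      filter_upwards [hev] with m hm
      rw [ENNReal.le_div_iff_mul_le (Or.inl ha0) (Or.inl ENNReal.ofReal_ne_top), mul_comm, ← sc _ _ hs]
      have := hC Ξ h (1 - ε) ε (K / T) (fun _ _ => (1 - ε) ^ 2 * (- (m:ℝ)⁻¹)) (fun _ _ => (1 - ε) ^ 2 * (2 * (m:ℝ)⁻¹))
        (fun i j => α i j / T ^ 2) (fun i j => β i j / T ^ 2) id (phT T) hs.le (by linarith) hε (by linarith) hΔ hΔ1 (gen _ hs (by linarith) m hm.1 hm.2).1 hβ1
        (fun i j => by rw [abs_sub_comm]; exact (gen _ hs (by linarith) m hm.1 hm.2).2 i j) (fun q i => by rw [norm_sub_rev]; exact hph q i) (fun q i => by simp)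
      rwa [sub_add_cancel] at this
    have h2 : cc k D Ξ ≤ (w + er) / ENNReal.ofReal ((1 - ε) ^ (k * (k - 1) + k * Fintype.card κ)) :=
      Filter.limsup_le_of_le (by isBoundedDefault) this
    rwa [ENNReal.le_div_iff_mul_le (Or.inl ha0) (Or.inl ENNReal.ofReal_ne_top), mul_comm] at h2
end

end

section
set_option linter.unusedSectionVars false
section
variable {p k : ℕ} {ι κ : Type} [Fintype ι] [Fintype κ] [DecidableEq κ] {R0 Λ : ℝ} {Ξ : UU ι κ → ℝ}

lemma pow_up (E : ℕ) {ε : ℝ} (h0 : 0 ≤ ε) (h1 : ε ≤ 1) : (1 + ε) ^ E ≤ 1 + 2 ^ E * ε := by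
  have : (1 + ε) ^ E ≤ 1 + (2 ^ E - 1) * ε := by
    induction E with
    | zero => simp
    | succ n ih =>
      have h2 : (1:ℝ) ≤ 2 ^ n := one_le_pow₀ (by norm_num)
      rw [pow_succ, pow_succ]
      nlinarith [mul_le_mul_of_nonneg_right ih (by linarith : 0 ≤ 1 + ε), mul_nonneg (by linarith : (0:ℝ) ≤ 2 ^ n - 1) (mul_nonneg h0 (by linarith : 0 ≤ 1 - ε))]
  nlinarith

lemma pow_dn (E : ℕ) {ε : ℝ} (h0 : 0 ≤ ε) (h1 : ε ≤ 1) : 1 - 2 ^ E * ε ≤ (1 - ε) ^ E := by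
  have := one_add_mul_le_pow (a := -ε) (by linarith) E
  have h2 : (E:ℝ) ≤ 2 ^ E := by exact_mod_cast Nat.lt_two_pow_self.le
  have : (1 - ε) = 1 + -ε := by ring
  rw [this]
  nlinarith

lemma mean_lim (hι : Fintype.card ι = 2 * (k - 1)) (D : Dat p ι κ) (hk2 : 2 ≤ k) (hk : k ≤ p + 1) (hl : 3 * k - 1 ≤ Fintype.card κ)
    (R0 Λ : ℝ) (hR0 : 0 < R0) (hL : 0 ≤ Λ) (α β : Fin k → Fin k → ℝ) (hβ : ∀ i j, 0 < β i j) :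
    ∃ C : ℝ, 0 ≤ C ∧ ∃ K : ℝ, 1 ≤ K ∧ ∀ Ξ : UU ι κ → ℝ, Nrm R0 Λ Ξ → cc k D Ξ ≠ ⊤ ∧ (cc k D Ξ).toReal ≤ C ∧ ∀ τ : ℝ, K ≤ τ →
      |(SS (ff D Ξ (τ ^ 4) α β)).toReal - pp β * (cc k D Ξ).toReal * (τ ^ 4) ^ (k * (k - 1) + k * Fintype.card κ)| ≤
        C * ((τ ^ 4) ^ (k * (k - 1) + k * Fintype.card κ) / τ) := by
  obtain ⟨C1, hC1⟩ := est_all hι D hk2 hk hl R0 Λ hR0.le β hβ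
  obtain ⟨C2, K, hK1, hC2⟩ := vm_bds hι D hk R0 Λ hR0 hL α β hβ
  have hp := pp_pos hβ
  set E := k * (k - 1) + k * Fintype.card κ with hE
  set M : ℝ := 2 ^ E * (C1 / pp β + C2 * 2) with hM
  have hM0 : 0 ≤ M := by positivity
  -- real bound for V
  have hV : ∀ Ξ : UU ι κ → ℝ, Nrm R0 Λ Ξ → ∀ T : ℝ, K ≤ T →
      vint D Ξ 1 (fun i j => α i j / T ^ 2) (fun i j => β i j / T ^ 2) (phT T) ≤ ENNReal.ofReal (C1 / pp β) := fun Ξ h T hT => by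
    have hT1 : 1 ≤ T := hK1.trans hT
    have a1 := (hC1 Ξ h T α hT1).1
    rw [mean_eq hι D h α β hβ (by linarith), ← hE, ENNReal.ofReal_mul hp.le, mul_right_comm] at a1
    have : ENNReal.ofReal (T ^ E) ≠ 0 := by simp; positivity
    have a2 := (ENNReal.mul_le_mul_iff_left this ENNReal.ofReal_ne_top).1 a1
    rw [ENNReal.ofReal_div_of_pos hp, ENNReal.le_div_iff_mul_le (by left; simpa using hp) (by left; exact ENNReal.ofReal_ne_top), mul_comm]
    simpa using a2
  have hc : ∀ Ξ : UU ι κ → ℝ, Nrm R0 Λ Ξ → cc k D Ξ ≤ ENNReal.ofReal M := fun Ξ h => by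
    have a := (hC2 Ξ h K (1/2) le_rfl (by norm_num) le_rfl).2
    have b := a.trans (add_le_add_left (hV Ξ h K le_rfl) _)
    rw [← ENNReal.ofReal_add (by positivity) (by positivity), div_self (by linarith), Real.sqrt_one] at b
    have h3 : ENNReal.ofReal M = ENNReal.ofReal (2 ^ E) * ENNReal.ofReal (C1 / pp β + C2 * 2) := by
      rw [hM, ENNReal.ofReal_mul (by positivity)]
    have h4 : cc k D Ξ = ENNReal.ofReal (2 ^ E) * (ENNReal.ofReal ((1 - 1/2) ^ E) * cc k D Ξ) := by
      rw [← mul_assoc, ← ENNReal.ofReal_mul (by positivity), ← mul_pow]; norm_num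
    rw [h3, h4]
    gcongr
    norm_num at b ⊢
    exact b
  refine ⟨M + pp β * (2 ^ E * M + C2 * √K), by positivity, K + 2, by linarith, fun Ξ h => ⟨ne_top_of_le_ne_top ENNReal.ofReal_ne_top (hc Ξ h), ?_, fun τ hτ => ?_⟩⟩
  · have : 0 ≤ pp β * (2 ^ E * M + C2 * √K) := by positivity
    have := ENNReal.toReal_le_of_le_ofReal hM0 (hc Ξ h)
    linarith
  · have hτ0 : 0 < τ := by linarith
    have hT : K ≤ τ ^ 4 := by
      have : τ ≤ τ ^ 4 := le_self_pow₀ (by linarith) (by norm_num)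
      linarith
    have hτi : τ⁻¹ ≤ 1/2 := by rw [one_div]; exact inv_anti₀ (by norm_num) (by linarith)
    have hτp : 0 < τ⁻¹ := by positivity
    obtain ⟨a, b⟩ := hC2 Ξ h (τ ^ 4) τ⁻¹ hT (by positivity) hτi
    have er : τ⁻¹⁻¹ * √(K / τ ^ 4) = √K / τ := by
      rw [Real.sqrt_div' _ (by positivity), show τ ^ 4 = (τ ^ 2) ^ 2 by ring, Real.sqrt_sq (by positivity)]; field_simp
    rw [er] at a b
    rw [mean_eq hι D h α β hβ (by positivity), ← hE]
    have hVT := hV Ξ h _ hT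
    set V := vint D Ξ 1 (fun i j => α i j / (τ ^ 4) ^ 2) (fun i j => β i j / (τ ^ 4) ^ 2) (phT (τ ^ 4))
    have hVn : V ≠ ⊤ := ne_top_of_le_ne_top ENNReal.ofReal_ne_top hVT
    have hcn : cc k D Ξ ≠ ⊤ := ne_top_of_le_ne_top ENNReal.ofReal_ne_top (hc Ξ h)
    have hcM := ENNReal.toReal_le_of_le_ofReal hM0 (hc Ξ h)
    have hc0 : 0 ≤ (cc k D Ξ).toReal := ENNReal.toReal_nonneg
    rw [← ENNReal.ofReal_toReal hVn, ← ENNReal.ofReal_toReal hcn, ← ENNReal.ofReal_mul (by positivity), ← ENNReal.ofReal_add (by positivity) (by positivity),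
      ENNReal.ofReal_le_ofReal_iff (by positivity)] at a
    rw [← ENNReal.ofReal_toReal hVn, ← ENNReal.ofReal_toReal hcn, ← ENNReal.ofReal_mul (pow_nonneg (by linarith) _), ← ENNReal.ofReal_add (by positivity) (by positivity),
      ENNReal.ofReal_le_ofReal_iff (by positivity)] at b
    rw [ENNReal.toReal_mul, ENNReal.toReal_ofReal (by positivity)]
    have u := pow_up E hτp.le (by linarith)
    have d := pow_dn E hτp.le (by linarith)
    have key : |V.toReal - (cc k D Ξ).toReal| ≤ (2 ^ E * M + C2 * √K) * τ⁻¹ := by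
      have u2 := mul_le_mul_of_nonneg_right u hc0
      have d2 := mul_le_mul_of_nonneg_right d hc0
      have e2 : C2 * (√K / τ) = C2 * √K * τ⁻¹ := by ring
      have e3 : 2 ^ E * τ⁻¹ * (cc k D Ξ).toReal ≤ 2 ^ E * τ⁻¹ * M := by gcongr
      rw [abs_le]; constructor <;> nlinarith
    have e1 : pp β * (τ ^ 4) ^ E * V.toReal - pp β * (cc k D Ξ).toReal * (τ ^ 4) ^ E = pp β * (τ ^ 4) ^ E * (V.toReal - (cc k D Ξ).toReal) := by ring
    rw [e1, abs_mul, abs_of_nonneg (by positivity)]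
    calc pp β * (τ ^ 4) ^ E * |V.toReal - (cc k D Ξ).toReal| ≤ pp β * (τ ^ 4) ^ E * ((2 ^ E * M + C2 * √K) * τ⁻¹) := by gcongr
      _ = pp β * (2 ^ E * M + C2 * √K) * ((τ ^ 4) ^ E / τ) := by ring
      _ ≤ _ := by gcongr; linarith
end

end

section
set_option linter.unusedSectionVars false
section
variable {p k : ℕ} {ι κ : Type} [Fintype ι] [Fintype κ] [DecidableEq κ] {R0 Λ : ℝ} {Ξ : UU ι κ → ℝ}

lemma b_sub_left (D : Dat p ι κ) (u u' v : UU ι κ) : D.b (u - u') v = D.b u v - D.b u' v := by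
  have := D.b_add_left (u - u') u' v
  rw [sub_add_cancel] at this; linarith

lemma pigeon (D : Dat p ι κ) (j : ℕ) (r : ℝ) (hr : 0 < r) : ∃ c : ℝ, 0 < c ∧ ∀ (ν : ℝ), 0 < ν → ν ≤ 1 → ∀ W : Fin j → UU ι κ, (∀ i, ‖W i‖ ≤ r) →
    ENNReal.ofReal (c * ν ^ j) ≤ volume {u : UU ι κ | ‖u‖ ≤ r ∧ ∀ i, |D.b u (W i)| < ν} := by
  classical
  have ih : (volume : Measure (UU ι κ)).IsAddHaarMeasure := Measure.prod.instIsAddHaarMeasure (volume : Measure (ι → ℝ)) (volume : Measure (κ → ℝ))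
  obtain ⟨n, hn, hb⟩ := D.b_bound
  have hB : 0 < volume (Metric.closedBall (0 : UU ι κ) (r/2)) := Metric.measure_closedBall_pos _ _ (by linarith)
  have hBt : volume (Metric.closedBall (0 : UU ι κ) (r/2)) ≠ ⊤ := measure_closedBall_lt_top.ne
  set v := (volume (Metric.closedBall (0 : UU ι κ) (r/2))).toReal with hv
  have hv0 : 0 < v := ENNReal.toReal_pos hB.ne' hBt
  set K := n * (r * r) with hK
  have hK0 : 0 < K := by positivity
  refine ⟨v / (2 * K + 5) ^ j, by positivity, fun ν hν hν1 W hW => ?_⟩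
  set tg := {u : UU ι κ | ‖u‖ ≤ r ∧ ∀ i, |D.b u (W i)| < ν} with htg
  set M : ℕ := ⌈K / ν⌉₊ + 1 with hM
  have hM1 : K / ν + 1 ≤ M := by rw [hM]; push_cast; linarith [Nat.le_ceil (K / ν)]
  have hM2 : (M : ℝ) ≤ K / ν + 2 := by rw [hM]; push_cast; linarith [Nat.ceil_lt_add_one (show 0 ≤ K / ν by positivity)]
  let cell : (Fin j → ℤ) → Set (UU ι κ) := fun z => {u | ‖u‖ ≤ r/2 ∧ ∀ i, ⌊D.b u (W i) / ν⌋ = z i}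
  let F : Finset (Fin j → ℤ) := Fintype.piFinset fun _ => Finset.Icc (-(M:ℤ)) M
  have hcov : Metric.closedBall (0 : UU ι κ) (r/2) ⊆ ⋃ z ∈ F, cell z := by
    intro u hu
    have hu' : ‖u‖ ≤ r / 2 := by simpa using hu
    refine Set.mem_biUnion (x := fun i => ⌊D.b u (W i) / ν⌋) ?_ (show u ∈ {u | _} from ⟨hu', fun i => rfl⟩)
    refine Fintype.mem_piFinset.2 fun i => Finset.mem_Icc.2 ?_
    have h1 : |D.b u (W i)| ≤ K := (hb _ _).trans (by rw [hK]; gcongr; linarith; exact hW i)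
    have h2 : |D.b u (W i) / ν| ≤ K / ν := by rw [abs_div, abs_of_pos hν]; gcongr
    obtain ⟨h3, h4⟩ := abs_le.1 h2
    constructor
    · rw [Int.le_floor]; push_cast; linarith
    · have := Int.floor_le (D.b u (W i) / ν)
      have : ((⌊D.b u (W i) / ν⌋ : ℤ) : ℝ) ≤ ((M : ℤ) : ℝ) := by push_cast; linarith
      exact_mod_cast this
  have hcell : ∀ z, volume (cell z) ≤ volume tg := by
    intro z
    by_cases hz : (cell z).Nonempty
    · obtain ⟨u0, h0⟩ := hz
      have hs : cell z ⊆ (fun u => u + (-u0)) ⁻¹' tg := by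
        intro u hu
        refine ⟨?_, fun i => ?_⟩
        · have := norm_sub_le u u0
          show ‖u + (-u0)‖ ≤ r
          rw [← sub_eq_add_neg]; linarith [hu.1, h0.1]
        · show |D.b (u + (-u0)) (W i)| < ν
          rw [← sub_eq_add_neg, b_sub_left]
          have := Int.abs_sub_lt_one_of_floor_eq_floor ((hu.2 i).trans (h0.2 i).symm)
          rw [← sub_div, abs_div, abs_of_pos hν, div_lt_one hν] at this
          exact this
      refine (measure_mono hs).trans ?_
      rw [measure_preimage_add_right]
    · rw [Set.not_nonempty_iff_eq_empty.1 hz]; simp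
  have hsum : volume (Metric.closedBall (0 : UU ι κ) (r/2)) ≤ ENNReal.ofReal (((2 * K + 5) / ν) ^ j) * volume tg := by
    refine (measure_mono hcov).trans ((measure_biUnion_finset_le _ _).trans ((Finset.sum_le_sum fun z _ => hcell z).trans ?_))
    rw [Finset.sum_const, nsmul_eq_mul]
    gcongr
    rw [← ENNReal.ofReal_natCast]
    apply ENNReal.ofReal_le_ofReal
    simp only [F, Fintype.card_piFinset, Finset.prod_const, Finset.card_univ, Fintype.card_fin, Int.card_Icc]
    push_cast
    have : (((M : ℤ) + 1 - -(M:ℤ)).toNat : ℝ) = 2 * M + 1 := by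
      have : ((M : ℤ) + 1 - -(M:ℤ)).toNat = 2 * M + 1 := by omega
      rw [this]; push_cast; ring
    rw [this]
    gcongr
    have : (2 * K + 5) / ν = 2 * (K / ν) + 5 / ν := by ring
    have : 5 ≤ 5 / ν := by rw [le_div_iff₀ hν]; linarith
    linarith
  have e1 : v / (2 * K + 5) ^ j * ν ^ j = v / ((2 * K + 5) / ν) ^ j := by
    rw [div_pow]; field_simp
  rw [e1, ENNReal.ofReal_div_of_pos (by positivity), hv, ENNReal.ofReal_toReal hBt]
  exact ENNReal.div_le_of_le_mul' hsum

def GG (D : Dat p ι κ) (k : ℕ) (r ν : ℝ) : Set (Fin k → UU ι κ) := {U | (∀ i, ‖U i‖ ≤ r) ∧ ∀ i j, i < j → |D.b (U i) (U j)| < ν}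

lemma GG_meas (D : Dat p ι κ) (r ν : ℝ) : MeasurableSet (GG D k r ν) := by
  have h1 : MeasurableSet {U : Fin k → UU ι κ | ∀ i, ‖U i‖ ≤ r} := by
    simp only [Set.ofPred_forall]
    exact MeasurableSet.iInter fun i => measurableSet_le (by fun_prop) (by fun_prop)
  have h2 : MeasurableSet {U : Fin k → UU ι κ | ∀ i j, i < j → |D.b (U i) (U j)| < ν} := by
    simp only [Set.ofPred_forall]
    refine MeasurableSet.iInter fun i => MeasurableSet.iInter fun j => MeasurableSet.iInter fun _ => ?_
    have : Continuous fun U : Fin k → UU ι κ => |D.b (U i) (U j)| :=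
      (D.b_continuous.comp (by fun_prop : Continuous fun U : Fin k → UU ι κ => (U i, U j))).abs
    exact measurableSet_lt this.measurable measurable_const
  exact h1.inter h2

lemma GG_low (D : Dat p ι κ) (r : ℝ) (hr : 0 < r) (k : ℕ) : ∃ c : ℝ, 0 < c ∧ ∀ (ν : ℝ), 0 < ν → ν ≤ 1 →
    ENNReal.ofReal (c * pp (fun _ _ : Fin k => ν)) ≤ volume (GG D k r ν) := by
  induction k with
  | zero =>
    refine ⟨1, one_pos, fun ν _ _ => ?_⟩
    have : GG D 0 r ν = Set.univ := by ext; simp [GG]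
    rw [this, volume_pi, Measure.pi_of_empty]; simp [pp]
  | succ k ih =>
    obtain ⟨c, hc, h⟩ := ih
    obtain ⟨d, hd, h'⟩ := pigeon D k r hr
    refine ⟨d * c, by positivity, fun ν hν hν1 => ?_⟩
    have hm : Measurable ((GG D (k+1) r ν).indicator (1 : (Fin (k+1) → UU ι κ) → ENNReal)) := measurable_const.indicator (GG_meas D r ν)
    have e0 := pp_succ (fun _ _ : Fin (k+1) => ν)
    simp only [Finset.prod_const, Finset.card_univ, Fintype.card_fin] at e0
    have hpk : 0 < pp (fun _ _ : Fin k => ν) := pp_pos fun _ _ => hν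
    have hm2 : Measurable (fun z : UU ι κ × (Fin k → UU ι κ) => (Fin.cons z.1 z.2 : Fin (k+1) → UU ι κ)) := by
      refine measurable_pi_lambda _ fun i => ?_
      refine Fin.cases ?_ (fun i => ?_) i
      · exact measurable_fst
      · exact (measurable_pi_apply i).comp measurable_snd
    rw [← lintegral_indicator_one (GG_meas D r ν), lint_cons _ _ hm, lintegral_lintegral_swap (f := fun y Z => (GG D (k+1) r ν).indicator 1 (Fin.cons y Z)) (hm.comp hm2).aemeasurable, e0]
    calc ENNReal.ofReal (d * c * (ν ^ k * pp (fun _ _ : Fin k => ν))) = ENNReal.ofReal (d * ν ^ k) * ENNReal.ofReal (c * pp (fun _ _ : Fin k => ν)) := by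
          rw [← ENNReal.ofReal_mul (by positivity)]; congr 1; ring
      _ ≤ ENNReal.ofReal (d * ν ^ k) * volume (GG D k r ν) := by gcongr; exact h ν hν hν1
      _ = ∫⁻ Z, ENNReal.ofReal (d * ν ^ k) * (GG D k r ν).indicator (1 : (Fin k → UU ι κ) → ENNReal) Z := by
          rw [lintegral_const_mul' _ _ ENNReal.ofReal_ne_top, lintegral_indicator_one (GG_meas D r ν)]
      _ ≤ _ := by
          refine lintegral_mono fun Z => ?_
          by_cases hZ : Z ∈ GG D k r ν
          · simp only [Set.indicator_of_mem hZ, Pi.one_apply, mul_one]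
            refine (h' ν hν hν1 Z hZ.1).trans ?_
            have ms : MeasurableSet {u : UU ι κ | ‖u‖ ≤ r ∧ ∀ i, |D.b u (Z i)| < ν} := by
              refine (measurableSet_le measurable_norm measurable_const).inter ?_
              change MeasurableSet {u : UU ι κ | ∀ i, |D.b u (Z i)| < ν}
              simp only [Set.ofPred_forall]
              refine MeasurableSet.iInter fun i => ?_
              have : Continuous fun u : UU ι κ => |D.b u (Z i)| :=
                (D.b_continuous.comp (by fun_prop : Continuous fun u : UU ι κ => (u, Z i))).abs
              exact measurableSet_lt this.measurable measurable_const
            rw [← lintegral_indicator_one ms]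
            refine lintegral_mono fun u => ?_
            by_cases hu : u ∈ {u : UU ι κ | ‖u‖ ≤ r ∧ ∀ i, |D.b u (Z i)| < ν}
            swap
            · rw [Set.indicator_of_notMem hu]; exact zero_le
            have : (Fin.cons u Z : Fin (k+1) → UU ι κ) ∈ GG D (k+1) r ν := by
              refine ⟨fun i => ?_, forall_lt_succ.2 ⟨fun j => ?_, fun i j hij => ?_⟩⟩
              · refine Fin.cases ?_ (fun i => ?_) i
                · exact hu.1
                · exact hZ.1 i
              · exact hu.2 j
              · exact hZ.2 i j hij
            simp only [Set.indicator_of_mem this, Set.indicator_of_mem hu, Pi.one_apply, le_refl]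
          · simp [Set.indicator_of_notMem hZ]

lemma cc_pos (D : Dat p ι κ) (h : Nrm R0 Λ Ξ) : cc k D Ξ ≠ 0 := by
  set r := 1 / (Λ + 1) with hr
  have hΛ := h.Lpos
  have hr0 : 0 < r := by positivity
  obtain ⟨c, hc, hh⟩ := GG_low D r hr0 k
  have hrg : ∀ u : UU ι κ, ‖u‖ ≤ r → Ξ u < 1 := fun u hu => by
    have h0 : Ξ 0 = 0 := by have := h.hom 2 0 (by norm_num); rw [smul_zero] at this; linarith
    have h1 := h.lip u 0
    rw [h0, sub_zero, sub_zero] at h1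
    have h2 : Λ * ‖u‖ ≤ Λ * r := by gcongr
    have h3 : Λ * r < 1 := by rw [hr, mul_one_div, div_lt_one (by linarith)]; linarith
    linarith [le_abs_self (Ξ u)]
  have key : ∀ m : ℕ, 1 ≤ m → ENNReal.ofReal (c / pp (fun _ _ : Fin k => (2:ℝ))) ≤ vm k D Ξ m := fun m hm => by
    have hm0 : (0:ℝ) < m := by exact_mod_cast hm
    have hm1 : (1:ℝ) ≤ m := by exact_mod_cast hm
    have hmi : 0 < (m:ℝ)⁻¹ := by positivity
    have e1 : pp (fun _ _ : Fin k => 2 * (m:ℝ)⁻¹) = pp (fun _ _ : Fin k => (2:ℝ)) * pp (fun _ _ : Fin k => (m:ℝ)⁻¹) := by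
      simp only [pp, Finset.prod_mul_distrib]
    have p2 : 0 < pp (fun _ _ : Fin k => (2:ℝ)) := pp_pos fun _ _ => by norm_num
    have pm : 0 < pp (fun _ _ : Fin k => (m:ℝ)⁻¹) := pp_pos fun _ _ => hmi
    set G := ff D Ξ 1 (fun _ _ : Fin k => - (m:ℝ)⁻¹) (fun _ _ => 2 * (m:ℝ)⁻¹) with hG
    have hGm : Measurable G := ff_meas D h _ _ _
    have mz : Measurable (fun z : (Fin k → ι → ℝ) × (Fin k → κ → ℝ) => zip z.1 z.2) := by unfold zip; fun_prop
    have e2 : vm k D Ξ m = (∫⁻ U : Fin k → UU ι κ, G U) / ENNReal.ofReal (pp (fun _ _ : Fin k => 2 * (m:ℝ)⁻¹)) := by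
      have mp := (volume_measurePreserving_arrowProdEquivProdArrow (ι → ℝ) (κ → ℝ) (Fin k)).symm
      have e4 : ∫⁻ U : Fin k → UU ι κ, G U = ∫⁻ z : (Fin k → ι → ℝ) × (Fin k → κ → ℝ), G (zip z.1 z.2) := (mp.lintegral_comp hGm).symm
      rw [e4, Measure.volume_eq_prod, lintegral_prod_symm (f := fun z : (Fin k → ι → ℝ) × (Fin k → κ → ℝ) => G (zip z.1 z.2)) (hGm.comp mz).aemeasurable]
      simp only [vm, vint, VV, VG, div_eq_mul_inv, id]
      rw [lintegral_mul_const]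
      · rfl
      · exact (hGm.comp mz).lintegral_prod_left'
    have e3 : volume (GG D k r (m:ℝ)⁻¹) ≤ ∫⁻ U : Fin k → UU ι κ, G U := by
      rw [← lintegral_indicator_one (GG_meas D r _)]
      refine lintegral_mono fun U => Set.indicator_le (fun U hU => ?_) U
      have a1 : U ∈ D.box (fun _ _ : Fin k => - (m:ℝ)⁻¹) (fun _ _ => 2 * (m:ℝ)⁻¹) := fun i j hij => by
        have := abs_lt.1 (hU.2 i j hij)
        constructor <;> linarith
      have a2 : U ∈ rg Ξ 1 := fun i => hrg _ (hU.1 i)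
      rw [hG, ff, Set.indicator_of_mem a1, Set.indicator_of_mem a2]
    rw [e2, ENNReal.le_div_iff_mul_le (by left; simpa using pp_pos fun _ _ => by positivity) (by left; exact ENNReal.ofReal_ne_top), ← ENNReal.ofReal_mul (by positivity), e1]
    refine le_trans (le_of_eq ?_) ((hh _ hmi (inv_le_one_of_one_le₀ hm1)).trans e3)
    congr 1; field_simp
  have p2 : 0 < pp (fun _ _ : Fin k => (2:ℝ)) := pp_pos fun _ _ => by norm_num
  have := Filter.le_limsup_of_frequently_le' (((Filter.eventually_ge_atTop 1).mono key).frequently)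
  have h3 : 0 < ENNReal.ofReal (c / pp (fun _ _ : Fin k => (2:ℝ))) := by simp; positivity
  exact (h3.trans_le this).ne'
end

end

section
set_option linter.unusedSectionVars false
section
variable {p k : ℕ} {ι κ : Type} [Fintype ι] [Fintype κ] [DecidableEq κ] [DecidableEq ι] {R0 Λ : ℝ} {Ξ : UU ι κ → ℝ}

abbrev dd (ι κ : Type) [Fintype ι] [Fintype κ] : ℕ := Fintype.card κ * Fintype.card ι
abbrev EX (k : ℕ) (κ : Type) [Fintype κ] : ℕ := k * (k - 1) + k * Fintype.card κ

lemma bc (hι : Fintype.card ι = 2 * (k - 1)) (D : Dat p ι κ) (hk2 : 2 ≤ k) (hk : k ≤ p + 1) (hl : 3 * k - 1 ≤ Fintype.card κ)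
    (hR0 : 0 ≤ R0) (α β : Fin k → Fin k → ℝ) (hβ : ∀ i j, 0 < β i j)
    (Ξ : (i : ℕ) → (ι → κ → Fin i) → UU ι κ → ℝ) (hΞ : ∀ i z, Nrm R0 Λ (Ξ i z)) (T : ℕ → ℝ) (K0 : ℕ) (m : ℕ) (hm : m = 4 * (dd ι κ + 2))
    (hT : ∀ i, K0 ≤ i → 1 ≤ T i ∧ T i ≤ 4 * (i:ℝ) ^ m ∧ (i:ℝ) ^ m ≤ 4 * T i) :
    ∀ᵐ X ∂(volume.restrict (cb ι κ)), ∃ K : ℕ, ∀ i, K ≤ i → ∀ z, NN (ff D (Ξ i z) (T i) α β) X ≠ ⊤ ∧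
      |(NN (ff D (Ξ i z) (T i) α β) X).toReal - (SS (ff D (Ξ i z) (T i) α β)).toReal| ≤ (i:ℝ) ^ (m * EX k κ) / i := by
  obtain ⟨C, hC⟩ := variance hι D hk2 hk hl R0 Λ hR0 β hβ
  set K1 := max K0 1 with hK1
  set E := EX k κ with hE
  let Dl : (i : ℕ) → (ι → κ → Fin i) → (ι → κ → ℝ) → ℝ := fun i z X => (NN (ff D (Ξ i z) (T i) α β) X).toReal - (SS (ff D (Ξ i z) (T i) α β)).toReal
  let w : ℕ → ℝ := fun i => ((i:ℝ) / (i:ℝ) ^ (m * E)) ^ 2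
  have mD : ∀ i z, Measurable (fun X => ENNReal.ofReal (w i * Dl i z X ^ 2)) := fun i z =>
    ENNReal.measurable_ofReal.comp (((((NN_meas (ff_meas D (hΞ i z) _ _ _)).ennreal_toReal).sub_const _).pow_const 2).const_mul _)
  let S : ℕ → (ι → κ → ℝ) → ENNReal := fun i X => if K1 ≤ i then ∑ z, ENNReal.ofReal (w i * Dl i z X ^ 2) else 0
  have mS : ∀ i, Measurable (S i) := fun i => by
    by_cases h : K1 ≤ i
    · simp only [S, h, if_true]; exact Finset.measurable_sum _ fun z _ => mD i z
    · simp only [S, h, if_false]; exact measurable_const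
  have bS : ∀ i, ∫⁻ X in cb ι κ, S i X ≤ ENNReal.ofReal (C * 4 ^ (2 * E + 1) * (1 / (i:ℝ) ^ 2)) := fun i => by
    by_cases h : K1 ≤ i
    swap
    · simp only [S, h, if_false, lintegral_zero]; exact zero_le
    have hi : 1 ≤ i := (le_max_right _ _).trans h
    have hi0 : (0:ℝ) < i := by exact_mod_cast hi
    obtain ⟨t1, t2, t3⟩ := hT i ((le_max_left _ _).trans h)
    simp only [S, h, if_true]
    rw [lintegral_finsetSum _ fun z _ => mD i z]
    have hz : ∀ z, ∫⁻ X in cb ι κ, ENNReal.ofReal (w i * Dl i z X ^ 2) ≤ ENNReal.ofReal (C * 4 ^ (2 * E + 1) * ((i:ℝ) ^ 2 / (i:ℝ) ^ m)) := fun z => by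
      have hv := (hC (Ξ i z) (hΞ i z) (T i) α t1).2.2
      have e1 : ∀ X, ENNReal.ofReal (w i * Dl i z X ^ 2) = ENNReal.ofReal (w i) * ENNReal.ofReal (Dl i z X ^ 2) := fun X => ENNReal.ofReal_mul (by positivity)
      simp_rw [e1]
      rw [lintegral_const_mul' _ _ ENNReal.ofReal_ne_top]
      set I := ∫⁻ X in cb ι κ, ENNReal.ofReal (Dl i z X ^ 2)
      have h1 : ENNReal.ofReal (T i) * I ≤ ENNReal.ofReal (C * T i ^ (2 * E)) := by
        rw [ENNReal.ofReal_mul (by positivity), ENNReal.ofReal_coe_nnreal]; exact hv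
      have h2 : I ≤ ENNReal.ofReal (C * T i ^ (2 * E) / T i) := by
        rw [ENNReal.ofReal_div_of_pos (by linarith), ENNReal.le_div_iff_mul_le (by left; simp; linarith) (by left; exact ENNReal.ofReal_ne_top), mul_comm]
        exact h1
      calc ENNReal.ofReal (w i) * I ≤ ENNReal.ofReal (w i) * ENNReal.ofReal (C * T i ^ (2 * E) / T i) := by gcongr
        _ = ENNReal.ofReal (w i * (C * T i ^ (2 * E) / T i)) := (ENNReal.ofReal_mul (by positivity)).symm
        _ ≤ _ := by
          apply ENNReal.ofReal_le_ofReal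
          calc w i * (C * T i ^ (2 * E) / T i) ≤ w i * (C * (4 * (i:ℝ) ^ m) ^ (2 * E) / ((i:ℝ) ^ m / 4)) := by
                gcongr; linarith
            _ = C * 4 ^ (2 * E + 1) * ((i:ℝ) ^ 2 / (i:ℝ) ^ m) := by
                simp only [w]
                rw [mul_pow, div_pow, ← pow_mul, ← pow_mul, show m * E * 2 = m * (2 * E) by ring, pow_succ]
                field_simp
                ring
    refine (Finset.sum_le_sum fun z _ => hz z).trans ?_
    rw [Finset.sum_const, nsmul_eq_mul, ← ENNReal.ofReal_natCast, ← ENNReal.ofReal_mul (by positivity)]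
    apply ENNReal.ofReal_le_ofReal
    have hcard : ((Finset.univ : Finset (ι → κ → Fin i)).card : ℝ) = (i:ℝ) ^ dd ι κ := by
      simp [Fintype.card_pi, pow_mul]
    rw [hcard]
    have : (i:ℝ) ^ dd ι κ * ((i:ℝ) ^ 2 / (i:ℝ) ^ m) ≤ 1 / (i:ℝ) ^ 2 := by
      rw [← mul_div_assoc, ← pow_add, div_le_div_iff₀ (by positivity) (by positivity), one_mul, ← pow_add]
      exact pow_le_pow_right₀ (by exact_mod_cast hi) (by omega)
    calc _ = C * 4 ^ (2 * E + 1) * ((i:ℝ) ^ dd ι κ * ((i:ℝ) ^ 2 / (i:ℝ) ^ m)) := by ring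
      _ ≤ _ := by gcongr
  have fin : ∫⁻ X in cb ι κ, ∑' i, S i X ≠ ⊤ := by
    rw [lintegral_tsum fun i => (mS i).aemeasurable]
    refine ne_top_of_le_ne_top ?_ (ENNReal.tsum_le_tsum bS)
    have : Summable (fun i : ℕ => C * 4 ^ (2 * E + 1) * (1 / (i:ℝ) ^ 2)) := (Real.summable_one_div_nat_pow.2 (by norm_num)).mul_left _
    exact this.tsum_ofReal_ne_top
  have h1 := ae_lt_top (Measurable.tsum mS) fin
  have h2 : ∀ᵐ X ∂(volume.restrict (cb ι κ)), ∀ i z, K1 ≤ i → NN (ff D (Ξ i z) (T i) α β) X ≠ ⊤ := by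
    refine ae_all_iff.2 fun i => ae_all_iff.2 fun z => ?_
    by_cases h : K1 ≤ i
    · filter_upwards [(hC (Ξ i z) (hΞ i z) (T i) α (hT i ((le_max_left _ _).trans h)).1).2.1] with X hX _ using hX
    · exact Filter.Eventually.of_forall fun X h' => absurd h' h
  filter_upwards [h1, h2] with X hX hX2
  have ht := ENNReal.tendsto_atTop_zero_of_tsum_ne_top hX.ne
  obtain ⟨K2, hK2⟩ := (ENNReal.tendsto_atTop_zero.1 ht) 1 one_pos
  refine ⟨max K1 K2, fun i hi z => ⟨hX2 i z ((le_max_left _ _).trans hi), ?_⟩⟩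
  have a1 := hK2 i ((le_max_right _ _).trans hi)
  have hKi : K1 ≤ i := (le_max_left _ _).trans hi
  have hi0 : (0:ℝ) < i := by exact_mod_cast (le_max_right _ _).trans hKi
  simp only [S, hKi, if_true] at a1
  have a2 := (Finset.single_le_sum (f := fun z => ENNReal.ofReal (w i * Dl i z X ^ 2)) (fun _ _ => zero_le) (Finset.mem_univ z)).trans a1
  rw [ENNReal.ofReal_le_one] at a2
  simp only [w] at a2
  rw [← mul_pow, sq_le_one_iff_abs_le_one, abs_mul, abs_of_nonneg (by positivity), div_mul_eq_mul_div, div_le_one (by positivity)] at a2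
  rw [le_div_iff₀ hi0, mul_comm]
  exact a2
end

end

section
set_option linter.unusedSectionVars false
section
variable {p k : ℕ} {ι κ : Type} [Fintype ι] [Fintype κ] [DecidableEq κ] [DecidableEq ι] {R0 Λ : ℝ} {Ξ : UU ι κ → ℝ}

def elin : UU ι κ →ₗ[ℝ] EuclideanSpace ℝ (ι ⊕ κ) :=
  (WithLp.linearEquiv 2 ℝ (ι ⊕ κ → ℝ)).symm.toLinearMap ∘ₗ
    { toFun := fun u => Sum.elim u.1 u.2
      map_add' := fun u v => by ext i; cases i <;> rfl
      map_smul' := fun s v => by ext i; cases i <;> rfl }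

def eu (u : UU ι κ) : ℝ := √(∑ a, u.1 a ^ 2 + ∑ b, u.2 b ^ 2)

lemma eu_eq (u : UU ι κ) : eu u = ‖elin u‖ := by
  rw [EuclideanSpace.norm_eq]; simp [eu, elin, Fintype.sum_sum_type]

lemma eu_low (u : UU ι κ) : ‖u‖ ≤ eu u := by
  have h : ∀ x : ℝ, x ^ 2 ≤ ∑ a, u.1 a ^ 2 + ∑ b, u.2 b ^ 2 → ‖x‖ ≤ eu u := fun x hx => Real.abs_le_sqrt hx
  have s1 : 0 ≤ ∑ a, u.1 a ^ 2 := Finset.sum_nonneg fun a _ => sq_nonneg _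
  have s2 : 0 ≤ ∑ b, u.2 b ^ 2 := Finset.sum_nonneg fun a _ => sq_nonneg _
  refine norm_prod_le_iff.2 ⟨?_, ?_⟩
  · refine (pi_norm_le_iff_of_nonneg (Real.sqrt_nonneg _)).2 fun a => h _ ?_
    have := Finset.single_le_sum (f := fun a => u.1 a ^ 2) (fun a _ => sq_nonneg _) (Finset.mem_univ a)
    linarith
  · refine (pi_norm_le_iff_of_nonneg (Real.sqrt_nonneg _)).2 fun a => h _ ?_
    have := Finset.single_le_sum (f := fun a => u.2 a ^ 2) (fun a _ => sq_nonneg _) (Finset.mem_univ a)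
    linarith

def mX (X : ι → κ → ℝ) (q : κ → ℝ) : ι → ℝ := fun a => ∑ b, X a b * q b
def nX (X : ι → κ → ℝ) (u : UU ι κ) : ℝ := eu (u.1 - mX X u.2, u.2)

lemma mX_bound (X : ι → κ → ℝ) (ε : ℝ) (hε : 0 ≤ ε) (hX : ∀ a b, |X a b| ≤ ε) (q : κ → ℝ) : ‖mX X q‖ ≤ Fintype.card κ * ε * ‖q‖ := by
  refine (pi_norm_le_iff_of_nonneg (by positivity)).2 fun a => ?_
  refine (norm_sum_le _ _).trans ?_
  calc ∑ b, ‖X a b * q b‖ ≤ ∑ b : κ, ε * ‖q‖ := by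
        refine Finset.sum_le_sum fun b _ => ?_
        rw [norm_mul]; gcongr; exact hX a b; exact norm_le_pi_norm q b
    _ = _ := by simp; ring

lemma nX_props : ∃ R0 Λ C0 : ℝ, 0 < R0 ∧ 0 ≤ Λ ∧ 0 ≤ C0 ∧ (∀ X ∈ cb ι κ, Nrm R0 Λ (nX X)) ∧
    ∀ X ∈ cb ι κ, ∀ Y ∈ cb ι κ, ∀ ε : ℝ, 0 ≤ ε → (∀ a b, |X a b - Y a b| ≤ ε) → ∀ u, nX X u ≤ (1 + C0 * ε) * nX Y u := by
  obtain ⟨N, hN, hb⟩ := lin_bound (elin (ι := ι) (κ := κ))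
  set l : ℝ := ((Fintype.card κ : ℕ) : ℝ) with hl
  have hl0 : 0 ≤ l := by positivity
  have tri : ∀ u v : UU ι κ, |eu u - eu v| ≤ N * ‖u - v‖ := fun u v => by
    rw [eu_eq, eu_eq]
    refine (abs_norm_sub_norm_le _ _).trans ?_
    rw [← map_sub]; exact hb _
  have hX1 : ∀ X ∈ cb ι κ, ∀ q, ‖mX X q‖ ≤ l * ‖q‖ := fun X hX q => by
    have := mX_bound X 1 zero_le_one (fun a b => by have := hX a b; rw [abs_of_nonneg this.1]; exact this.2.le) q
    rwa [mul_one] at this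
  have mXs : ∀ X : ι → κ → ℝ, ∀ q q', mX X (q - q') = mX X q - mX X q' := fun X q q' => by
    ext a; simp [mX, mul_sub, Finset.sum_sub_distrib]
  have nr : ∀ X ∈ cb ι κ, Nrm (1 + l) (N * (1 + l)) (nX X) := fun X hX => by
    refine ⟨by positivity, by positivity, fun s u hs => ?_, fun u v => ?_, fun u => ?_⟩
    · have : ((s • u).1 - mX X (s • u).2, (s • u).2) = s • ((u.1 - mX X u.2, u.2) : UU ι κ) := by
        ext a
        · simp only [mX, Prod.smul_fst, Prod.smul_snd, Pi.sub_apply, Pi.smul_apply, smul_eq_mul, mul_sub, Finset.mul_sum]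
          congr 1; exact Finset.sum_congr rfl fun b _ => by ring
        · simp
      rw [nX, this, eu_eq, map_smul, norm_smul, Real.norm_of_nonneg hs.le, ← eu_eq]; rfl
    · refine (tri _ _).trans ?_
      rw [mul_assoc]; gcongr
      have : ((u.1 - mX X u.2, u.2) : UU ι κ) - (v.1 - mX X v.2, v.2) = ((u - v).1 - mX X (u - v).2, (u - v).2) := by
        ext a
        · simp [mXs]; ring
        · simp
      rw [this]
      have h1 := norm_fst_le (u - v); have h2 := norm_snd_le (u - v)
      refine norm_prod_le_iff.2 ⟨?_, ?_⟩
      · refine (norm_sub_le _ _).trans ?_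
        have := hX1 X hX (u - v).2
        nlinarith
      · show ‖(u - v).2‖ ≤ _
        nlinarith [norm_nonneg (u - v)]
    · have h0 := eu_low (u.1 - mX X u.2, u.2)
      have h1 := (norm_fst_le ((u.1 - mX X u.2, u.2) : UU ι κ)).trans h0
      have h2 := (norm_snd_le ((u.1 - mX X u.2, u.2) : UU ι κ)).trans h0
      change ‖u.1 - mX X u.2‖ ≤ _ at h1
      change ‖u.2‖ ≤ _ at h2
      change _ ≤ nX X u at h1
      change _ ≤ nX X u at h2
      have h3 := hX1 X hX u.2
      have h4 := norm_le_norm_add_norm_sub' u.1 (mX X u.2)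
      have h5 := norm_nonneg u.2
      refine norm_prod_le_iff.2 ⟨?_, ?_⟩ <;> nlinarith
  refine ⟨1 + l, N * (1 + l), N * l * (1 + l), by positivity, by positivity, by positivity, nr, fun X hX Y hY ε hε hXY u => ?_⟩
  have h1 := (tri (u.1 - mX X u.2, u.2) (u.1 - mX Y u.2, u.2))
  have h2 : ((u.1 - mX X u.2, u.2) : UU ι κ) - (u.1 - mX Y u.2, u.2) = (- mX (X - Y) u.2, 0) := by
    ext a
    · simp [mX, sub_mul, Finset.sum_sub_distrib]
    · simp
  have h3 := mX_bound (X - Y) ε hε (fun a b => hXY a b) u.2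
  rw [h2] at h1
  have h4 : ‖((- mX (X - Y) u.2, 0) : UU ι κ)‖ ≤ l * ε * ‖u‖ := by
    refine norm_prod_le_iff.2 ⟨?_, ?_⟩
    · show ‖- mX (X - Y) u.2‖ ≤ _
      rw [norm_neg]; refine h3.trans ?_
      have := norm_snd_le u
      gcongr
    · simp; positivity
  have h5 := (nr Y hY).low u
  have h6 := (le_abs_self _).trans h1
  change nX X u - nX Y u ≤ _ at h6
  have h7 : N * ‖((- mX (X - Y) u.2, 0) : UU ι κ)‖ ≤ N * (l * ε * ((1 + l) * nX Y u)) := by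
    gcongr; exact h4.trans (by gcongr)
  linarith

lemma NN_mono {f g : (Fin k → UU ι κ) → ENNReal} (h : ∀ U, f U ≤ g U) (X : ι → κ → ℝ) : NN f X ≤ NN g X :=
  ENNReal.tsum_le_tsum fun _ => ENNReal.tsum_le_tsum fun _ => h _
lemma SS_mono {f g : (Fin k → UU ι κ) → ENNReal} (h : ∀ U, f U ≤ g U) : SS f ≤ SS g :=
  ENNReal.tsum_le_tsum fun _ => lintegral_mono fun _ => h _
lemma ff_mono (D : Dat p ι κ) {Ξ Ξ' : UU ι κ → ℝ} {T T' : ℝ} (h : ∀ u, Ξ u < T → Ξ' u < T') (α β : Fin k → Fin k → ℝ) (U : Fin k → UU ι κ) :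
    ff D Ξ T α β U ≤ ff D Ξ' T' α β U := by
  unfold ff
  refine Set.indicator_le_indicator ?_
  have hs : (rg Ξ T : Set (Fin k → UU ι κ)) ⊆ rg Ξ' T' := fun U hU i => h _ (hU i)
  exact Set.indicator_le_indicator_of_subset hs (fun _ => zero_le) U
end

end

section
set_option linter.unusedSectionVars false
section
variable {p k : ℕ} {ι κ : Type} [Fintype ι] [Fintype κ] [DecidableEq κ] [DecidableEq ι] {R0 Λ : ℝ} {Ξ : UU ι κ → ℝ}

lemma fin_real {N Np Nm Sp Sm V1 V2 A i s j C c C0 b : ℝ} {e : ℕ} (hb : 0 < b) (hc : 0 < c) (hcC : c ≤ C) (hC0 : 0 ≤ C0) (hA0 : 0 < A) (hi0 : 2 ≤ i)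
    (hji : i ≤ j) (h3 : 1 ≤ s) (h4 : s ≤ 2) (es : s = 1 + C0 * (1 / i)) (U1 : N ≤ Np) (U2 : Sp ≤ V1) (L1 : Nm ≤ N) (L2 : V2 ≤ Sm)
    (dp : |Np - Sp| ≤ A / i) (dm : |Nm - Sm| ≤ A / i) (M1 : |V1 - b * c * (s ^ e * A)| ≤ C * (s ^ e * A / (s * j)))
    (M2 : |V2 - b * c * (A / s ^ e)| ≤ C * (A / s ^ e / (j / s))) :
    |N - b * c * A| ≤ (b * C * (2 ^ e * C0) + C * 2 ^ e + 2 * C + 1) * (A / i) := by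
  have hC : 0 < C := hc.trans_le hcC
  have hi : 0 < i := by linarith
  have hj : 0 < j := by linarith
  have hs0 : 0 < s := by linarith
  have hjs : i / 2 ≤ j / s := by gcongr
  obtain ⟨G, hG⟩ : ∃ G, G = s ^ e := ⟨_, rfl⟩
  have g1 : 1 ≤ G := hG ▸ one_le_pow₀ h3
  have g2 : G ≤ 2 ^ e := by rw [hG]; gcongr
  have g3 : G ≤ 1 + 2 ^ e * C0 * (1 / i) := by
    have := pow_up e (ε := s - 1) (by linarith) (by linarith)
    rw [add_sub_cancel] at this
    have e : s - 1 = C0 * (1 / i) := by rw [es]; ring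
    rw [e] at this; rw [hG]; linarith
  rw [← hG] at M1 M2
  have M1' : C * (G * A / (s * j)) ≤ C * 2 ^ e * (A / i) := by
    rw [mul_assoc]; gcongr
    calc G * A / (s * j) ≤ 2 ^ e * A / i := by gcongr; nlinarith
      _ = _ := by ring
  have M2' : C * (A / G / (j / s)) ≤ 2 * C * (A / i) := by
    calc C * (A / G / (j / s)) ≤ C * (A / 1 / (i / 2)) := by gcongr
      _ = _ := by field_simp
  have hAi : 0 < A / i := by positivity
  have q0 : b * c * A * (2 ^ e * C0 * (1 / i)) ≤ b * C * (2 ^ e * C0) * (A / i) := by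
    calc _ ≤ b * C * A * (2 ^ e * C0 * (1 / i)) := by gcongr
      _ = _ := by ring
  have P1 : b * c * (G * A) ≤ b * c * A + b * C * (2 ^ e * C0) * (A / i) := by
    calc _ = b * c * A * G := by ring
      _ ≤ b * c * A * (1 + 2 ^ e * C0 * (1 / i)) := by gcongr
      _ ≤ _ := by linarith
  have P2 : b * c * A - b * C * (2 ^ e * C0) * (A / i) ≤ b * c * (A / G) := by
    have h7 : 1 - 2 ^ e * C0 * (1 / i) ≤ 1 / G := by
      rw [le_div_iff₀ (by linarith)]
      have : (1 - 2 ^ e * C0 * (1 / i)) * G ≤ (2 - G) * G := mul_le_mul_of_nonneg_right (by linarith) (by linarith)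
      nlinarith [sq_nonneg (G - 1)]
    calc _ ≤ b * c * A * (1 - 2 ^ e * C0 * (1 / i)) := by linarith
      _ ≤ b * c * A * (1 / G) := by gcongr
      _ = _ := by ring
  have B1 : 0 ≤ C * 2 ^ e * (A / i) := by positivity
  have B2 : 0 ≤ 2 * C * (A / i) := by positivity
  have e9 : (b * C * (2 ^ e * C0) + C * 2 ^ e + 2 * C + 1) * (A / i) = b * C * (2 ^ e * C0) * (A / i) + C * 2 ^ e * (A / i) + 2 * C * (A / i) + A / i := by ring
  rw [e9]
  rw [abs_le] at M1 M2 dp dm ⊢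
  constructor <;> linarith [M1.1, M1.2, M2.1, M2.2, dp.1, dp.2, dm.1, dm.2]

set_option maxHeartbeats 2000000 in
lemma main_X (hι : Fintype.card ι = 2 * (k - 1)) (D : Dat p ι κ) (hk2 : 2 ≤ k) (hk : k ≤ p + 1) (hl : 3 * k - 1 ≤ Fintype.card κ)
    (α β : Fin k → Fin k → ℝ) (hβ : ∀ i j, 0 < β i j) (m : ℕ) (hm : m = 4 * (dd ι κ + 2)) :
    ∀ᵐ X ∂(volume.restrict (cb ι κ)), 0 < (cc k D (nX X)).toReal ∧ ∃ K : ℕ, ∀ i : ℕ, K ≤ i → NN (ff D (nX X) ((i:ℝ) ^ m) α β) X ≠ ⊤ ∧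
      |(NN (ff D (nX X) ((i:ℝ) ^ m) α β) X).toReal - pp β * (cc k D (nX X)).toReal * ((i:ℝ) ^ m) ^ EX k κ| ≤ K * (((i:ℝ) ^ m) ^ EX k κ / i) := by
  obtain ⟨R0, Λ, C0, hR0, hΛ, hC0, nr, cmp⟩ := nX_props (ι := ι) (κ := κ)
  obtain ⟨C, hC, K, hK1, mean⟩ := mean_lim hι D hk2 hk hl R0 Λ hR0 hΛ α β hβ
  obtain ⟨C', var⟩ := variance hι D hk2 hk hl R0 Λ hR0.le β hβ
  have hp := pp_pos hβ
  set E := EX k κ with hE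
  let ctr : (i : ℕ) → (ι → κ → Fin i) → ι → κ → ℝ := fun i z a b => ((z a b : ℕ) : ℝ) / i
  have hctr : ∀ i z, ctr i z ∈ cb ι κ := fun i z a b => by
    have h1 : (z a b : ℕ) < i := (z a b).2
    have h2 : ((z a b : ℕ) : ℝ) < i := by exact_mod_cast h1
    exact ⟨by positivity, (div_lt_one (by linarith [(Nat.cast_nonneg (z a b : ℕ) : (0:ℝ) ≤ _)])).2 h2⟩
  let σ : ℕ → ℝ := fun i => 1 + C0 * (1 / i)
  obtain ⟨K0, hK0⟩ := exists_nat_ge (2 + C0 + 2 * K)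
  have hσ : ∀ i, K0 ≤ i → (2:ℝ) ≤ i ∧ 2 * K ≤ i ∧ 1 ≤ σ i ∧ σ i ≤ 2 := fun i hi => by
    have h1 : (K0:ℝ) ≤ i := by exact_mod_cast hi
    have hi0 : (0:ℝ) < i := by linarith
    refine ⟨by linarith, by linarith, ?_, ?_⟩
    · have : 0 ≤ C0 * (1 / (i:ℝ)) := by positivity
      simp only [σ]; linarith
    · have : C0 * (1 / (i:ℝ)) ≤ 1 := by rw [mul_one_div, div_le_one hi0]; linarith
      simp only [σ]; linarith
  have hpow : ∀ i, K0 ≤ i → 4 ≤ (i:ℝ) ^ m := fun i hi => by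
    obtain ⟨h1, _, _, _⟩ := hσ i hi
    have : (i:ℝ) ^ 2 ≤ (i:ℝ) ^ m := pow_le_pow_right₀ (by linarith) (by omega)
    nlinarith
  have bp := bc hι D hk2 hk hl hR0.le α β hβ (fun i z => nX (ctr i z)) (fun i z => nr _ (hctr i z)) (fun i => σ i ^ 2 * (i:ℝ) ^ m) K0 m hm
    (fun i hi => by
      obtain ⟨h1, _, h3, h4⟩ := hσ i hi
      have h5 := hpow i hi
      have h6 : σ i ^ 2 ≤ 4 := by nlinarith
      have h7 : 1 ≤ σ i ^ 2 := by nlinarith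
      refine ⟨by nlinarith, by nlinarith, by nlinarith⟩)
  have bm := bc hι D hk2 hk hl hR0.le α β hβ (fun i z => nX (ctr i z)) (fun i z => nr _ (hctr i z)) (fun i => (i:ℝ) ^ m / σ i ^ 2) K0 m hm
    (fun i hi => by
      obtain ⟨h1, _, h3, h4⟩ := hσ i hi
      have h5 := hpow i hi
      have h6 : σ i ^ 2 ≤ 4 := by nlinarith
      have h7 : 1 ≤ σ i ^ 2 := by nlinarith
      refine ⟨by rw [le_div_iff₀ (by linarith)]; linarith, by rw [div_le_iff₀ (by linarith)]; nlinarith, by rw [← mul_div_assoc, le_div_iff₀ (by linarith)]; nlinarith⟩)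
  filter_upwards [bp, bm, ae_restrict_mem cb_meas] with X ⟨Kp, hKp⟩ ⟨Km, hKm⟩ hX
  obtain ⟨hct, hcC, hmean⟩ := mean (nX X) (nr X hX)
  have hc0 := cc_pos (k := k) D (nr X hX)
  set c := (cc k D (nX X)).toReal with hc
  have hcp : 0 < c := ENNReal.toReal_pos hc0 hct
  refine ⟨hcp, ?_⟩
  set L : ℝ := pp β * C * (2 ^ (4 * E) * C0) + C * 2 ^ (4 * E) + 2 * C + 1 with hL
  obtain ⟨K3, hK3⟩ := exists_nat_ge L
  refine ⟨max (max K3 K0) (max Kp Km), fun i hi => ?_⟩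
  have hiK0 : K0 ≤ i := by have := (le_max_left _ _).trans hi; exact (le_max_right _ _).trans this
  have hiKp : Kp ≤ i := by have := (le_max_right _ _).trans hi; exact (le_max_left _ _).trans this
  have hiKm : Km ≤ i := by have := (le_max_right _ _).trans hi; exact (le_max_right _ _).trans this
  obtain ⟨h1, h2, h3, h4⟩ := hσ i hiK0
  have hi0 : (0:ℝ) < i := by linarith
  -- centre
  have hfl : ∀ a b, ⌊(i:ℝ) * X a b⌋₊ < i := fun a b => by
    rw [Nat.floor_lt (mul_nonneg hi0.le (hX a b).1)]
    nlinarith [(hX a b).2]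
  let z : ι → κ → Fin i := fun a b => ⟨_, hfl a b⟩
  have hz : ∀ a b, |X a b - ctr i z a b| ≤ 1 / i := fun a b => by
    have e1 := Nat.floor_le (mul_nonneg hi0.le (hX a b).1)
    have e2 := (Nat.lt_floor_add_one ((i:ℝ) * X a b)).le
    have e3 : X a b - ctr i z a b = ((i:ℝ) * X a b - (⌊(i:ℝ) * X a b⌋₊ : ℝ)) / i := by
      simp only [ctr, z]; field_simp
    rw [e3, abs_div, abs_of_pos hi0, abs_of_nonneg (by linarith)]
    gcongr; linarith
  have hz' : ∀ a b, |ctr i z a b - X a b| ≤ 1 / i := fun a b => by rw [abs_sub_comm]; exact hz a b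
  have c1 : ∀ u, nX X u ≤ σ i * nX (ctr i z) u := cmp X hX _ (hctr i z) (1 / i) (by positivity) hz
  have c2 : ∀ u, nX (ctr i z) u ≤ σ i * nX X u := cmp _ (hctr i z) X hX (1 / i) (by positivity) hz'
  obtain ⟨np, dp⟩ := hKp i hiKp z
  obtain ⟨nm, dm⟩ := hKm i hiKm z
  set s := σ i with hs
  set Y := nX (ctr i z) with hY
  set T := (i:ℝ) ^ m with hT
  have hT0 : 0 < T := by positivity
  have hT1 : 4 ≤ T := hpow i hiK0
  have hs0 : 0 < s := by linarith
  set j := (i:ℝ) ^ (dd ι κ + 2) with hj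
  have hjT : j ^ 4 = T := by rw [hj, ← pow_mul, hT, hm, mul_comm]
  have hji : (i:ℝ) ≤ j := le_self_pow₀ (by linarith) (by omega)
  have s2 : 1 ≤ s ^ 2 := one_le_pow₀ h3
  -- comparisons
  have u1 : NN (ff D (nX X) T α β) X ≤ NN (ff D Y (s ^ 2 * T) α β) X := NN_mono (ff_mono D (fun u hu => by
    calc Y u ≤ s * nX X u := c2 u
      _ < s * T := by gcongr
      _ ≤ s ^ 2 * T := by gcongr; nlinarith) α β) X
  have u2 : SS (ff D Y (s ^ 2 * T) α β) ≤ SS (ff D (nX X) ((s * j) ^ 4) α β) := SS_mono (ff_mono D (fun u hu => by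
    calc nX X u ≤ s * Y u := c1 u
      _ < s * (s ^ 2 * T) := by gcongr
      _ ≤ s * (s * (s ^ 2 * T)) := le_mul_of_one_le_left (by positivity) h3 |>.trans_eq (by ring)
      _ = (s * j) ^ 4 := by rw [mul_pow, hjT]; ring) α β)
  have l1 : NN (ff D Y (T / s ^ 2) α β) X ≤ NN (ff D (nX X) T α β) X := NN_mono (ff_mono D (fun u hu => by
    calc nX X u ≤ s * Y u := c1 u
      _ < s * (T / s ^ 2) := by gcongr
      _ = T / s := by field_simp
      _ ≤ T := div_le_self hT0.le h3) α β) X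
  have l2 : SS (ff D (nX X) ((j / s) ^ 4) α β) ≤ SS (ff D Y (T / s ^ 2) α β) := SS_mono (ff_mono D (fun u hu => by
    calc Y u ≤ s * nX X u := c2 u
      _ < s * (j / s) ^ 4 := by gcongr
      _ = T / s ^ 2 / s := by rw [div_pow, hjT]; field_simp
      _ ≤ T / s ^ 2 := div_le_self (by positivity) h3) α β)
  have hN : NN (ff D (nX X) T α β) X ≠ ⊤ := ne_top_of_le_ne_top np u1
  refine ⟨hN, ?_⟩
  have hsj : 1 ≤ s * j := by nlinarith
  have hjs : i / 2 ≤ j / s := by gcongr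
  have S1 : SS (ff D (nX X) ((s * j) ^ 4) α β) ≠ ⊤ := (var _ (nr X hX) _ α (one_le_pow₀ hsj)).1
  have S2 : SS (ff D Y (T / s ^ 2) α β) ≠ ⊤ := (var _ (nr _ (hctr i z)) _ α (by rw [le_div_iff₀ (by positivity)]; nlinarith)).1
  have U1 := ENNReal.toReal_mono np u1
  have U2 := ENNReal.toReal_mono S1 u2
  have L1 := ENNReal.toReal_mono hN l1
  have L2 := ENNReal.toReal_mono S2 l2
  have M1 := hmean (s * j) (by nlinarith)
  have M2 := hmean (j / s) (by linarith)
  have eA : (i:ℝ) ^ (m * E) = T ^ E := by rw [pow_mul]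
  set A := T ^ E with hA
  have dp : |(NN (ff D Y (s ^ 2 * T) α β) X).toReal - (SS (ff D Y (s ^ 2 * T) α β)).toReal| ≤ A / i := by rw [← eA]; exact dp
  have dm : |(NN (ff D Y (T / s ^ 2) α β) X).toReal - (SS (ff D Y (T / s ^ 2) α β)).toReal| ≤ A / i := by rw [← eA]; exact dm
  have hA0 : 0 < A := by positivity
  have e1 : ((s * j) ^ 4) ^ E = s ^ (4 * E) * A := by rw [mul_pow, mul_pow, hjT, ← pow_mul s]
  have e2 : ((j / s) ^ 4) ^ E = A / s ^ (4 * E) := by rw [div_pow, div_pow, hjT, ← pow_mul s]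
  change |_ - pp β * c * ((s * j) ^ 4) ^ E| ≤ C * (((s * j) ^ 4) ^ E / (s * j)) at M1
  change |_ - pp β * c * ((j / s) ^ 4) ^ E| ≤ C * (((j / s) ^ 4) ^ E / (j / s)) at M2
  rw [e1] at M1; rw [e2] at M2
  have hKL : L ≤ ((max (max K3 K0) (max Kp Km) : ℕ) : ℝ) := hK3.trans (by exact_mod_cast (le_max_left _ _).trans (le_max_left _ _))
  have hAi : 0 < A / i := by positivity
  exact (fin_real hp hcp hcC hC0 hA0 h1 hji h3 h4 rfl U1 U2 L1 L2 dp dm M1 M2).trans (mul_le_mul_of_nonneg_right hKL hAi.le)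
end

end

section
section
variable {I : Type} [Fintype I] [DecidableEq I]

def cns {p : ℕ} (x z : (I → ℝ) →ₗ[ℝ] ℝ) (L : (I → ℝ) →ₗ[ℝ] WW p) : (I → ℝ) →ₗ[ℝ] WW (p+1) where
  toFun u := Fin.cons (⟨x u, z u⟩ : ℂ) (L u)
  map_add' u v := by
    ext i; refine Fin.cases ?_ (fun i => ?_) i
    · simp; rfl
    · simp
  map_smul' r v := by
    ext i; refine Fin.cases ?_ (fun i => ?_) i
    · simp [Complex.ext_iff]
    · simp

abbrev e1 (i : I) : I → ℝ := Pi.single i 1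

lemma lin_exp (f : (I → ℝ) →ₗ[ℝ] ℝ) (u : I → ℝ) : f u = ∑ i, u i * f (e1 i) := by
  conv_lhs => rw [LinearMap.pi_apply_eq_sum_univ f u]
  refine Finset.sum_congr rfl fun i _ => ?_
  rw [smul_eq_mul]; congr 2; ext j; simp [Pi.single_apply, eq_comm]

lemma darb (B : (I → ℝ) →ₗ[ℝ] (I → ℝ) →ₗ[ℝ] ℝ) (ha : ∀ u v, B u v = - B v u) (hn : ∀ u, (∀ v, B u v = 0) → u = 0) :
    ∀ p : ℕ, 2 * p ≤ Fintype.card I → ∃ (S : Finset I) (L : (I → ℝ) →ₗ[ℝ] WW p) (B' : (I → ℝ) →ₗ[ℝ] (I → ℝ) →ₗ[ℝ] ℝ),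
      S.card = 2 * p ∧ (∀ u v, B u v = om (L u) (L v) + B' u v) ∧ (∀ u v, B' u v = - B' v u) ∧ (∀ i ∈ S, ∀ v, B' (e1 i) v = 0) ∧
      ∀ u, (∀ i, i ∉ S → u i = 0) → L u = 0 → u = 0 := by
  intro p
  induction p with
  | zero =>
    intro _
    refine ⟨∅, 0, B, rfl, fun u v => by simp [om], ha, by simp, fun u hu _ => funext fun i => hu i (by simp)⟩
  | succ p ih =>
    intro hp
    obtain ⟨S, L, B', hS, hB, ha', h0, hinj⟩ := ih (by omega)
    obtain ⟨i, j, hij⟩ : ∃ i j, B' (e1 i) (e1 j) ≠ 0 := by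
      by_contra! hc
      have hz : ∀ u v, B' u v = 0 := fun u v => by
        rw [lin_exp (B' u) v]
        refine Finset.sum_eq_zero fun j _ => ?_
        rw [ha', lin_exp (B' (e1 j)) u, Finset.sum_eq_zero fun i _ => by rw [hc, mul_zero]]; simp
      have : ¬ Function.Injective L := fun hL => by
        have := LinearMap.finrank_le_finrank_of_injective hL
        simp [Module.finrank_pi_fintype] at this
        omega
      apply this
      rw [← LinearMap.ker_eq_bot, LinearMap.ker_eq_bot']
      intro u hu
      refine hn u fun v => ?_
      rw [hB, hz, hu]; simp [om]
    set β := B' (e1 i) (e1 j) with hβ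
    have hii : ∀ u, B' u u = 0 := fun u => by linarith [ha' u u]
    have hiS : i ∉ S := fun h => hij (h0 i h _)
    have hjS : j ∉ S := fun h => hij (by rw [hβ, ha', h0 j h, neg_zero])
    have hne : i ≠ j := fun h => hij (by rw [hβ, h]; exact hii _)
    let x : (I → ℝ) →ₗ[ℝ] ℝ := B'.flip (e1 j)
    let z : (I → ℝ) →ₗ[ℝ] ℝ := β⁻¹ • B' (e1 i)
    have hx : ∀ u, x u = B' u (e1 j) := fun u => rfl
    have hz : ∀ u, z u = β⁻¹ * B' (e1 i) u := fun u => rfl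
    let B2 : (I → ℝ) →ₗ[ℝ] (I → ℝ) →ₗ[ℝ] ℝ := B' - (x.smulRight z - z.smulRight x)
    have hB2 : ∀ u v, B2 u v = B' u v - (x u * z v - z u * x v) := fun u v => by simp [B2]
    refine ⟨insert i (insert j S), cns x z L, B2, ?_, fun u v => ?_, fun u v => ?_, fun a hi v => ?_, fun u hu hL => ?_⟩
    · rw [Finset.card_insert_of_notMem (by simp [hne, hiS]), Finset.card_insert_of_notMem hjS, hS]; ring
    · simp only [cns, LinearMap.coe_mk, AddHom.coe_mk]
      rw [om_cons, hB, hB2]; ring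
    · rw [hB2, hB2, ha' u v]; ring
    · rw [hB2, hx, hx, hz, hz]
      simp only [Finset.mem_insert] at hi
      rcases hi with rfl | rfl | hi
      · rw [hii, ← hβ]; field_simp; ring
      · rw [hii, ← hβ, ha' v]; field_simp; ring
      · rw [h0 a hi, h0 a hi, ha' (e1 i) (e1 a), h0 a hi]; ring
    · have hc : ∀ a, cns x z L u a = 0 := fun a => by rw [hL]; rfl
      have c0 : (⟨x u, z u⟩ : ℂ) = 0 := hc 0
      have c1 : x u = 0 := congrArg Complex.re c0
      have c2 : z u = 0 := congrArg Complex.im c0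
      have c3 : L u = 0 := funext fun a => hc a.succ
      have ui : u i = 0 := by
        rw [lin_exp x u, Finset.sum_eq_single i] at c1
        · exact (mul_eq_zero.1 c1).resolve_right hij
        · intro a _ hai
          rw [hx]
          by_cases haS : a ∈ S
          · rw [h0 a haS, mul_zero]
          · by_cases haj : a = j
            · rw [haj, hii, mul_zero]
            · rw [hu a (by simp [hai, haj, haS]), zero_mul]
        · simp
      have uj : u j = 0 := by
        rw [lin_exp z u, Finset.sum_eq_single j] at c2
        · refine (mul_eq_zero.1 c2).resolve_right ?_
          rw [hz]; exact mul_ne_zero (inv_ne_zero hij) hij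
        · intro a _ haj
          rw [hz]
          by_cases haS : a ∈ S
          · rw [ha', h0 a haS]; simp
          · by_cases hai : a = i
            · rw [hai, hii]; simp
            · rw [hu a (by simp [hai, haj, haS]), zero_mul]
        · simp
      refine hinj u (fun a haS => ?_) c3
      by_cases hai : a = i
      · rw [hai, ui]
      · by_cases haj : a = j
        · rw [haj, uj]
        · exact hu a (by simp [hai, haj, haS])

def exL (P : I → Prop) [DecidablePred P] : ({i // P i} → ℝ) →ₗ[ℝ] (I → ℝ) where
  toFun u := fun i => if h : P i then u ⟨i, h⟩ else 0
  map_add' u v := by ext i; by_cases h : P i <;> simp [h]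
  map_smul' r v := by ext i; by_cases h : P i <;> simp [h]

def spl (S : Finset I) (v : I → ℝ) : UU {i // i ∈ S} {i // i ∉ S} := (fun i => v i, fun i => v i)

lemma dat_ex (B : (I → ℝ) →ₗ[ℝ] (I → ℝ) →ₗ[ℝ] ℝ) (ha : ∀ u v, B u v = - B v u) (hn : ∀ u, (∀ v, B u v = 0) → u = 0)
    (p : ℕ) (hp : 2 * p ≤ Fintype.card I) : ∃ S : Finset I, S.card = 2 * p ∧ ∃ D : Dat p {i // i ∈ S} {i // i ∉ S}, ∀ u v, B u v = D.b (spl S u) (spl S v) := by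
  obtain ⟨S, L, B', hS, hB, ha', h0, hinj⟩ := darb B ha hn p hp
  refine ⟨S, hS, ?_⟩
  let M := L ∘ₗ exL (fun i => i ∈ S)
  have hM : Function.Injective M := by
    rw [← LinearMap.ker_eq_bot, LinearMap.ker_eq_bot']
    intro u hu
    have := hinj _ (fun i hi => by simp [exL, hi]) hu
    ext i
    have h2 := congrFun this i.1
    simpa [exL] using h2
  have hd : Module.finrank ℝ ({i // i ∈ S} → ℝ) = Module.finrank ℝ (WW p) := by
    simp [Module.finrank_pi_fintype, hS]; ring
  let E := LinearEquiv.ofInjectiveOfFinrankEq M hM hd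
  have hE : ∀ u, E u = M u := fun u => rfl
  let J := exL (I := I) (fun i => i ∉ S)
  have hJ : ∀ u : I → ℝ, u = exL (fun i => i ∈ S) (spl S u).1 + J (spl S u).2 := fun u => by
    ext i; by_cases h : i ∈ S <;> simp [J, exL, spl, h]
  have hz : ∀ w v, B' (exL (fun i => i ∈ S) w) v = 0 := fun w v => by
    have := lin_exp (B'.flip v) (exL (fun i => i ∈ S) w)
    simp only [LinearMap.flip_apply] at this
    rw [this]
    refine Finset.sum_eq_zero fun i _ => ?_
    by_cases h : i ∈ S
    · rw [h0 i h, mul_zero]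
    · simp [exL, h]
  refine ⟨⟨E, L ∘ₗ J, (B'.compl₁₂ J J)⟩, fun u v => ?_⟩
  have hL : ∀ u : I → ℝ, L u = E (spl S u).1 + (L ∘ₗ J) (spl S u).2 := fun u => by
    conv_lhs => rw [hJ u, map_add]
    rfl
  rw [hB, Dat.b, hL u, hL v]
  congr 1
  conv_lhs => rw [hJ u, map_add, LinearMap.add_apply, hz, zero_add, hJ v, map_add, ha' _ (exL _ _), hz]
  simp
end

end

section
open Matrix MeasureTheory
section
variable {N : ℕ}
local notation "SLN" => Matrix.SpecialLinearGroup (Fin N) ℝ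

lemma ent_meas (i j : Fin N) : Measurable (fun g : SLN => (g : Matrix (Fin N) (Fin N) ℝ) i j) :=
  (measurable_pi_apply j).comp ((measurable_pi_apply i).comp measurable_subtype_coe)

lemma sl_meas {Ω : Type*} [MeasurableSpace Ω] {f : Ω → SLN} (h : ∀ i j, Measurable fun x => (f x : Matrix (Fin N) (Fin N) ℝ) i j) : Measurable f :=
  Measurable.subtype_mk (f := fun x => (f x : Matrix (Fin N) (Fin N) ℝ)) (measurable_pi_lambda _ fun i => measurable_pi_lambda _ fun j => h i j)

instance slMul : MeasurableMul₂ SLN := ⟨sl_meas fun i j => by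
  simp only [Matrix.SpecialLinearGroup.coe_mul, Matrix.mul_apply]
  exact Finset.measurable_sum _ fun l _ => ((ent_meas i l).comp measurable_fst).mul ((ent_meas l j).comp measurable_snd)⟩

instance slInv : MeasurableInv SLN := ⟨sl_meas fun i j => by
  simp only [Matrix.SpecialLinearGroup.coe_inv, Matrix.adjugate_apply, Matrix.det_apply]
  refine Finset.measurable_sum _ fun σ _ => Measurable.const_smul (Finset.measurable_prod _ fun l _ => ?_) _
  by_cases h : σ l = j
  · simp only [h, Matrix.updateRow_self]; exact measurable_const
  · simp only [Matrix.updateRow_ne h]; exact ent_meas _ _⟩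

lemma sl_sf (μ : Measure SLN) [μ.IsHaarMeasure] : SFinite μ := by
  have hc : IsClosed {A : Matrix (Fin N) (Fin N) ℝ | A.det = 1} :=
    isClosed_singleton.preimage (Continuous.matrix_det continuous_id)
  have he : Topology.IsClosedEmbedding ((↑) : SLN → Matrix (Fin N) (Fin N) ℝ) := hc.isClosedEmbedding_subtypeVal
  have i1 : SigmaCompactSpace (Matrix (Fin N) (Fin N) ℝ) := inferInstanceAs (SigmaCompactSpace (Fin N → Fin N → ℝ))
  have i2 : SigmaCompactSpace SLN := he.sigmaCompactSpace
  have : SigmaFinite μ := inferInstance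
  infer_instance
end

end

section
open Matrix MeasureTheory
section
variable {N : ℕ}
local notation "SLN" => Matrix.SpecialLinearGroup (Fin N) ℝ

abbrev sI (S : Finset (Fin N)) := {i // i ∈ S}
abbrev sK (S : Finset (Fin N)) := {i // i ∉ S}

def hS (S : Finset (Fin N)) (X : sI S → sK S → ℝ) : SLN :=
  ⟨(Matrix.fromBlocks 1 (Matrix.of X) 0 1).submatrix (Equiv.sumCompl (· ∈ S)).symm (Equiv.sumCompl (· ∈ S)).symm, by
    rw [Matrix.det_submatrix_equiv_self]; simp⟩

lemma hS_coe (S : Finset (Fin N)) (X : sI S → sK S → ℝ) : (hS S X : Matrix (Fin N) (Fin N) ℝ) =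
  (Matrix.fromBlocks 1 (Matrix.of X) 0 1).submatrix (Equiv.sumCompl (· ∈ S)).symm (Equiv.sumCompl (· ∈ S)).symm := rfl

lemma hS_add (S : Finset (Fin N)) (X Y : sI S → sK S → ℝ) : hS S (X + Y) = hS S X * hS S Y := by
  apply Subtype.ext
  rw [Matrix.SpecialLinearGroup.coe_mul, hS_coe, hS_coe, hS_coe, Matrix.submatrix_mul_equiv, Matrix.fromBlocks_multiply]
  congr 2 <;> simp [add_comm]

lemma hS_spl (S : Finset (Fin N)) (X : sI S → sK S → ℝ) (v : Fin N → ℝ) :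
    spl S ((hS S X : Matrix (Fin N) (Fin N) ℝ).mulVec v) = ((spl S v).1 + mX X (spl S v).2, (spl S v).2) := by
  rw [hS_coe, Matrix.submatrix_mulVec_equiv, Matrix.fromBlocks_mulVec]
  ext i
  · have : (Equiv.sumCompl (· ∈ S)).symm (i : Fin N) = Sum.inl i := by simp
    simp only [spl, Function.comp_apply, this, Sum.elim_inl, Matrix.one_mulVec]
    rfl
  · have : (Equiv.sumCompl (· ∈ S)).symm (i : Fin N) = Sum.inr i := by
      rw [Equiv.symm_apply_eq]; rfl
    simp only [spl, Function.comp_apply, this, Sum.elim_inr, Matrix.one_mulVec, Matrix.zero_mulVec, zero_add]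
    rfl

lemma hS_meas (S : Finset (Fin N)) : Measurable (hS S) := sl_meas fun i j => by
  simp only [hS_coe, Matrix.submatrix_apply]
  rcases (Equiv.sumCompl (· ∈ S)).symm i with a | a <;> rcases (Equiv.sumCompl (· ∈ S)).symm j with b | b <;>
    simp only [Matrix.fromBlocks_apply₁₁, Matrix.fromBlocks_apply₁₂, Matrix.fromBlocks_apply₂₁, Matrix.fromBlocks_apply₂₂, Matrix.of_apply] <;> fun_prop

lemma nul (μ : Measure SLN) [μ.IsHaarMeasure] {Z : Set SLN} (hZ : MeasurableSet Z) (S : Finset (Fin N)) (W : Set SLN)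
    (hW : ∀ g ∈ W, ∀ X, g * hS S X ∈ W) (h : ∀ g ∈ W, ∀ᵐ X ∂(volume.restrict (cb (sI S) (sK S))), g * hS S X ∉ Z) : μ (Z ∩ W) = 0 := by
  have i0 := sl_sf μ
  have i1 : (volume : Measure (sI S → sK S → ℝ)).IsAddHaarMeasure := Measure.pi.isAddHaarMeasure _
  have hm : Measurable (fun q : SLN × (sI S → sK S → ℝ) => Z.indicator (1 : SLN → ENNReal) (q.1 * hS S q.2)) :=
    (measurable_one.indicator hZ).comp (measurable_fst.mul ((hS_meas S).comp measurable_snd))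
  have hm1 : ∀ g : SLN, Measurable (fun X => Z.indicator (1 : SLN → ENNReal) (g * hS S X)) := fun g => hm.comp measurable_prodMk_left
  let F : SLN → ENNReal := fun g => ∫⁻ X, Z.indicator (1 : SLN → ENNReal) (g * hS S X)
  have hF : Measurable F := hm.lintegral_prod_right'
  have hinv : ∀ g X, F (g * hS S X) = F g := fun g X => by
    simp only [F, mul_assoc, ← hS_add]
    exact lintegral_add_left_eq_self (fun Y => Z.indicator (1 : SLN → ENNReal) (g * hS S Y)) X
  let W' : Set SLN := {g | F g = 0}
  have hW'm : MeasurableSet W' := hF (measurableSet_singleton 0)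
  have hWW : W ⊆ W' := fun g hg => by
    show ∫⁻ X, Z.indicator (1 : SLN → ENNReal) (g * hS S X) = 0
    rw [tile _ (hm1 g), ENNReal.tsum_eq_zero]
    intro P
    simp only [add_comm _ (fz P), hS_add, ← mul_assoc]
    rw [lintegral_eq_zero_iff (hm1 _)]
    filter_upwards [h _ (hW g hg (fz P))] with X hX
    exact Set.indicator_of_notMem hX _
  refine measure_mono_null (Set.inter_subset_inter_right Z hWW) ?_
  have hm2 : Measurable (fun q : SLN × (sI S → sK S → ℝ) => (Z ∩ W').indicator (1 : SLN → ENNReal) (q.1 * hS S q.2)) :=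
    (measurable_one.indicator (hZ.inter hW'm)).comp (measurable_fst.mul ((hS_meas S).comp measurable_snd))
  have key : ∫⁻ X, ∫⁻ g, (Z ∩ W').indicator (1 : SLN → ENNReal) (g * hS S X) ∂μ = 0 := by
    rw [← lintegral_lintegral_swap (f := fun g X => (Z ∩ W').indicator (1 : SLN → ENNReal) (g * hS S X)) hm2.aemeasurable]
    refine (lintegral_congr fun g => ?_).trans lintegral_zero
    by_cases hg : g ∈ W'
    · refine le_antisymm (le_trans (lintegral_mono fun X => ?_) (le_of_eq hg)) zero_le
      exact Set.indicator_le_indicator_of_subset Set.inter_subset_left (fun _ => zero_le) _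
    · refine (lintegral_congr fun X => ?_).trans lintegral_zero
      refine Set.indicator_of_notMem (fun hh => hg ?_) _
      have : F (g * hS S X) = 0 := hh.2
      rwa [hinv] at this
  rw [lintegral_eq_zero_iff (hm2.lintegral_prod_left')] at key
  obtain ⟨X, hX⟩ := key.exists
  rw [← measure_mul_right_null μ (hS S X)]
  have : ∫⁻ g, ((· * hS S X) ⁻¹' (Z ∩ W')).indicator (1 : SLN → ENNReal) g ∂μ = 0 := hX
  rwa [lintegral_indicator_one ((measurable_mul_const _) (hZ.inter hW'm))] at this
end

end

section
open Matrix MeasureTheory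
section
variable {n k : ℕ}

def cS (n k : ℕ) (g : SL2n n) (a b : Pairs k → ℝ) (T : ℝ) : Set (Fin k → (Fin (2*n) → ℤ)) :=
  {v : Fin k → (Fin (2*n) → ℤ) |
    (∀ p : Pairs k, sympG n g (fun j => ((v p.1.1 j : ℤ) : ℝ))
        (fun j => ((v p.1.2 j : ℤ) : ℝ)) ∈ Set.Ioo (a p) (b p)) ∧
    ∀ l, enorm2 (fun j => ((v l j : ℤ) : ℝ)) < T}

lemma Nc_eq (g : SL2n n) (a b : Pairs k → ℝ) (T : ℝ) : Ncount n k g a b T = (cS n k g a b T).ncard := rfl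

def NE (n k : ℕ) (g : SL2n n) (a b : Pairs k → ℝ) (T : ℝ) : ENNReal := ∑' v, (cS n k g a b T).indicator 1 v

lemma NE_toReal (g : SL2n n) (a b : Pairs k → ℝ) (T : ℝ) : (NE n k g a b T).toReal = Ncount n k g a b T := by
  have h : NE n k g a b T = ((cS n k g a b T).encard : ENNReal) := by
    rw [NE, ← tsum_subtype (cS n k g a b T) 1, ← ENNReal.tsum_set_one]; rfl
  rw [h, Nc_eq, Set.ncard]
  generalize (cS n k g a b T).encard = e
  induction e using ENat.recTopCoe <;> simp

lemma symp_meas (x y : Fin (2*n) → ℝ) : Measurable (fun g : SL2n n => sympG n g x y) := by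
  have := fun i j => ent_meas (N := 2*n) i j
  simp only [sympG, symp, dotProduct, Matrix.mulVec]
  refine Finset.measurable_sum _ fun i _ => Measurable.mul ?_ (Finset.measurable_sum _ fun j _ => Measurable.const_mul ?_ _)
  · exact Finset.measurable_sum _ fun j _ => (this i j).mul_const _
  · exact Finset.measurable_sum _ fun l _ => (this j l).mul_const _

lemma NE_meas (a b : Pairs k → ℝ) (T : ℝ) : Measurable (fun g : SL2n n => NE n k g a b T) := by
  refine Measurable.tsum fun v => ?_
  have : (fun g : SL2n n => (cS n k g a b T).indicator (1 : (Fin k → Fin (2*n) → ℤ) → ENNReal) v) = {g : SL2n n | v ∈ cS n k g a b T}.indicator 1 := by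
    ext g; by_cases h : v ∈ cS n k g a b T <;> simp [h]
  rw [this]
  refine measurable_one.indicator ?_
  have e : {g : SL2n n | v ∈ cS n k g a b T} = (⋂ p : Pairs k, (fun g : SL2n n => sympG n g (fun j => ((v p.1.1 j : ℤ) : ℝ))
        (fun j => ((v p.1.2 j : ℤ) : ℝ))) ⁻¹' Set.Ioo (a p) (b p)) ∩ {g | ∀ l, enorm2 (fun j => ((v l j : ℤ) : ℝ)) < T} := by
    ext g; simp [cS]
  rw [e]
  exact (MeasurableSet.iInter fun p => symp_meas _ _ measurableSet_Ioo).inter (MeasurableSet.const _)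

def alp (a : Pairs k → ℝ) (i j : Fin k) : ℝ := if h : i < j then a ⟨(i, j), h⟩ else 0
def be (a b : Pairs k → ℝ) (i j : Fin k) : ℝ := if h : i < j then b ⟨(i, j), h⟩ - a ⟨(i, j), h⟩ else 1

lemma be_pos {a b : Pairs k → ℝ} (h : ∀ p, a p < b p) (i j : Fin k) : 0 < be a b i j := by
  unfold be; split_ifs
  · linarith [h ⟨(i, j), ‹_›⟩]
  · exact one_pos

lemma pp_be (a b : Pairs k → ℝ) : pp (be a b) = ∏ p : Pairs k, (b p - a p) := by
  have h1 : ∏ p : Pairs k, (b p - a p) = ∏ p : Pairs k, be a b p.1.1 p.1.2 :=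
    Finset.prod_congr rfl fun p _ => by simp [be, p.2]
  rw [h1, ← Finset.prod_subtype (Finset.univ.filter fun x : Fin k × Fin k => x.1 < x.2) (by simp) (fun x => be a b x.1 x.2),
    Finset.prod_filter, Fintype.prod_prod_type, pp]
  refine Finset.prod_congr rfl fun i _ => ?_
  rw [← Finset.prod_filter]
  refine Finset.prod_congr (by ext; simp) fun _ _ => rfl

def eqv (k : ℕ) {N : ℕ} (S : Finset (Fin N)) : (Fin k → Fin N → ℤ) ≃ (Fin k → sK S → ℤ) × (Fin k → sI S → ℤ) where
  toFun v := (fun l i => v l i, fun l i => v l i)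
  invFun q := fun l i => if h : i ∈ S then q.2 l ⟨i, h⟩ else q.1 l ⟨i, h⟩
  left_inv v := by ext l i; by_cases h : i ∈ S <;> simp [h]
  right_inv q := by
    ext l i
    · simp [i.2]
    · simp

lemma eu_spl {N : ℕ} (S : Finset (Fin N)) (v : Fin N → ℝ) : eu (spl S v) = enorm2 v := by
  rw [eu, enorm2, ← Fintype.sum_subtype_add_sum_subtype (fun i => i ∈ S)]; congr! 2; exact Finset.sum_congr (by ext x; simp) fun _ _ => rfl

lemma cnt {p : ℕ} {S : Finset (Fin (2*n))} {g : SL2n n} (D : Dat p (sI S) (sK S)) (hD : ∀ u v, sympG n g u v = D.b (spl S u) (spl S v))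
    (X : sI S → sK S → ℝ) (a b : Pairs k → ℝ) (T : ℝ) : NN (ff D (nX X) T (alp a) (be a b)) X = NE n k (g * hS S X) a b T := by
  unfold NN aa NE
  rw [← ENNReal.tsum_prod (f := fun Q P => ff D (nX X) T (alp a) (be a b) (zip (fz P + aX X (fz Q)) (fz Q))), ← (eqv k S).tsum_eq]
  congr 1; ext v
  set U : Fin k → UU (sI S) (sK S) := zip (fz (eqv k S v).2 + aX X (fz (eqv k S v).1)) (fz (eqv k S v).1) with hU
  have hl : ∀ l, U l = spl S ((hS S X : Matrix (Fin (2*n)) (Fin (2*n)) ℝ).mulVec fun j => ((v l j : ℤ) : ℝ)) := fun l => by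
    rw [hS_spl]; rfl
  have h1 : ∀ i j, D.b (U i) (U j) = sympG n (g * hS S X) (fun l => ((v i l : ℤ) : ℝ)) (fun l => ((v j l : ℤ) : ℝ)) := fun i j => by
    rw [hl, hl, ← hD]; simp only [sympG, Matrix.SpecialLinearGroup.coe_mul, Matrix.mulVec_mulVec]
  have h2 : ∀ l, nX X (U l) = enorm2 (fun j => ((v l j : ℤ) : ℝ)) := fun l => by
    rw [hl, hS_spl, nX, ← eu_spl S]; simp
  have h3 : (U ∈ D.box (alp a) (be a b) ∧ U ∈ rg (nX X) T) ↔ v ∈ cS n k (g * hS S X) a b T := by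
    simp only [Dat.box, rg, cS, Set.mem_ofPred_eq, h1, h2]
    refine and_congr ⟨fun h p => ?_, fun h i j hij => ?_⟩ Iff.rfl
    · have := h p.1.1 p.1.2 p.2
      simpa [alp, be, p.2] using this
    · simpa [alp, be, hij] using h ⟨(i, j), hij⟩
  unfold ff
  by_cases hv : v ∈ cS n k (g * hS S X) a b T
  · obtain ⟨q1, q2⟩ := h3.2 hv
    rw [Set.indicator_of_mem hv, Set.indicator_of_mem q1, Set.indicator_of_mem q2]; rfl
  · rw [Set.indicator_of_notMem hv]
    by_cases q1 : U ∈ D.box (alp a) (be a b)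
    · rw [Set.indicator_of_mem q1, Set.indicator_of_notMem fun q2 => hv (h3.1 ⟨q1, q2⟩)]
    · rw [Set.indicator_of_notMem q1]

lemma inv_D {p : ℕ} {S : Finset (Fin (2*n))} {g : SL2n n} (D : Dat p (sI S) (sK S)) (hD : ∀ u v, sympG n g u v = D.b (spl S u) (spl S v))
    (X : sI S → sK S → ℝ) : ∃ D' : Dat p (sI S) (sK S), ∀ u v, sympG n (g * hS S X) u v = D'.b (spl S u) (spl S v) := by
  refine ⟨⟨D.L1, D.L2 + D.L1.toLinearMap ∘ₗ (Matrix.mulVecLin (Matrix.of X)), D.B⟩, fun u v => ?_⟩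
  have e : sympG n (g * hS S X) u v = sympG n g ((hS S X : Matrix (Fin (2*n)) (Fin (2*n)) ℝ).mulVec u) ((hS S X : Matrix (Fin (2*n)) (Fin (2*n)) ℝ).mulVec v) := by
    simp only [sympG, Matrix.SpecialLinearGroup.coe_mul, Matrix.mulVec_mulVec]
  have hm : ∀ q, Matrix.mulVecLin (Matrix.of X) q = mX X q := fun q => rfl
  rw [e, hD, hS_spl, hS_spl, Dat.b, Dat.b]
  simp only [map_add, LinearMap.add_apply, LinearMap.comp_apply, LinearEquiv.coe_coe, hm]
  congr 2 <;> abel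

lemma dat_g (g : SL2n n) (p : ℕ) (hp : p ≤ n) : ∃ S : Finset (Fin (2*n)), S.card = 2 * p ∧ ∃ D : Dat p (sI S) (sK S), ∀ u v, sympG n g u v = D.b (spl S u) (spl S v) := by
  let M : Matrix (Fin (2*n)) (Fin (2*n)) ℝ := g
  let B : (Fin (2*n) → ℝ) →ₗ[ℝ] (Fin (2*n) → ℝ) →ₗ[ℝ] ℝ := (Matrix.toLinearMap₂' ℝ (Jmat n)).compl₁₂ M.mulVecLin M.mulVecLin
  have hB : ∀ u v, B u v = sympG n g u v := fun u v => by
    simp only [B, LinearMap.compl₁₂_apply, Matrix.toLinearMap₂'_apply', sympG, symp]; rfl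
  have hJT : (Jmat n)ᵀ = - Jmat n := by
    ext i j; simp only [Matrix.transpose_apply, Matrix.neg_apply, Jmat]; split_ifs <;> (try omega) <;> simp
  have hJ2 : Jmat n * Jmat n = -1 := by
    ext i j
    let σ : Fin (2*n) := if h : (i:ℕ) < n then ⟨i + n, by omega⟩ else ⟨i - n, by omega⟩
    rw [Matrix.mul_apply, Finset.sum_eq_single σ, Matrix.neg_apply, Matrix.one_apply]
    · simp only [Jmat, σ, Fin.ext_iff]
      split_ifs <;> simp at * <;> omega
    · intro l _ hl
      have : (i:ℕ) + n ≠ l ∧ (l:ℕ) + n ≠ i := by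
        simp only [σ, ne_eq, Fin.ext_iff] at hl
        split_ifs at hl <;> simp at hl <;> omega
      simp [Jmat, this.1, this.2]
    · simp
  have alt : ∀ x y, symp n x y = - symp n y x := fun x y => by
    unfold symp
    rw [Matrix.dotProduct_mulVec, ← Matrix.mulVec_transpose, hJT, Matrix.neg_mulVec, neg_dotProduct, dotProduct_comm]
  have nd : ∀ x, (∀ y, symp n x y = 0) → x = 0 := fun x hx => by
    have h : ∀ y, symp n y x = 0 := fun y => by rw [alt, hx, neg_zero]
    have h1 : (Jmat n).mulVec x = 0 := dotProduct_eq_zero _ fun w => by rw [dotProduct_comm]; exact h w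
    have h2 : (Jmat n).mulVec ((Jmat n).mulVec x) = - x := by rw [Matrix.mulVec_mulVec, hJ2, Matrix.neg_mulVec, Matrix.one_mulVec]
    rw [h1, Matrix.mulVec_zero] at h2
    simpa using h2.symm
  have gg : ∀ y, M.mulVec ((g⁻¹ : SL2n n).1.mulVec y) = y := fun y => by
    rw [Matrix.mulVec_mulVec]
    have : M * (g⁻¹ : SL2n n).1 = ((g * g⁻¹ : SL2n n) : Matrix _ _ ℝ) := rfl
    rw [this]; simp
  have gg' : ∀ y, (g⁻¹ : SL2n n).1.mulVec (M.mulVec y) = y := fun y => by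
    rw [Matrix.mulVec_mulVec]
    have : (g⁻¹ : SL2n n).1 * M = ((g⁻¹ * g : SL2n n) : Matrix _ _ ℝ) := rfl
    rw [this]; simp
  obtain ⟨S, hS, D, hD⟩ := dat_ex B (fun u v => by rw [hB, hB]; exact alt _ _) (fun u hu => by
    have := nd (M.mulVec u) fun y => by
      have := hu ((g⁻¹ : SL2n n).1.mulVec y)
      rw [hB, sympG] at this
      change symp n (M.mulVec u) (M.mulVec _) = 0 at this
      rwa [gg] at this
    rw [← gg' u, this, Matrix.mulVec_zero]) p (by simp; omega)
  exact ⟨S, hS, D, fun u v => by rw [← hB, hD]⟩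
end

end

section
open Matrix MeasureTheory
section
variable {n k : ℕ}
open Filter Topology

def MN (n k : ℕ) : ℕ := 4 * ((2 * n - 2 * (k - 1)) * (2 * (k - 1)) + 2)
def EN (n k : ℕ) : ℕ := k * (k - 1) + k * (2 * n - 2 * (k - 1))
def cst (n k : ℕ) (g : SL2n n) : ℝ :=
  (limsup (fun i : ℕ => NE n k g 0 1 ((i:ℝ) ^ MN n k) / ENNReal.ofReal (((i:ℝ) ^ MN n k) ^ EN n k)) atTop).toReal

lemma cst_meas : Measurable (cst n k) :=
  (Measurable.limsup fun _ => (NE_meas _ _ _).div_const _).ennreal_toReal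

def good (n k : ℕ) (a b : Pairs k → ℝ) : Set (SL2n n) :=
  {g | 0 < cst n k g ∧ ∃ K : ℕ, ∀ i : ℕ, K ≤ i → |(Ncount n k g a b ((i:ℝ) ^ MN n k) : ℝ) - (∏ p : Pairs k, (b p - a p)) * cst n k g * ((i:ℝ) ^ MN n k) ^ EN n k|
    ≤ K * (((i:ℝ) ^ MN n k) ^ EN n k / i)}

lemma good_meas (a b : Pairs k → ℝ) : MeasurableSet (good n k a b) := by
  have e : good n k a b = {g | 0 < cst n k g} ∩ ⋃ K : ℕ, ⋂ i : ℕ, {g | K ≤ i → |(NE n k g a b ((i:ℝ) ^ MN n k)).toReal - (∏ p : Pairs k, (b p - a p)) * cst n k g * ((i:ℝ) ^ MN n k) ^ EN n k|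
    ≤ K * (((i:ℝ) ^ MN n k) ^ EN n k / i)} := by
    ext g; simp [good, NE_toReal]
  rw [e]
  refine (measurableSet_lt measurable_const cst_meas).inter (MeasurableSet.iUnion fun K => MeasurableSet.iInter fun i => ?_)
  by_cases h : K ≤ i
  · simp only [h, true_imp_iff]
    have := cst_meas (n := n) (k := k)
    exact measurableSet_le ((((NE_meas _ _ _).ennreal_toReal).sub ((this.const_mul _).mul_const _)).norm) measurable_const
  · simp [h]

lemma cst_eq {g : SL2n n} {c : ℝ} (hc : 0 < c) {K : ℕ} (h : ∀ i : ℕ, K ≤ i → NE n k g 0 1 ((i:ℝ) ^ MN n k) ≠ ⊤ ∧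
      |(NE n k g 0 1 ((i:ℝ) ^ MN n k)).toReal - c * ((i:ℝ) ^ MN n k) ^ EN n k| ≤ K * (((i:ℝ) ^ MN n k) ^ EN n k / i)) : cst n k g = c := by
  have t1 : Tendsto (fun i : ℕ => (NE n k g 0 1 ((i:ℝ) ^ MN n k)).toReal / ((i:ℝ) ^ MN n k) ^ EN n k) atTop (𝓝 c) := by
    rw [tendsto_iff_norm_sub_tendsto_zero]
    refine squeeze_zero' (Eventually.of_forall fun _ => norm_nonneg _) ?_ (tendsto_const_div_atTop_nhds_zero_nat (K:ℝ))
    filter_upwards [eventually_ge_atTop (max K 1)] with i hi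
    have hi0 : (0:ℝ) < i := by exact_mod_cast (le_max_right K 1).trans hi
    have hA : 0 < ((i:ℝ) ^ MN n k) ^ EN n k := by positivity
    have := (h i ((le_max_left _ _).trans hi)).2
    rw [Real.norm_eq_abs, ← mul_le_mul_iff_of_pos_right hA, ← abs_of_pos hA, ← abs_mul, abs_of_pos hA, sub_mul, div_mul_cancel₀ _ hA.ne']
    refine this.trans_eq (by ring)
  have t2 : Tendsto (fun i : ℕ => NE n k g 0 1 ((i:ℝ) ^ MN n k) / ENNReal.ofReal (((i:ℝ) ^ MN n k) ^ EN n k)) atTop (𝓝 (ENNReal.ofReal c)) := by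
    refine (ENNReal.tendsto_ofReal t1).congr' ?_
    filter_upwards [eventually_ge_atTop (max K 1)] with i hi
    have hi0 : (0:ℝ) < i := by exact_mod_cast (le_max_right K 1).trans hi
    rw [ENNReal.ofReal_div_of_pos (by positivity), ENNReal.ofReal_toReal (h i ((le_max_left _ _).trans hi)).1]
  rw [cst, t2.limsup_eq, ENNReal.toReal_ofReal hc.le]

lemma good_X (hk : 2 ≤ k) (hnk : k^2 + 3 ≤ 2*n) {S : Finset (Fin (2*n))} (hS' : S.card = 2 * (k - 1)) {g : SL2n n} (D : Dat (k-1) (sI S) (sK S))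
    (hD : ∀ u v, sympG n g u v = D.b (spl S u) (spl S v)) (a b : Pairs k → ℝ) (hab : ∀ p, a p < b p) :
    ∀ᵐ X ∂(volume.restrict (cb (sI S) (sK S))), g * hS S X ∈ good n k a b := by
  have h1 : Fintype.card (sI S) = 2 * (k - 1) := by simp [hS']
  have h2 : Fintype.card (sK S) = 2 * n - 2 * (k - 1) := by simp [Fintype.card_subtype_compl, hS']
  have h3 : 3 * k - 1 ≤ Fintype.card (sK S) := by
    rw [h2]
    have e : (k - 2) * (k - 3) + 5 * k = k ^ 2 + 6 := by
      obtain ⟨j, rfl⟩ := Nat.exists_eq_add_of_le hk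
      rcases j with _ | j
      · norm_num
      · have e1 : 2 + (j + 1) - 2 = j + 1 := by omega
        have e2 : 2 + (j + 1) - 3 = j := by omega
        rw [e1, e2]; ring
    omega
  have hm : MN n k = 4 * (dd (sI S) (sK S) + 2) := by rw [dd, h1, h2, MN]
  have hE : EX k (sK S) = EN n k := by show k * (k - 1) + k * Fintype.card (sK S) = _; rw [h2, EN]
  have A1 := main_X h1 D hk (by omega) h3 (alp 0) (be 0 1) (be_pos (fun p => by simp)) _ hm
  have A2 := main_X h1 D hk (by omega) h3 (alp a) (be a b) (be_pos hab) _ hm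
  filter_upwards [A1, A2] with X ⟨hc, K1, k1⟩ ⟨_, K2, k2⟩
  have e : cst n k (g * hS S X) = (cc k D (nX X)).toReal := cst_eq hc (K := K1) fun i hi => by
    have := k1 i hi
    rw [cnt D hD, pp_be, hE] at this
    simpa using this
  refine ⟨by rw [e]; exact hc, K2, fun i hi => ?_⟩
  have := (k2 i hi).2
  rwa [cnt D hD, pp_be, hE, NE_toReal, ← e] at this

lemma good_ae (hk : 2 ≤ k) (hnk : k^2 + 3 ≤ 2*n) (a b : Pairs k → ℝ) (hab : ∀ p, a p < b p) (μ : Measure (SL2n n)) [μ.IsHaarMeasure] :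
    ∀ᵐ g ∂μ, g ∈ good n k a b := by
  let W : Finset (Fin (2*n)) → Set (SL2n n) := fun S => {g | S.card = 2 * (k - 1) ∧ ∃ D : Dat (k-1) (sI S) (sK S), ∀ u v, sympG n g u v = D.b (spl S u) (spl S v)}
  have hs : {g | g ∉ good n k a b} ⊆ ⋃ S, (good n k a b)ᶜ ∩ W S := fun g hg => by
    obtain ⟨S, h1, h2⟩ := dat_g g (k - 1) (by nlinarith [Nat.sub_le k 1])
    exact Set.mem_iUnion.2 ⟨S, hg, h1, h2⟩
  rw [ae_iff]
  refine measure_mono_null hs (measure_iUnion_null fun S => ?_)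
  refine nul μ (good_meas a b).compl S (W S) (fun g hg X => ?_) fun g hg => ?_
  · obtain ⟨h1, D, hD⟩ := hg
    exact ⟨h1, inv_D D hD X⟩
  · obtain ⟨h1, D, hD⟩ := hg
    filter_upwards [good_X hk hnk h1 D hD a b hab] with X hX
    exact fun h => h hX
end

end

section
open Matrix MeasureTheory
section
variable {n k : ℕ}

lemma cS_fin (g : SL2n n) (a b : Pairs k → ℝ) (T : ℝ) : (cS n k g a b T).Finite := by
  refine Set.Finite.subset (Set.Finite.pi' fun _ : Fin k => Set.Finite.pi' fun _ : Fin (2*n) => Set.finite_Icc ⌊-T⌋ ⌈T⌉) fun v hv l j => ?_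
  have h1 : |((v l j : ℤ) : ℝ)| < T := by
    refine lt_of_le_of_lt (Real.abs_le_sqrt ?_) (hv.2 l)
    exact Finset.single_le_sum (f := fun j => ((v l j : ℤ) : ℝ) ^ 2) (fun _ _ => sq_nonneg _) (Finset.mem_univ j)
  rw [abs_lt] at h1
  exact ⟨Int.floor_le_iff.2 (by linarith), Int.le_ceil_iff.2 (by linarith)⟩

lemma Nc_mono (g : SL2n n) (a b : Pairs k → ℝ) {T T' : ℝ} (h : T ≤ T') : (Ncount n k g a b T : ℝ) ≤ Ncount n k g a b T' := by
  rw [Nc_eq, Nc_eq]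
  have hs : cS n k g a b T ⊆ cS n k g a b T' := fun v hv => ⟨hv.1, fun l => (hv.2 l).trans_le h⟩
  exact_mod_cast Set.ncard_le_ncard hs (cS_fin g a b _)

lemma interp {f : ℝ → ℝ} (hf : ∀ x y, x ≤ y → f x ≤ f y) {q : ℝ} (hq : 0 ≤ q) {m E : ℕ} (hm : 0 < m) (hE : 0 < E) {K : ℕ}
    (h : ∀ i : ℕ, K ≤ i → |f ((i:ℝ) ^ m) - q * ((i:ℝ) ^ m) ^ E| ≤ K * (((i:ℝ) ^ m) ^ E / i)) {δ : ℝ} (hδ : 1 - 1 / ((m:ℝ) * E) < δ)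
    {T : ℝ} (hT : ((K:ℝ) + 1) ^ m < T) : |f T - q * T ^ (E:ℝ)| ≤ (q + K + 1) * 2 ^ (m * E) * 2 * T ^ (δ * E) := by
  have hT1 : 1 ≤ T := (one_le_pow₀ (by linarith [(Nat.cast_nonneg K : (0:ℝ) ≤ K)])).trans hT.le
  have hT0 : 0 < T := by linarith
  have hm0 : (m:ℝ) ≠ 0 := by positivity
  set r := T ^ (1 / (m:ℝ)) with hr
  have hrm : r ^ m = T := by rw [hr, ← Real.rpow_natCast, ← Real.rpow_mul hT0.le, one_div_mul_cancel hm0, Real.rpow_one]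
  have hr0 : 0 < r := by positivity
  have hKr : (K:ℝ) + 1 < r := lt_of_pow_lt_pow_left₀ m hr0.le (by rw [hrm]; exact hT)
  set i := ⌊r⌋₊ with hi
  have i1 : (i:ℝ) ≤ r := Nat.floor_le hr0.le
  have i2 : r ≤ i + 1 := (Nat.lt_floor_add_one r).le
  have i3 : K + 1 ≤ i := Nat.le_floor (by push_cast; exact hKr.le)
  have i0 : (1:ℝ) ≤ i := by exact_mod_cast (by omega : 1 ≤ i)
  have b1 := h i (by omega)
  have b2 := h (i + 1) (by omega)
  push_cast at b2
  rw [← pow_mul] at b1 b2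
  have n1 : f ((i:ℝ) ^ m) ≤ f T := hf _ _ (by rw [← hrm]; gcongr)
  have n2 : f T ≤ f (((i:ℝ) + 1) ^ m) := hf _ _ (by rw [← hrm]; gcongr)
  have t0 : T ^ (E:ℝ) = r ^ (m * E) := by rw [Real.rpow_natCast, pow_mul, hrm]
  set e := m * E with he
  have t1 : (i:ℝ) ^ e ≤ T ^ (E:ℝ) := by rw [t0]; gcongr
  have t2 : T ^ (E:ℝ) ≤ ((i:ℝ) + 1) ^ e := by rw [t0]; gcongr
  set A := (i:ℝ) ^ e with hA
  have hA0 : 0 < A := by positivity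
  have u1 : ((i:ℝ) + 1) ^ e ≤ A + 2 ^ e * (A / i) := by
    have := pow_up e (ε := 1 / (i:ℝ)) (by positivity) (by rw [div_le_one (by linarith)]; exact i0)
    calc ((i:ℝ) + 1) ^ e = A * (1 + 1 / i) ^ e := by rw [hA, ← mul_pow]; congr 1; field_simp
      _ ≤ A * (1 + 2 ^ e * (1 / i)) := by gcongr
      _ = _ := by ring
  have u2 : ((i:ℝ) + 1) ^ e / (i + 1) ≤ 2 ^ e * (A / i) := by
    calc ((i:ℝ) + 1) ^ e / (i + 1) ≤ (i + i) ^ e / i := by gcongr; linarith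
      _ = _ := by rw [← two_mul, mul_pow, hA]; ring
  have two : (1:ℝ) ≤ 2 ^ e := one_le_pow₀ (by norm_num)
  have hAi : 0 < A / i := by positivity
  have w : |f T - q * T ^ (E:ℝ)| ≤ (q + K + 1) * 2 ^ e * (A / i) := by
    have q1 : q * A ≤ q * T ^ (E:ℝ) := by gcongr
    have q2 : q * T ^ (E:ℝ) ≤ q * (A + 2 ^ e * (A / i)) := by gcongr; exact t2.trans u1
    have q3 : q * ((i:ℝ) + 1) ^ e ≤ q * (A + 2 ^ e * (A / i)) := by gcongr
    have q4 : (K:ℝ) * (((i:ℝ) + 1) ^ e / (i + 1)) ≤ K * (2 ^ e * (A / i)) := by gcongr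
    have q5 : (K:ℝ) * (A / i) ≤ K * (2 ^ e * (A / i)) := by gcongr; exact le_mul_of_one_le_left hAi.le two
    have q6 : 0 ≤ 2 ^ e * (A / i) := by positivity
    have q7 : (q + K + 1) * 2 ^ e * (A / i) = q * (2 ^ e * (A / i)) + K * (2 ^ e * (A / i)) + 2 ^ e * (A / i) := by ring
    rw [q7]
    rw [abs_le] at b1 b2 ⊢
    constructor <;> linarith [b1.1, b2.2]
  refine w.trans ?_
  rw [mul_assoc _ (2:ℝ)]
  have fin : A / i ≤ 2 * T ^ (δ * E) := by
    calc A / i ≤ T ^ (E:ℝ) / (r / 2) := by gcongr; linarith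
      _ = 2 * (T ^ (E:ℝ) / r) := by field_simp
      _ = 2 * T ^ ((E:ℝ) - 1 / m) := by rw [hr, Real.rpow_sub hT0]
      _ ≤ _ := by
        have hE0 : (0:ℝ) < E := by exact_mod_cast hE
        have e1 : (1 - 1 / ((m:ℝ) * E)) * E = E - 1 / m := by field_simp
        have : (E:ℝ) - 1 / m ≤ δ * E := by rw [← e1]; gcongr
        gcongr
  gcongr
end

end

/-- Theorem 1.2 (generic quantitative Oppenheim for symplectic forms): for `k ≥ 2` and
`2n ≥ k² + 3` there is `δ₀ ∈ (0,1)` and a constant `c_g > 0` depending only on `g`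
such that for every `δ ∈ (δ₀,1)` and every collection of bounded intervals, for
Haar-almost every `g ∈ SL_{2n}(ℝ)`,
`N_{g,I}(T) = c_g ∏(b_{ij}-a_{ij}) T^{2nk-k(k-1)} + O(T^{δ(2nk-k(k-1))})`. -/
theorem stmt3 (n k : ℕ) (hk : 2 ≤ k) (hnk : k^2 + 3 ≤ 2*n) :
    ∃ δ0 ∈ Set.Ioo (0:ℝ) 1, ∃ c : SL2n n → ℝ,
      ∀ δ ∈ Set.Ioo δ0 (1:ℝ), ∀ a b : Pairs k → ℝ, (∀ p, a p < b p) →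
        ∀ μ : Measure (SL2n n), μ.IsHaarMeasure →
          ∀ᵐ g ∂μ, 0 < c g ∧ ∃ C > (0:ℝ), ∃ T0 > (0:ℝ), ∀ T > T0,
            |(Ncount n k g a b T : ℝ) - c g * (∏ p : Pairs k, (b p - a p)) * T ^ expo n k|
              ≤ C * T ^ (δ * expo n k) := by
  have hkn : k - 1 ≤ n := by nlinarith [Nat.sub_le k 1]
  have hEN : expo n k = (EN n k : ℝ) := by
    obtain ⟨j, rfl⟩ := Nat.exists_eq_add_of_le hkn
    obtain ⟨l, rfl⟩ : ∃ l, k = l + 1 := ⟨k - 1, by omega⟩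
    have h2 : 2 * (l + j) - 2 * l = 2 * j := by omega
    simp only [expo, EN, Nat.add_sub_cancel, h2]
    push_cast; ring
  have hE : 0 < EN n k := Nat.lt_of_lt_of_le (Nat.mul_pos (by omega) (by omega)) (Nat.le_add_right (k * (k - 1)) _)
  have hM : 8 ≤ MN n k := by unfold MN; omega
  have hM2 : (1:ℝ) < (MN n k : ℝ) * EN n k := by exact_mod_cast (by nlinarith : 1 < MN n k * EN n k)
  refine ⟨1 - 1 / ((MN n k : ℝ) * EN n k), ⟨?_, ?_⟩, cst n k, ?_⟩
  · rw [sub_pos, div_lt_one (by linarith)]; exact hM2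
  · have : 0 < 1 / ((MN n k : ℝ) * EN n k) := by positivity
    linarith
  intro δ hδ a b hab μ hμ
  filter_upwards [good_ae hk hnk a b hab μ] with g ⟨hc, K, hK⟩
  have hP : 0 < ∏ p : Pairs k, (b p - a p) := Finset.prod_pos fun p _ => by linarith [hab p]
  have hq : 0 < (∏ p : Pairs k, (b p - a p)) * cst n k g := mul_pos hP hc
  refine ⟨hc, ((∏ p : Pairs k, (b p - a p)) * cst n k g + K + 1) * 2 ^ (MN n k * EN n k) * 2, by positivity, ((K:ℝ) + 1) ^ MN n k, by positivity, fun T hT => ?_⟩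
  have := interp (f := fun T => (Ncount n k g a b T : ℝ)) (fun x y h => Nc_mono g a b h) hq.le (by omega) hE hK hδ.1 hT
  rw [hEN, mul_comm (cst n k g)]
  exact this
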